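/- Let μ be a Borel probability measure on ℝ, not a Dirac measure, with m_8(μ) < ∞, m_1(μ) = 0 and m_2(μ) = 1. Then there exist a constant c(μ) > 0 and n₁ = n₁(μ) ∈ ℕ such that for all n ≥ n₁: | χ(μ_n) − ( χ(w) − m_3(μ)²/(6n) ) | ≤ c(μ) n^{−6/5}, where χ(μ_n) = ∫_ℝ ∫_ℝ log|x−y| p_n(x) p_n(y) dx dy + 3/4 + (1/2) log 2π and χ(w) = (1/2) log(2π e). -/

import Mathlib

open MeasureTheory Complex Filter Set
open scoped Topology

noncomputable section

namespace FreeCLT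

def mom (μ : Measure ℝ) (k : ℕ) : ℝ := ∫ u, u ^ k ∂μ

def cauchy (μ : Measure ℝ) (z : ℂ) : ℂ := ∫ u, (z - (u : ℂ))⁻¹ ∂μ

def recip (μ : Measure ℝ) (z : ℂ) : ℂ := (cauchy μ z)⁻¹

def MemF (F : ℂ → ℂ) : Prop :=
  ∃ ν : Measure ℝ, IsProbabilityMeasure ν ∧ ∀ z : ℂ, 0 < z.im → F z = recip ν z

def Subord (μ : Measure ℝ) (n : ℕ) (Z : ℂ → ℂ) : Prop :=
  MemF Z ∧ ∀ z : ℂ, 0 < z.im →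
    z = (n : ℂ) * Z z - ((n : ℂ) - 1) * recip μ (Z z)

def IsBoxPow (μ : Measure ℝ) (n : ℕ) (Z : ℂ → ℂ) (ν : Measure ℝ) : Prop :=
  Subord μ n Z ∧ IsProbabilityMeasure ν ∧
    ∀ z : ℂ, 0 < z.im → recip ν z = recip μ (Z z)

def rescale (n : ℕ) (ν : Measure ℝ) : Measure ℝ :=
  ν.map (fun x => x / Real.sqrt n)

def HasDensity (ν : Measure ℝ) (p : ℝ → ℝ) : Prop :=
  Continuous p ∧ (∀ x, 0 ≤ p x) ∧
    ν = MeasureTheory.volume.withDensity (fun x => ENNReal.ofReal (p x))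

def aQ (μ : Measure ℝ) (n : ℕ) : ℝ := mom μ 3 / Real.sqrt n
def bQ (μ : Measure ℝ) (n : ℕ) : ℝ := (mom μ 4 - (mom μ 3) ^ 2 - 1) / n
def dQ (μ : Measure ℝ) (n : ℕ) : ℝ := (mom μ 4 - (mom μ 3) ^ 2) / n
def eQ (μ : Measure ℝ) (n : ℕ) : ℝ := (1 - bQ μ n) / Real.sqrt (1 - dQ μ n)

def pw (x : ℝ) : ℝ := (1 / (2 * Real.pi)) * Real.sqrt (max (4 - x ^ 2) 0)

def truncSet (n : ℕ) : Set ℝ := {u : ℝ | |u| ≤ Real.sqrt ((n : ℝ) - 1) / Real.pi}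

def Tfun (W : ℕ → ℂ → ℂ) (n : ℕ) (z : ℂ) : ℂ :=
  W n ((Real.sqrt (n : ℝ) : ℂ) * z) / (Real.sqrt (n : ℝ) : ℂ)

lemma iadd {α E : Type*} [MeasurableSpace α] [NormedAddCommGroup E] {μ : Measure α} {f g : α → E}
    (hf : Integrable f μ) (hg : Integrable g μ) : Integrable (fun x => f x + g x) μ := hf.add hg

lemma isub {α E : Type*} [MeasurableSpace α] [NormedAddCommGroup E] {μ : Measure α} {f g : α → E}
    (hf : Integrable f μ) (hg : Integrable g μ) : Integrable (fun x => f x - g x) μ := hf.sub hg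

lemma sub_ne {z : ℂ} (hz : 0 < z.im) (u : ℝ) : z - (u : ℂ) ≠ 0 := by
  intro h
  have := congrArg Complex.im h
  simp at this
  linarith

lemma im_le_norm_sub (z : ℂ) (u : ℝ) : z.im ≤ ‖z - (u : ℂ)‖ := by
  have := Complex.abs_im_le_norm (z - (u : ℂ))
  simp at this
  exact (le_abs_self _).trans this

lemma norm_inv_sub_le {z : ℂ} (hz : 0 < z.im) (u : ℝ) : ‖(z - (u : ℂ))⁻¹‖ ≤ z.im⁻¹ := by
  rw [norm_inv]
  exact inv_anti₀ hz (im_le_norm_sub z u)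

lemma meas_inv_sub (z : ℂ) : Measurable (fun u : ℝ => (z - (u : ℂ))⁻¹) := by
  fun_prop

lemma integrable_inv_sub (μ : Measure ℝ) [IsFiniteMeasure μ] {z : ℂ} (hz : 0 < z.im) :
    Integrable (fun u : ℝ => (z - (u : ℂ))⁻¹) μ :=
  Integrable.of_bound (meas_inv_sub z).aestronglyMeasurable z.im⁻¹
    (Eventually.of_forall fun u => norm_inv_sub_le hz u)

lemma inv_sub_im (z : ℂ) (u : ℝ) : ((z - (u : ℂ))⁻¹).im = -(z.im / ‖z - (u : ℂ)‖ ^ 2) := by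
  rw [Complex.inv_im, Complex.normSq_eq_norm_sq]
  simp
  ring

lemma cauchy_im (μ : Measure ℝ) [IsFiniteMeasure μ] {z : ℂ} (hz : 0 < z.im) :
    (cauchy μ z).im = -∫ u : ℝ, z.im / ‖z - (u : ℂ)‖ ^ 2 ∂μ := by
  unfold cauchy
  have := (integral_im (𝕜 := ℂ) (integrable_inv_sub μ hz))
  simp only [RCLike.im_to_complex] at this
  rw [← this, ← integral_neg]
  simp_rw [inv_sub_im]

lemma integrable_pois (μ : Measure ℝ) [IsFiniteMeasure μ] {z : ℂ} (hz : 0 < z.im) :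
    Integrable (fun u : ℝ => z.im / ‖z - (u : ℂ)‖ ^ 2) μ := by
  have := ((integrable_inv_sub μ hz).im).neg
  refine this.congr (Eventually.of_forall fun u => ?_)
  simp
  rw [Complex.normSq_eq_norm_sq]
  ring

lemma cauchy_im_neg (μ : Measure ℝ) [IsProbabilityMeasure μ] {z : ℂ} (hz : 0 < z.im) :
    (cauchy μ z).im < 0 := by
  rw [cauchy_im μ hz, neg_lt_zero]
  have hp : ∀ u : ℝ, 0 < z.im / ‖z - (u : ℂ)‖ ^ 2 := fun u => by
    have := norm_pos_iff.mpr (sub_ne hz u)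
    positivity
  rw [integral_pos_iff_support_of_nonneg (fun u => (hp u).le) (integrable_pois μ hz)]
  have : Function.support (fun u : ℝ => z.im / ‖z - (u : ℂ)‖ ^ 2) = univ := by
    ext u; simp only [Function.mem_support, mem_univ, iff_true]; exact (hp u).ne'
  rw [this]; simp

lemma cauchy_ne (μ : Measure ℝ) [IsProbabilityMeasure μ] {z : ℂ} (hz : 0 < z.im) :
    cauchy μ z ≠ 0 := by
  intro h
  have := cauchy_im_neg μ hz
  simp [h] at this

lemma recip_im_pos (μ : Measure ℝ) [IsProbabilityMeasure μ] {z : ℂ} (hz : 0 < z.im) :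
    0 < (recip μ z).im := by
  unfold recip
  rw [Complex.inv_im]
  have := cauchy_im_neg μ hz
  have h2 := Complex.normSq_pos.mpr (cauchy_ne μ hz)
  exact div_pos (by linarith) h2

lemma cs_pow (μ : Measure ℝ) [IsProbabilityMeasure μ] (k : ℕ)
    (hk : Integrable (fun u : ℝ => u ^ (2 * k)) μ) (f : ℝ → ℂ) (hf : Measurable f) (B : ℝ)
    (hB : ∀ u, ‖f u‖ ≤ B) :
    ‖∫ u : ℝ, ((u : ℂ)) ^ k * f u ∂μ‖ ≤ √(mom μ (2 * k)) * √(∫ u, ‖f u‖ ^ 2 ∂μ) := by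
  refine (norm_integral_le_integral_norm _).trans ?_
  have h1 : MemLp (fun u : ℝ => ‖(u : ℂ) ^ k‖) (ENNReal.ofReal 2) μ := by
    rw [show ENNReal.ofReal 2 = 2 by simp]
    rw [memLp_two_iff_integrable_sq (by fun_prop)]
    refine hk.congr (Eventually.of_forall fun u => ?_)
    simp [← pow_mul]
    rw [mul_comm k 2, pow_mul, pow_mul, sq_abs]
  have h2 : MemLp (fun u : ℝ => ‖f u‖) (ENNReal.ofReal 2) μ := by
    refine MemLp.of_bound hf.norm.aestronglyMeasurable B (Eventually.of_forall fun u => ?_)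
    simpa using hB u
  have := integral_mul_le_Lp_mul_Lq_of_nonneg (μ := μ) (p := 2) (q := 2)
    (Real.HolderConjugate.two_two) (f := fun u : ℝ => ‖(u : ℂ) ^ k‖) (g := fun u => ‖f u‖)
    (Eventually.of_forall fun u => by positivity) (Eventually.of_forall fun u => by positivity) h1 h2
  simp only [norm_mul]
  refine this.trans (le_of_eq ?_)
  rw [Real.sqrt_eq_rpow, Real.sqrt_eq_rpow]
  congr 2
  · unfold mom
    refine integral_congr_ae (Eventually.of_forall fun u => ?_)
    simp [← pow_mul]
    rw [mul_comm k 2, pow_mul, pow_mul, sq_abs]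
  · refine integral_congr_ae (Eventually.of_forall fun u => ?_)
    simp

lemma int_pow (μ : Measure ℝ) [IsProbabilityMeasure μ]
    (h8 : Integrable (fun u : ℝ => u ^ 8) μ) (k : ℕ) (hk : k ≤ 8) :
    Integrable (fun u : ℝ => |u| ^ k) μ := by
  refine Integrable.mono' (h8.add (integrable_const (1 : ℝ)))
    (by fun_prop) (Eventually.of_forall fun u => ?_)
  simp only [Pi.add_apply, Real.norm_eq_abs, abs_pow, abs_abs]
  have e : u ^ 8 = |u| ^ 8 := by rw [show 8 = 2 * 4 from rfl, pow_mul, pow_mul, sq_abs]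
  rw [e]
  rcases le_total |u| 1 with h | h
  · have := pow_le_one₀ (n := k) (abs_nonneg u) h
    have := pow_nonneg (abs_nonneg u) 8
    linarith
  · have := pow_le_pow_right₀ h hk
    linarith

set_option maxHeartbeats 1000000 in
lemma layer1 (μ : Measure ℝ) [IsProbabilityMeasure μ]
    (h8 : Integrable (fun u : ℝ => u ^ 8) μ)
    (h1 : mom μ 1 = 0) (h2 : mom μ 2 = 1) :
    ∃ K : ℝ, 1 ≤ K ∧ ∀ w : ℂ, 0 < w.im → ∃ S : ℝ, 0 ≤ S ∧
      (recip μ w).im = w.im * (1 + S) ∧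
      ‖w - recip μ w‖ ≤ √S ∧
      ‖w * (w - recip μ w) - 1‖ ≤ K * √S ∧
      ‖w ^ 2 * (w - recip μ w) - w - (mom μ 3 : ℂ)‖ ≤ K * √S ∧
      (1 ≤ ‖w‖ → S ≤ 1 → S ≤ (1 + K / ‖w‖) / ‖w‖ ^ 2 + K / (‖w‖ ^ 6 * w.im ^ 2)) := by
  have ipc : ∀ k ≤ 8, Integrable (fun u : ℝ => u ^ k) μ := fun k hk => by
    refine (int_pow μ h8 k hk).mono (by fun_prop) (Eventually.of_forall fun u => ?_)
    simp
  have ipz : ∀ k ≤ 8, Integrable (fun u : ℝ => (u : ℂ) ^ k) μ := fun k hk => by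
    refine (int_pow μ h8 k hk).mono (by fun_prop) (Eventually.of_forall fun u => ?_)
    simp
  have momc : ∀ k, ∫ u : ℝ, (u : ℂ) ^ k ∂μ = (mom μ k : ℂ) := fun k => by
    unfold mom
    rw [← integral_complex_ofReal]
    simp
  set A3 : ℝ := ∫ u : ℝ, |u| ^ 3 ∂μ with hA3
  set A1 : ℝ := ∫ u : ℝ, |u| ^ 1 ∂μ with hA1
  set A8 : ℝ := ∫ u : ℝ, |u| ^ 8 ∂μ with hA8
  set A6 : ℝ := ∫ u : ℝ, |u| ^ 6 ∂μ with hA6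
  have A3p : 0 ≤ A3 := integral_nonneg fun u => by positivity
  have A1p : 0 ≤ A1 := integral_nonneg fun u => by positivity
  have A8p : 0 ≤ A8 := integral_nonneg fun u => by positivity
  have A6p : 0 ≤ A6 := integral_nonneg fun u => by positivity
  set K0 : ℝ := 1 + √(mom μ 4) + √(mom μ 6) with hK0
  have k4 := Real.sqrt_nonneg (mom μ 4)
  have k6 := Real.sqrt_nonneg (mom μ 6)
  refine ⟨(1 + K0) ^ 2 + 12 * A3 + 12 * A1 + 128 * A8 + 128 * A6, by nlinarith, ?_⟩
  have hKK : K0 ≤ (1 + K0) ^ 2 + 12 * A3 + 12 * A1 + 128 * A8 + 128 * A6 := by nlinarith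
  intro w hw
  have hG := cauchy_ne μ hw
  set G := cauchy μ w with hGdef
  have hFG : recip μ w = G⁻¹ := rfl
  set F := recip μ w with hF
  set φ := w - F with hφ
  let f : ℝ → ℂ := fun u => F * (w - (u : ℂ))⁻¹ - 1
  have hfm : Measurable f := by fun_prop
  set B : ℝ := ‖F‖ * w.im⁻¹ + 1
  have hfB : ∀ u, ‖f u‖ ≤ B := fun u => by
    refine (norm_sub_le _ _).trans ?_
    rw [norm_mul, norm_one]
    have := mul_le_mul_of_nonneg_left (norm_inv_sub_le hw u) (norm_nonneg F)
    simp only [B]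
    linarith
  have hfi : Integrable f μ := Integrable.of_bound hfm.aestronglyMeasurable B (Eventually.of_forall hfB)
  have hpf : ∀ k ≤ 8, Integrable (fun u : ℝ => (u : ℂ) ^ k * f u) μ := fun k hk => by
    exact (ipz k hk).mul_bdd (c := B) hfm.aestronglyMeasurable (Eventually.of_forall hfB)
  have f0 : ∫ u, f u ∂μ = 0 := by
    simp only [f]
    rw [integral_sub ((integrable_inv_sub μ hw).const_mul F) (integrable_const _),
      integral_const_mul]
    simp only [integral_const, probReal_univ, one_smul]
    change F * cauchy μ w - 1 = 0
    rw [hFG, ← hGdef, inv_mul_cancel₀ hG, sub_self]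
  have hrec : ∀ u : ℝ, (u : ℂ) * f u = w * f u + φ - u := fun u => by
    have := sub_ne hw u
    simp only [f, hφ]
    field_simp
    ring
  have frec : ∀ k, k ≤ 6 → ∫ u : ℝ, (u : ℂ) ^ (k + 1) * f u ∂μ
      = w * (∫ u : ℝ, (u : ℂ) ^ k * f u ∂μ) + φ * (mom μ k : ℂ) - (mom μ (k + 1) : ℂ) := fun k hk => by
    have e : ∀ u : ℝ, (u : ℂ) ^ (k + 1) * f u
        = w * ((u : ℂ) ^ k * f u) + φ * (u : ℂ) ^ k - (u : ℂ) ^ (k + 1) := fun u => by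
      rw [pow_succ, mul_assoc, hrec]; ring
    simp_rw [e]
    rw [integral_sub (iadd ((hpf k (by omega)).const_mul w) ((ipz k (by omega)).const_mul φ))
      (ipz (k+1) (by omega)), integral_add ((hpf k (by omega)).const_mul w)
      ((ipz k (by omega)).const_mul φ), integral_const_mul, integral_const_mul, momc, momc]
  have m0 : mom μ 0 = 1 := by simp [mom]
  have i1 : ∫ u : ℝ, (u : ℂ) ^ 1 * f u ∂μ = φ := by
    rw [frec 0 (by norm_num)]; simp [f0, m0, h1]
  have i2 : ∫ u : ℝ, (u : ℂ) ^ 2 * f u ∂μ = w * φ - 1 := by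
    rw [frec 1 (by norm_num), i1]; simp [h1, h2]
  have i3 : ∫ u : ℝ, (u : ℂ) ^ 3 * f u ∂μ = w * (w * φ - 1) + φ - (mom μ 3 : ℂ) := by
    rw [frec 2 (by norm_num), i2]; simp [h2]
  set S : ℝ := ∫ u, ‖f u‖ ^ 2 ∂μ with hS
  have S0 : 0 ≤ S := integral_nonneg fun u => by positivity
  have c1 : ‖φ‖ ≤ √S := by
    have := cs_pow μ 1 (ipc 2 (by norm_num)) f hfm B hfB
    rw [i1, show 2 * 1 = 2 from rfl, h2] at this
    simpa using this
  have c2 : ‖w * φ - 1‖ ≤ √(mom μ 4) * √S := by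
    have := cs_pow μ 2 (ipc 4 (by norm_num)) f hfm B hfB
    rwa [i2] at this
  have c3 : ‖w * (w * φ - 1) + φ - (mom μ 3 : ℂ)‖ ≤ √(mom μ 6) * √S := by
    have := cs_pow μ 3 (ipc 6 (by norm_num)) f hfm B hfB
    rwa [i3] at this
  have sS := Real.sqrt_nonneg S
  refine ⟨S, S0, ?_, c1, ?_, ?_, ?_⟩
  · have e : ∀ u : ℝ, ‖f u‖ ^ 2 = ‖F‖ ^ 2 / w.im * (w.im / ‖w - (u : ℂ)‖ ^ 2)
        - (2 * (F * (w - (u : ℂ))⁻¹ - 1).re + 1) := fun u => by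
      have h3 : ‖f u‖ ^ 2 = ‖F * (w - (u : ℂ))⁻¹‖ ^ 2 - (2 * (F * (w - (u : ℂ))⁻¹ - 1).re + 1) := by
        simp only [f]
        rw [← Complex.normSq_eq_norm_sq, ← Complex.normSq_eq_norm_sq, Complex.normSq_apply, Complex.normSq_apply]
        simp only [Complex.sub_re, Complex.sub_im, Complex.one_re, Complex.one_im]
        ring
      rw [h3, norm_mul, norm_inv]
      have := norm_pos_iff.mpr (sub_ne hw u)
      field_simp
    have hre : ∫ u : ℝ, (f u).re ∂μ = 0 := by
      have := integral_re (𝕜 := ℂ) hfi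
      simp only [RCLike.re_to_complex] at this
      rw [this, f0]; simp
    have hSe : S = ‖F‖ ^ 2 / w.im * (-(cauchy μ w).im) - 1 := by
      rw [hS]
      simp_rw [e]
      have hfr : Integrable (fun u : ℝ => (f u).re) μ := hfi.re
      rw [integral_sub ((integrable_pois μ hw).const_mul _)
        (iadd (hfr.const_mul 2) (integrable_const 1)), integral_const_mul,
        integral_add (hfr.const_mul 2) (integrable_const 1), integral_const_mul]
      change _ - (2 * ∫ u : ℝ, (f u).re ∂μ + _) = _
      rw [hre, cauchy_im μ hw]
      simp
    rw [hSe, hFG, Complex.inv_im, norm_inv, Complex.normSq_eq_norm_sq, ← hGdef]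
    have := norm_pos_iff.mpr hG
    field_simp
    ring
  · refine c2.trans (mul_le_mul_of_nonneg_right ?_ sS)
    linarith
  · have : w ^ 2 * φ - w - (mom μ 3 : ℂ) = (w * (w * φ - 1) + φ - (mom μ 3 : ℂ)) - φ := by ring
    rw [this]
    refine (norm_sub_le _ _).trans ?_
    have : ‖w * (w * φ - 1) + φ - (mom μ 3 : ℂ)‖ + ‖φ‖ ≤ K0 * √S := by
      rw [hK0]; nlinarith [mul_nonneg k4 sS]
    refine this.trans (mul_le_mul_of_nonneg_right hKK sS)
  · intro hw1 hS1
    have sS1 : √S ≤ 1 := by simpa using Real.sqrt_le_sqrt hS1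
    have hφ1 : ‖φ‖ ≤ 1 := c1.trans sS1
    have wp : 0 < ‖w‖ := by linarith
    have hφw : ‖w‖ * ‖φ‖ ≤ K0 := by
      have : w * φ = (w * φ - 1) + 1 := by ring
      rw [← norm_mul, this]
      refine (norm_add_le _ _).trans ?_
      rw [norm_one, hK0]
      nlinarith
    have hfu : ∀ u : ℝ, f u = ((u : ℂ) - φ) * (w - (u : ℂ))⁻¹ := fun u => by
      have := sub_ne hw u
      simp only [f, hφ]
      field_simp
      ring
    have e1 : ∀ u : ℝ, ‖(u : ℂ) - φ‖ ^ 2 = u ^ 2 - 2 * φ.re * u + ‖φ‖ ^ 2 := fun u => by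
      rw [← Complex.normSq_eq_norm_sq, ← Complex.normSq_eq_norm_sq, Complex.normSq_apply, Complex.normSq_apply]
      simp
      ring
    have e2 : ∀ u : ℝ, ‖(u : ℂ) - φ‖ ^ 2 ≤ 2 * |u| ^ 2 + 2 := fun u => by
      have h := norm_sub_le (u : ℂ) φ
      have hn : ‖(u : ℂ)‖ = |u| := by simp
      rw [hn] at h
      have h0 := norm_nonneg ((u : ℂ) - φ)
      have : ‖(u : ℂ) - φ‖ ≤ |u| + 1 := by linarith
      nlinarith [sq_nonneg (|u| - 1)]
    have pt : ∀ u : ℝ, ‖f u‖ ^ 2 ≤ ‖w‖⁻¹ ^ 2 * (u ^ 2 - 2 * φ.re * u + ‖φ‖ ^ 2)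
        + 6 * ‖w‖⁻¹ ^ 3 * (2 * |u| ^ 3 + 2 * |u| ^ 1)
        + 64 * ‖w‖⁻¹ ^ 6 * w.im⁻¹ ^ 2 * (2 * |u| ^ 8 + 2 * |u| ^ 6) := fun u => by
      rw [hfu, norm_mul, mul_pow, norm_inv]
      have ha := abs_nonneg u
      have hx0 : 0 ≤ ‖(u : ℂ) - φ‖ ^ 2 := by positivity
      have hd : 0 < ‖w - (u : ℂ)‖ := norm_pos_iff.mpr (sub_ne hw u)
      have key : ‖w - (u : ℂ)‖⁻¹ ^ 2 ≤ ‖w‖⁻¹ ^ 2 + 6 * ‖w‖⁻¹ ^ 3 * |u|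
          + 64 * ‖w‖⁻¹ ^ 6 * w.im⁻¹ ^ 2 * |u| ^ 6 := by
        rcases le_total |u| (‖w‖ / 2) with h | h
        · have hb : ‖w‖ - |u| ≤ ‖w - (u : ℂ)‖ := by
            have := norm_sub_norm_le w (u : ℂ)
            simpa using this
          have hb0 : 0 < ‖w‖ - |u| := by linarith
          have h5 : ‖w - (u : ℂ)‖⁻¹ ^ 2 ≤ (‖w‖ - |u|)⁻¹ ^ 2 := by gcongr
          have h6 : (‖w‖ - |u|)⁻¹ ^ 2 ≤ ‖w‖⁻¹ ^ 2 + 6 * ‖w‖⁻¹ ^ 3 * |u| := by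
            have : ‖w‖⁻¹ ^ 2 + 6 * ‖w‖⁻¹ ^ 3 * |u| = (‖w‖ + 6 * |u|) / ‖w‖ ^ 3 := by
              field_simp
            rw [this, inv_pow, inv_eq_one_div, div_le_div_iff₀ (by positivity) (by positivity)]
            generalize ‖w‖ = W at *
            generalize |u| = a at *
            have : 0 ≤ a * (W - 2 * a) * (4 * W - 3 * a) := by
              apply mul_nonneg (mul_nonneg ha (by linarith)) (by linarith)
            nlinarith
          have : 0 ≤ 64 * ‖w‖⁻¹ ^ 6 * w.im⁻¹ ^ 2 * |u| ^ 6 := by positivity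
          linarith
        · have h5 : ‖w - (u : ℂ)‖⁻¹ ^ 2 ≤ w.im⁻¹ ^ 2 := by
            have := im_le_norm_sub w u
            gcongr
          have h6 : 1 ≤ 64 * ‖w‖⁻¹ ^ 6 * |u| ^ 6 := by
            have : 64 * ‖w‖⁻¹ ^ 6 * |u| ^ 6 = (2 * |u| / ‖w‖) ^ 6 := by
              field_simp
              ring
            rw [this]
            apply one_le_pow₀
            rw [le_div_iff₀ wp]; linarith
          have h7 : 0 ≤ ‖w‖⁻¹ ^ 2 + 6 * ‖w‖⁻¹ ^ 3 * |u| := by positivity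
          have h9 : 0 ≤ w.im⁻¹ ^ 2 := by positivity
          have h10 : w.im⁻¹ ^ 2 * 1 ≤ w.im⁻¹ ^ 2 * (64 * ‖w‖⁻¹ ^ 6 * |u| ^ 6) := mul_le_mul_of_nonneg_left h6 h9
          have h11 : w.im⁻¹ ^ 2 * (64 * ‖w‖⁻¹ ^ 6 * |u| ^ 6) = 64 * ‖w‖⁻¹ ^ 6 * w.im⁻¹ ^ 2 * |u| ^ 6 := by ring
          linarith
      calc _ ≤ ‖(u : ℂ) - φ‖ ^ 2 * (‖w‖⁻¹ ^ 2 + 6 * ‖w‖⁻¹ ^ 3 * |u|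
          + 64 * ‖w‖⁻¹ ^ 6 * w.im⁻¹ ^ 2 * |u| ^ 6) := mul_le_mul_of_nonneg_left key hx0
        _ = ‖w‖⁻¹ ^ 2 * ‖(u : ℂ) - φ‖ ^ 2 + 6 * ‖w‖⁻¹ ^ 3 * (‖(u : ℂ) - φ‖ ^ 2 * |u|)
          + 64 * ‖w‖⁻¹ ^ 6 * w.im⁻¹ ^ 2 * (‖(u : ℂ) - φ‖ ^ 2 * |u| ^ 6) := by ring
        _ ≤ _ := by
          rw [← e1]
          have a1 : ‖(u : ℂ) - φ‖ ^ 2 * |u| ≤ 2 * |u| ^ 3 + 2 * |u| ^ 1 := by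
            have := mul_le_mul_of_nonneg_right (e2 u) ha
            have e : (2 * |u| ^ 2 + 2) * |u| = 2 * |u| ^ 3 + 2 * |u| ^ 1 := by ring
            linarith
          have a2 : ‖(u : ℂ) - φ‖ ^ 2 * |u| ^ 6 ≤ 2 * |u| ^ 8 + 2 * |u| ^ 6 := by
            have := mul_le_mul_of_nonneg_right (e2 u) (pow_nonneg ha 6)
            have e : (2 * |u| ^ 2 + 2) * |u| ^ 6 = 2 * |u| ^ 8 + 2 * |u| ^ 6 := by ring
            linarith
          gcongr
    have I1 : Integrable (fun u : ℝ => u ^ 2 - 2 * φ.re * u + ‖φ‖ ^ 2) μ := by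
      have h := ipc 1 (by norm_num)
      simp only [pow_one] at h
      exact iadd (isub (ipc 2 (by norm_num)) (h.const_mul _)) (integrable_const _)
    have I2 : Integrable (fun u : ℝ => 2 * |u| ^ 3 + 2 * |u| ^ 1) μ :=
      ((int_pow μ h8 3 (by norm_num)).const_mul 2).add ((int_pow μ h8 1 (by norm_num)).const_mul 2)
    have I3 : Integrable (fun u : ℝ => 2 * |u| ^ 8 + 2 * |u| ^ 6) μ :=
      ((int_pow μ h8 8 (by norm_num)).const_mul 2).add ((int_pow μ h8 6 (by norm_num)).const_mul 2)
    have v1 : ∫ u : ℝ, (u ^ 2 - 2 * φ.re * u + ‖φ‖ ^ 2) ∂μ = 1 + ‖φ‖ ^ 2 := by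
      have h := ipc 1 (by norm_num)
      simp only [pow_one] at h
      rw [integral_add (isub (ipc 2 (by norm_num)) (h.const_mul _)) (integrable_const _),
        integral_sub (ipc 2 (by norm_num)) (h.const_mul _), integral_const_mul]
      have hh2 : ∫ u : ℝ, u ^ 2 ∂μ = 1 := h2
      have hh1 : ∫ u : ℝ, u ∂μ = 0 := by simpa [mom] using h1
      rw [hh2, hh1]; simp
    have v2 : ∫ u : ℝ, (2 * |u| ^ 3 + 2 * |u| ^ 1) ∂μ = 2 * A3 + 2 * A1 := by
      rw [integral_add ((int_pow μ h8 3 (by norm_num)).const_mul 2)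
        ((int_pow μ h8 1 (by norm_num)).const_mul 2), integral_const_mul, integral_const_mul]
    have v3 : ∫ u : ℝ, (2 * |u| ^ 8 + 2 * |u| ^ 6) ∂μ = 2 * A8 + 2 * A6 := by
      rw [integral_add ((int_pow μ h8 8 (by norm_num)).const_mul 2)
        ((int_pow μ h8 6 (by norm_num)).const_mul 2), integral_const_mul, integral_const_mul]
    have main : S ≤ ‖w‖⁻¹ ^ 2 * (1 + ‖φ‖ ^ 2)
        + 6 * ‖w‖⁻¹ ^ 3 * (2 * A3 + 2 * A1)
        + 64 * ‖w‖⁻¹ ^ 6 * w.im⁻¹ ^ 2 * (2 * A8 + 2 * A6) := by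
      rw [← v1, ← v2, ← v3, ← integral_const_mul, ← integral_const_mul, ← integral_const_mul,
        ← integral_add (I1.const_mul _) (I2.const_mul _),
        ← integral_add (iadd (I1.const_mul _) (I2.const_mul _)) (I3.const_mul _)]
      refine integral_mono_of_nonneg (Eventually.of_forall fun u => by positivity)
        (iadd (iadd (I1.const_mul _) (I2.const_mul _)) (I3.const_mul _)) (Eventually.of_forall pt)
    have hφ2 : ‖φ‖ ^ 2 ≤ K0 ^ 2 / ‖w‖ := by
      rw [le_div_iff₀ wp]
      have := norm_nonneg φ
      have : (‖w‖ * ‖φ‖) ^ 2 ≤ K0 ^ 2 := by gcongr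
      nlinarith [sq_nonneg ‖φ‖]
    refine main.trans ?_
    set K := (1 + K0) ^ 2 + 12 * A3 + 12 * A1 + 128 * A8 + 128 * A6 with hK
    have t1 : ‖w‖⁻¹ ^ 2 * (1 + ‖φ‖ ^ 2) + 6 * ‖w‖⁻¹ ^ 3 * (2 * A3 + 2 * A1)
        ≤ (1 + K / ‖w‖) / ‖w‖ ^ 2 := by
      have q1 : (1 + K / ‖w‖) / ‖w‖ ^ 2 = ‖w‖⁻¹ ^ 2 * (1 + K / ‖w‖) := by field_simp
      have q2 : 6 * ‖w‖⁻¹ ^ 3 * (2 * A3 + 2 * A1) = ‖w‖⁻¹ ^ 2 * ((12 * A3 + 12 * A1) / ‖w‖) := by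
        field_simp; ring
      rw [q1, q2, ← mul_add]
      refine mul_le_mul_of_nonneg_left ?_ (by positivity)
      have : K0 ^ 2 / ‖w‖ + (12 * A3 + 12 * A1) / ‖w‖ ≤ K / ‖w‖ := by
        rw [← add_div]
        gcongr
        rw [hK]; nlinarith
      linarith
    have t2 : 64 * ‖w‖⁻¹ ^ 6 * w.im⁻¹ ^ 2 * (2 * A8 + 2 * A6) ≤ K / (‖w‖ ^ 6 * w.im ^ 2) := by
      have q1 : 64 * ‖w‖⁻¹ ^ 6 * w.im⁻¹ ^ 2 * (2 * A8 + 2 * A6)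
        = (128 * A8 + 128 * A6) / (‖w‖ ^ 6 * w.im ^ 2) := by field_simp; ring
      rw [q1]
      gcongr
      rw [hK]; nlinarith
    linarith

lemma layer2 {m3 K N S : ℝ} {z w F : ℂ} (hK : 1 ≤ K) (hN : 8 * K ≤ N)
    (hz : 0 < z.im) (hw : 0 < w.im) (S0 : 0 ≤ S) (hF : F.im = w.im * (1 + S))
    (c1 : ‖w - F‖ ≤ √S) (c2 : ‖w * (w - F) - 1‖ ≤ K * √S)
    (c3 : ‖w ^ 2 * (w - F) - w - (m3 : ℂ)‖ ≤ K * √S)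
    (heq : (N : ℂ) * z = (N : ℂ) ^ 2 * w - ((N : ℂ) ^ 2 - 1) * F) :
    ((N : ℂ) / w).im < 0 ∧ ‖(N : ℂ) / w‖ ≤ 1 + 6 * K / N ∧
    ‖(N : ℂ) / w + w / N - z‖ ≤ 6 * K / N * ‖(N : ℂ) / w‖ ∧
    ‖(N : ℂ) / w + w / N - z + m3 / N * ((N : ℂ) / w) ^ 2‖ ≤ 6 * K / N ^ 2 * ‖(N : ℂ) / w‖ ∧
    ‖(N : ℂ) / F - (N : ℂ) / w‖ ≤ 6 * K / N ^ 2 * ‖(N : ℂ) / w‖ ^ 3 ∧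
    N / 2 ≤ ‖w‖ ∧ ‖w‖ / 2 ≤ ‖F‖ ∧ √S ≤ 2 / N ∧ ‖w - F‖ ≤ 2 / ‖w‖ ∧
    N * z.im = w.im * (1 - (N ^ 2 - 1) * S) := by
  have hN8 : 8 ≤ N := by linarith
  have N0 : 0 < N := by linarith
  have hNc : (N : ℂ) ≠ 0 := by exact_mod_cast N0.ne'
  have w0 : w ≠ 0 := by rintro rfl; simp at hw
  have wp : 0 < ‖w‖ := norm_pos_iff.mpr w0
  have him : N * z.im = w.im * (1 - (N ^ 2 - 1) * S) := by
    have := congrArg Complex.im heq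
    have e1 : ((N : ℂ) * z).im = N * z.im := by simp
    have e2 : ((N : ℂ) ^ 2 * w - ((N : ℂ) ^ 2 - 1) * F).im = N ^ 2 * w.im - (N ^ 2 - 1) * F.im := by
      have a : ((N : ℂ) ^ 2) = ((N ^ 2 : ℝ) : ℂ) := by push_cast; ring
      have b : ((N : ℂ) ^ 2 - 1) = ((N ^ 2 - 1 : ℝ) : ℂ) := by push_cast; ring
      rw [b, a, Complex.sub_im, Complex.im_ofReal_mul, Complex.im_ofReal_mul]
    rw [e1, e2, hF] at this
    rw [this]; ring
  have hS1 : (N ^ 2 - 1) * S < 1 := by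
    by_contra h
    have : w.im * (1 - (N ^ 2 - 1) * S) ≤ 0 := mul_nonpos_of_nonneg_of_nonpos hw.le (by linarith)
    have := mul_pos N0 hz
    linarith
  set s := √S with hs
  have s0 : 0 ≤ s := Real.sqrt_nonneg _
  have ss : s ^ 2 = S := Real.sq_sqrt S0
  have hs1 : (N - 1) * s ≤ 1 := by
    have : ((N - 1) * s) ^ 2 ≤ 1 := by
      rw [mul_pow, ss]; nlinarith
    have h0 : 0 ≤ (N - 1) * s := mul_nonneg (by linarith) s0
    nlinarith
  have hs2 : s ≤ 2 / N := by
    rw [le_div_iff₀ N0]; nlinarith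
  set φ := w - F with hφ
  have hwφ : ‖w‖ * ‖φ‖ ≤ 1 + K * s ∧ 1 ≤ ‖w‖ * ‖φ‖ + K * s := by
    rw [← norm_mul]
    constructor
    · have : w * φ = (w * φ - 1) + 1 := by ring
      rw [this]; refine (norm_add_le _ _).trans ?_; rw [norm_one]; linarith
    · have : (1 : ℂ) = w * φ - (w * φ - 1) := by ring
      have h := norm_sub_le (w * φ) (w * φ - 1)
      rw [← this, norm_one] at h
      linarith
  have hwN : N - 1 - K ≤ ‖w‖ := by
    have h1 : 1 ≤ s * (‖w‖ + K) := by nlinarith [hwφ.2, mul_le_mul_of_nonneg_left c1 wp.le]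
    by_contra h
    push Not at h
    have : s * (‖w‖ + K) ≤ s * (N - 1) := mul_le_mul_of_nonneg_left (by linarith) s0
    have sp : 0 < s := by
      rcases s0.eq_or_lt with h2 | h2
      · rw [← h2] at h1; simp at h1; linarith
      · exact h2
    nlinarith
  have hw2 : N / 2 ≤ ‖w‖ := by linarith
  have Ks : K * s ≤ 1 := by
    have : K * s ≤ K * (2 / N) := mul_le_mul_of_nonneg_left hs2 (by linarith)
    have : K * (2 / N) ≤ 1 := by rw [← mul_div_assoc, div_le_one N0]; linarith
    linarith
  have hφ2 : ‖φ‖ ≤ 2 / ‖w‖ := by rw [le_div_iff₀ wp]; nlinarith [hwφ.1]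
  have hFw : ‖w‖ / 2 ≤ ‖F‖ := by
    have h1 : ‖w‖ - ‖φ‖ ≤ ‖F‖ := by
      have := norm_sub_norm_le w φ
      have e : w - φ = F := by rw [hφ]; ring
      rwa [e] at this
    have : 2 / ‖w‖ ≤ ‖w‖ / 2 := by
      rw [div_le_div_iff₀ wp (by norm_num)]; nlinarith
    linarith
  have Fp : 0 < ‖F‖ := by linarith
  have F0 : F ≠ 0 := norm_pos_iff.mp Fp
  have tn : ‖(N : ℂ) / w‖ = N / ‖w‖ := by
    rw [norm_div]; simp [abs_of_pos N0]
  have tp : 0 < N / ‖w‖ := by positivity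
  have t2 : N / ‖w‖ ≤ 2 := by rw [div_le_iff₀ wp]; linarith
  have zeq : z = w / N + (N - 1 / N) * φ := by
    have : z = ((N : ℂ) ^ 2 * w - ((N : ℂ) ^ 2 - 1) * F) / N := by
      rw [← heq]; field_simp
    rw [this, hφ]; field_simp; ring
  have hφN : ‖φ / N‖ ≤ 2 * (N / ‖w‖) / N ^ 2 := by
    rw [norm_div]
    simp only [Complex.norm_real, Real.norm_eq_abs, abs_of_pos N0]
    have : 2 * (N / ‖w‖) / N ^ 2 = 2 / ‖w‖ / N := by field_simp
    rw [this]
    gcongr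
  refine ⟨?_, ?_, ?_, ?_, ?_, hw2, hFw, hs2, hφ2, him⟩
  · have : ((N : ℂ) / w).im = - (N * w.im / ‖w‖ ^ 2) := by
      rw [div_eq_mul_inv, Complex.im_ofReal_mul, Complex.inv_im, Complex.normSq_eq_norm_sq]; ring
    rw [this]
    have : 0 < N * w.im / ‖w‖ ^ 2 := by positivity
    linarith
  · rw [tn, div_le_iff₀ wp]
    have h1 : (1 + 6 * K / N) * (N - 2 * K) ≤ (1 + 6 * K / N) * ‖w‖ := by
      apply mul_le_mul_of_nonneg_left
      · linarith
      · positivity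
    have h2 : (1 + 6 * K / N) * (N - 2 * K) = N + 4 * K * (N - 3 * K) / N := by field_simp; ring
    have h3 : 0 ≤ 4 * K * (N - 3 * K) / N := by
      apply div_nonneg (mul_nonneg (by linarith) (by linarith)) N0.le
    linarith
  · have e : (N : ℂ) / w + w / N - z = φ / N - (N : ℂ) / w * (w * φ - 1) := by
      rw [zeq]; field_simp; ring
    rw [e]
    refine (norm_sub_le _ _).trans ?_
    rw [norm_mul, tn]
    have h1 : N / ‖w‖ * ‖w * φ - 1‖ ≤ N / ‖w‖ * (K * (2 / N)) := by
      apply mul_le_mul_of_nonneg_left _ tp.le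
      exact c2.trans (mul_le_mul_of_nonneg_left hs2 (by linarith))
    have h2 : 2 * (N / ‖w‖) / N ^ 2 ≤ 2 * K / N * (N / ‖w‖) := by
      have : 2 * (N / ‖w‖) / N ^ 2 = 2 / N ^ 2 * (N / ‖w‖) := by ring
      rw [this]
      apply mul_le_mul_of_nonneg_right _ tp.le
      rw [div_le_div_iff₀ (by positivity) N0]
      nlinarith
    have h3 : N / ‖w‖ * (K * (2 / N)) = 2 * K / N * (N / ‖w‖) := by ring
    have h4 : 0 ≤ K / N * (N / ‖w‖) := by positivity
    have h5 : 6 * K / N * (N / ‖w‖) = 2 * K / N * (N / ‖w‖) + 2 * K / N * (N / ‖w‖) + 2 * (K / N * (N / ‖w‖)) := by ring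
    linarith
  · have e : (N : ℂ) / w + w / N - z + m3 / N * ((N : ℂ) / w) ^ 2
        = φ / N - ((N : ℂ) / w) ^ 2 / N * (w ^ 2 * φ - w - m3) := by
      rw [zeq]; field_simp; ring
    rw [e]
    refine (norm_sub_le _ _).trans ?_
    rw [norm_mul, norm_div (((N : ℂ) / w) ^ 2), norm_pow, tn]
    simp only [Complex.norm_real, Real.norm_eq_abs, abs_of_pos N0]
    have h1 : (N / ‖w‖) ^ 2 / N * ‖w ^ 2 * φ - w - m3‖ ≤ (N / ‖w‖) ^ 2 / N * (K * (2 / N)) := by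
      apply mul_le_mul_of_nonneg_left _ (by positivity)
      exact c3.trans (mul_le_mul_of_nonneg_left hs2 (by linarith))
    have h2 : (N / ‖w‖) ^ 2 / N * (K * (2 / N)) ≤ 4 * K / N ^ 2 * (N / ‖w‖) := by
      have : (N / ‖w‖) ^ 2 / N * (K * (2 / N)) = (2 * K / N ^ 2 * (N / ‖w‖)) * (N / ‖w‖) := by
        field_simp
      rw [this]
      have h0 : 0 ≤ 2 * K / N ^ 2 * (N / ‖w‖) := by positivity
      have := mul_le_mul_of_nonneg_left t2 h0
      have e2 : 2 * K / N ^ 2 * (N / ‖w‖) * 2 = 4 * K / N ^ 2 * (N / ‖w‖) := by ring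
      linarith
    have h3 : 2 * (N / ‖w‖) / N ^ 2 ≤ 2 * K / N ^ 2 * (N / ‖w‖) := by
      have : 2 * (N / ‖w‖) / N ^ 2 = 2 / N ^ 2 * (N / ‖w‖) := by ring
      rw [this]
      gcongr
      linarith
    have h5 : 6 * K / N ^ 2 * (N / ‖w‖) = 4 * K / N ^ 2 * (N / ‖w‖) + 2 * K / N ^ 2 * (N / ‖w‖) := by ring
    linarith
  · have e : (N : ℂ) / F - (N : ℂ) / w = N * φ / (w * F) := by
      rw [hφ]; field_simp
    rw [e, norm_div, norm_mul, norm_mul, tn]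
    simp only [Complex.norm_real, Real.norm_eq_abs, abs_of_pos N0]
    have h1 : N * ‖φ‖ / (‖w‖ * ‖F‖) ≤ N * (2 / ‖w‖) / (‖w‖ * (‖w‖ / 2)) := by gcongr
    have h2 : N * (2 / ‖w‖) / (‖w‖ * (‖w‖ / 2)) = 4 / N ^ 2 * (N / ‖w‖) ^ 3 := by field_simp; norm_num
    rw [h2] at h1
    refine h1.trans ?_
    gcongr
    linarith

lemma half_disc_dist {g t : ℂ} {δ : ℝ} (hg : g.im ≤ 0) (hg1 : ‖g‖ ≤ 1) (ht : t.im ≤ 0)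
    (ht1 : ‖t‖ ≤ 1 + δ) (hδ : 0 ≤ δ) : ‖1 - g ^ 2‖ ≤ 4 * ‖1 - t * g‖ + 2 * δ := by
  have a1 : -g.im ≤ ‖1 - t * g‖ := by
    have h1 : ((1 - t * g) * (starRingEnd ℂ) g).im = -g.im - t.im * (g.re ^ 2 + g.im ^ 2) := by
      simp; ring
    have h2 := Complex.abs_im_le_norm ((1 - t * g) * (starRingEnd ℂ) g)
    rw [h1, norm_mul, RCLike.norm_conj] at h2
    have h3 : 0 ≤ - t.im * (g.re ^ 2 + g.im ^ 2) := by
      apply mul_nonneg (by linarith) (by positivity)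
    have h4 := le_abs_self (-g.im - t.im * (g.re ^ 2 + g.im ^ 2))
    have h5 : ‖1 - t * g‖ * ‖g‖ ≤ ‖1 - t * g‖ := mul_le_of_le_one_right (norm_nonneg _) hg1
    linarith
  have a2 : 1 - ‖g‖ - δ ≤ ‖1 - t * g‖ := by
    have h := norm_sub_norm_le (1 : ℂ) (t * g)
    rw [norm_one, norm_mul] at h
    have := mul_le_mul_of_nonneg_right ht1 (norm_nonneg g)
    nlinarith
  have a3 : ‖1 - g ^ 2‖ ≤ (1 - ‖g‖ ^ 2) + 2 * ‖g‖ * (-g.im) := by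
    have e : 1 - g ^ 2 = ((1 - ‖g‖ ^ 2 : ℝ) : ℂ) + (-2 * I * g * (g.im : ℂ)) := by
      rw [← Complex.normSq_eq_norm_sq, Complex.normSq_apply]
      apply Complex.ext
      · simp [pow_two]; ring
      · simp [pow_two]; ring
    rw [e]
    refine (norm_add_le _ _).trans ?_
    have h1 : ‖((1 - ‖g‖ ^ 2 : ℝ) : ℂ)‖ = 1 - ‖g‖ ^ 2 := by
      rw [Complex.norm_real, Real.norm_eq_abs, abs_of_nonneg]
      nlinarith [norm_nonneg g]
    rw [h1]
    simp [abs_of_nonpos hg]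
  have := norm_nonneg g
  nlinarith

set_option maxHeartbeats 1600000 in
lemma stab {g t z : ℂ} {C ε a : ℝ} (hg : g.im < 0) (hg1 : ‖g‖ < 1) (hgz : g + g⁻¹ = z)
    (ht : t.im < 0) (hC : 1 ≤ C) (hε : 0 < ε) (hCε : 32 * C * ε ≤ 1) (ha : |a| ≤ C)
    (ht1 : ‖t‖ ≤ 1 + C * ε) (hr : ‖t + t⁻¹ - z‖ ≤ C * ε * ‖t‖)
    (hr2 : ‖t + t⁻¹ - z + a * ε * t ^ 2‖ ≤ C * ε ^ 2 * ‖t‖) :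
    ‖t‖ ≤ 9 * ‖g‖ ∧ 0 < ‖1 - g ^ 2‖ ∧ ‖1 - g ^ 2‖ ≤ 2 ∧
    ‖t - g - a * ε * (g ^ 4 / (1 - g ^ 2))‖ * ‖1 - g ^ 2‖ ≤ 1000000 * C ^ 2 * ‖g‖ ^ 2 * ε ∧
    (16 * C * ε ≤ ‖1 - g ^ 2‖ →
    ‖t - g - a * ε * (g ^ 4 / (1 - g ^ 2))‖ * ‖1 - g ^ 2‖ ^ 3 ≤ 1000000 * C ^ 2 * ‖g‖ ^ 2 * ε ^ 2) := by
  have g0 : g ≠ 0 := by rintro rfl; simp at hg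
  have t0 : t ≠ 0 := by rintro rfl; simp at ht
  have gp : 0 < ‖g‖ := norm_pos_iff.mpr g0
  have tp : 0 < ‖t‖ := norm_pos_iff.mpr t0
  have Cε0 : 0 < C * ε := by positivity
  have t2 : ‖t‖ ≤ 2 := by nlinarith
  set r := t + t⁻¹ - z with hrdef
  have hr1 : ‖r‖ ≤ 1 := by nlinarith
  have hxr : (t - g) * (1 - t * g) = - (r * (t * g)) := by
    rw [hrdef, ← hgz]; field_simp; ring
  have t9 : ‖t‖ ≤ 9 * ‖g‖ := by
    have e : t = g + (t - g - r) * (t * g) := by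
      rw [hrdef, ← hgz]; field_simp; ring
    have h : ‖t‖ ≤ ‖g‖ + ‖t - g - r‖ * (‖t‖ * ‖g‖) := by
      conv_lhs => rw [e]
      refine (norm_add_le _ _).trans ?_
      rw [norm_mul, norm_mul]
    have h2 : ‖t - g - r‖ ≤ 4 := by
      have h3 := norm_sub_le (t - g) r
      have h4 := norm_sub_le t g
      linarith
    have h5 : ‖t - g - r‖ * (‖t‖ * ‖g‖) ≤ 4 * (2 * ‖g‖) := by gcongr
    linarith
  have ρ0 : 1 - g ^ 2 ≠ 0 := by
    intro h
    have : ‖g ^ 2‖ = 1 := by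
      have : g ^ 2 = 1 := by linear_combination -h
      rw [this, norm_one]
    rw [norm_pow] at this
    nlinarith
  have ρp : 0 < ‖1 - g ^ 2‖ := norm_pos_iff.mpr ρ0
  have ρ2 : ‖1 - g ^ 2‖ ≤ 2 := by
    refine (norm_sub_le _ _).trans ?_
    rw [norm_one, norm_pow]; nlinarith
  have hd := half_disc_dist hg.le hg1.le ht.le ht1 Cε0.le
  set ρ := ‖1 - g ^ 2‖ with hρ
  have hΦ : ‖(a * ε * (g ^ 4 / (1 - g ^ 2)) : ℂ)‖ * ρ ≤ C * ε * ‖g‖ ^ 2 := by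
    rw [norm_mul, norm_mul, norm_div, ← hρ, norm_pow]
    simp only [Complex.norm_real, Real.norm_eq_abs, abs_of_pos hε]
    have : |a| * ε * (‖g‖ ^ 4 / ρ) * ρ = |a| * ε * (‖g‖ ^ 2 * ‖g‖ ^ 2) := by field_simp
    rw [this]
    have : ‖g‖ ^ 2 ≤ 1 := by nlinarith
    have h2 : ‖g‖ ^ 2 * ‖g‖ ^ 2 ≤ ‖g‖ ^ 2 * 1 := by gcongr
    have h3 : |a| * ε ≤ C * ε := by gcongr
    have h4 : 0 ≤ |a| * ε := by positivity
    calc _ ≤ (C * ε) * (‖g‖ ^ 2 * 1) := by gcongr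
      _ = _ := by ring
  have hC2 : C ≤ C ^ 2 := by nlinarith
  have gg : 0 < ‖g‖ ^ 2 := by positivity
  have hCC : C * ε * ‖g‖ ^ 2 ≤ C ^ 2 * ‖g‖ ^ 2 * ε := by
    have : C * (ε * ‖g‖ ^ 2) ≤ C ^ 2 * (ε * ‖g‖ ^ 2) := by gcongr
    nlinarith
  have hsplit : ‖t - g - a * ε * (g ^ 4 / (1 - g ^ 2))‖ * ρ ≤ ‖t - g‖ * ρ + C * ε * ‖g‖ ^ 2 := by
    have := mul_le_mul_of_nonneg_right (norm_sub_le (t - g) (a * ε * (g ^ 4 / (1 - g ^ 2)))) ρp.le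
    linarith
  have big : 16 * C * ε ≤ ρ → ρ ≤ 8 * ‖1 - t * g‖ ∧ ‖t - g‖ * ρ ≤ 648 * (C * ε * ‖g‖ ^ 3) := by
    intro h
    have h8 : ρ ≤ 8 * ‖1 - t * g‖ := by linarith
    refine ⟨h8, ?_⟩
    have h1 : ‖t - g‖ * ‖1 - t * g‖ = ‖r‖ * (‖t‖ * ‖g‖) := by
      rw [← norm_mul, hxr, norm_neg, norm_mul, norm_mul]
    have h2 : ‖r‖ * (‖t‖ * ‖g‖) ≤ (C * ε * (9 * ‖g‖)) * ((9 * ‖g‖) * ‖g‖) := by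
      have : ‖r‖ ≤ C * ε * (9 * ‖g‖) := hr.trans (by gcongr)
      gcongr
    have h3 : ‖t - g‖ * ρ ≤ ‖t - g‖ * (8 * ‖1 - t * g‖) := by gcongr
    nlinarith
  refine ⟨t9, ρp, ρ2, ?_, ?_⟩
  · refine hsplit.trans ?_
    rcases le_total (16 * C * ε) ρ with h | h
    · have h1 := (big h).2
      have h2 : ‖g‖ ^ 3 ≤ ‖g‖ ^ 2 := by nlinarith
      have h3 : C * ε * ‖g‖ ^ 3 ≤ C * ε * ‖g‖ ^ 2 := by gcongr
      nlinarith
    · have hg2 : 1 / 2 ≤ ‖g‖ := by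
        have h1 : 1 - ‖g‖ ^ 2 ≤ ρ := by
          have := norm_sub_norm_le (1 : ℂ) (g ^ 2)
          rwa [norm_one, norm_pow] at this
        nlinarith
      have h1 : ‖t - g‖ ≤ 20 * ‖g‖ ^ 2 := by
        have := norm_sub_le t g
        nlinarith
      have h2 : ‖t - g‖ * ρ ≤ 20 * ‖g‖ ^ 2 * (16 * C * ε) := by gcongr
      nlinarith
  · intro h
    obtain ⟨h8, hx⟩ := big h
    set X := t - g - a * ε * (g ^ 4 / (1 - g ^ 2)) with hX
    have key : X * (1 - t * g) * (1 - g ^ 2) = - ((r + a * ε * t ^ 2) * (t * g) * (1 - g ^ 2))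
        + a * ε * (g * (t - g) * ((t ^ 2 + t * g + g ^ 2) - t * g ^ 2 * (t + g))) := by
      have e1 : X * (1 - t * g) * (1 - g ^ 2)
        = (t - g) * (1 - t * g) * (1 - g ^ 2) - a * ε * g ^ 4 * (1 - t * g) := by
        rw [hX]; field_simp
      rw [e1, hxr]; ring
    have n1 : ‖(r + a * ε * t ^ 2) * (t * g) * (1 - g ^ 2)‖ ≤ 81 * (C * ε ^ 2 * ‖g‖ ^ 3) * ρ := by
      rw [norm_mul, norm_mul, norm_mul, ← hρ]
      have : ‖r + a * ε * t ^ 2‖ ≤ C * ε ^ 2 * (9 * ‖g‖) := hr2.trans (by gcongr)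
      calc _ ≤ (C * ε ^ 2 * (9 * ‖g‖)) * ((9 * ‖g‖) * ‖g‖) * ρ := by gcongr
        _ = _ := by ring
    have n2 : ‖(t ^ 2 + t * g + g ^ 2) - t * g ^ 2 * (t + g)‖ ≤ 181 * ‖g‖ ^ 2 := by
      have q1 : ‖t ^ 2 + t * g + g ^ 2‖ ≤ 91 * ‖g‖ ^ 2 := by
        refine (norm_add_le _ _).trans ?_
        have := norm_add_le (t ^ 2) (t * g)
        rw [norm_pow, norm_mul] at this
        rw [norm_pow]
        have h1 : ‖t‖ ^ 2 ≤ (9 * ‖g‖) ^ 2 := by gcongr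
        have h2 : ‖t‖ * ‖g‖ ≤ 9 * ‖g‖ * ‖g‖ := by gcongr
        nlinarith
      have q2 : ‖t * g ^ 2 * (t + g)‖ ≤ 90 * ‖g‖ ^ 2 := by
        rw [norm_mul, norm_mul, norm_pow]
        have h3 : ‖t + g‖ ≤ 10 * ‖g‖ := (norm_add_le _ _).trans (by linarith)
        calc _ ≤ (9 * ‖g‖) * ‖g‖ ^ 2 * (10 * ‖g‖) := by gcongr
          _ = 90 * ‖g‖ ^ 2 * ‖g‖ ^ 2 := by ring
          _ ≤ 90 * ‖g‖ ^ 2 * 1 := by gcongr; nlinarith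
          _ = _ := by ring
      exact (norm_sub_le _ _).trans (by linarith)
    have n3 : ‖(a * ε * (g * (t - g) * ((t ^ 2 + t * g + g ^ 2) - t * g ^ 2 * (t + g))) : ℂ)‖
        ≤ 181 * (C * ε * ‖g‖ ^ 3) * ‖t - g‖ := by
      rw [norm_mul, norm_mul, norm_mul, norm_mul]
      simp only [Complex.norm_real, Real.norm_eq_abs, abs_of_pos hε]
      calc _ ≤ C * ε * (‖g‖ * ‖t - g‖ * (181 * ‖g‖ ^ 2)) := by gcongr
        _ = _ := by ring
    have n4 : ‖X‖ * ‖1 - t * g‖ * ρ ≤ 81 * (C * ε ^ 2 * ‖g‖ ^ 3) * ρ + 181 * (C * ε * ‖g‖ ^ 3) * ‖t - g‖ := by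
      rw [hρ, ← norm_mul, ← norm_mul, key]
      refine (norm_add_le _ _).trans ?_
      rw [norm_neg]
      linarith
    have n5 : ‖X‖ * ρ ^ 3 ≤ 8 * (‖X‖ * ‖1 - t * g‖ * ρ) * ρ := by
      have : ‖X‖ * ρ ^ 2 * ρ ≤ ‖X‖ * ρ ^ 2 * (8 * ‖1 - t * g‖) := by gcongr
      nlinarith
    have n6 : 8 * (‖X‖ * ‖1 - t * g‖ * ρ) * ρ ≤ 8 * (81 * (C * ε ^ 2 * ‖g‖ ^ 3) * ρ * ρ
        + 181 * (C * ε * ‖g‖ ^ 3) * (‖t - g‖ * ρ)) := by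
      have := mul_le_mul_of_nonneg_right n4 ρp.le
      nlinarith
    have n7 : 81 * (C * ε ^ 2 * ‖g‖ ^ 3) * ρ * ρ ≤ 324 * (C ^ 2 * ‖g‖ ^ 2 * ε ^ 2) := by
      have h2 : ‖g‖ ^ 3 ≤ ‖g‖ ^ 2 := by nlinarith
      calc _ ≤ 81 * (C ^ 2 * ε ^ 2 * ‖g‖ ^ 2) * 2 * 2 := by gcongr
        _ = _ := by ring
    have n8 : 181 * (C * ε * ‖g‖ ^ 3) * (‖t - g‖ * ρ) ≤ 117288 * (C ^ 2 * ‖g‖ ^ 2 * ε ^ 2) := by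
      have h2 : ‖g‖ ^ 3 ≤ ‖g‖ ^ 2 := by nlinarith
      have h3 : ‖g‖ ^ 3 ≤ 1 := by nlinarith
      calc _ ≤ 181 * (C * ε * ‖g‖ ^ 2) * (648 * (C * ε * ‖g‖ ^ 3)) := by gcongr
        _ ≤ 181 * (C * ε * ‖g‖ ^ 2) * (648 * (C * ε * 1)) := by gcongr
        _ = _ := by ring
    have : 0 ≤ C ^ 2 * ‖g‖ ^ 2 * ε ^ 2 := by positivity
    linarith

lemma interp {X A ε ρ B : ℝ} (hA : 0 ≤ A) (hε : 0 < ε) (hρ : 0 < ρ)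
    (h1 : X * ρ ≤ A * ε) (h2 : B * ε ≤ ρ → X * ρ ^ 3 ≤ A * ε ^ 2) (hB : B ^ 2 * ε ≤ 1) :
    X ≤ A * (ε ^ (7 / 5 : ℝ) * ρ ^ (-(9 / 5) : ℝ)) := by
  obtain ⟨a, ha, rfl⟩ : ∃ a : ℝ, 0 < a ∧ a ^ 5 = ε :=
    ⟨ε ^ (1 / 5 : ℝ), by positivity, by rw [← Real.rpow_natCast, ← Real.rpow_mul hε.le]; norm_num⟩
  obtain ⟨b, hb, rfl⟩ : ∃ a : ℝ, 0 < a ∧ a ^ 5 = ρ :=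
    ⟨ρ ^ (1 / 5 : ℝ), by positivity, by rw [← Real.rpow_natCast, ← Real.rpow_mul hρ.le]; norm_num⟩
  have e1 : (a ^ 5) ^ (7 / 5 : ℝ) = a ^ 7 := by
    rw [← Real.rpow_natCast, ← Real.rpow_mul ha.le, ← Real.rpow_natCast]; norm_num
  have e2 : (b ^ 5) ^ (-(9 / 5) : ℝ) = (b ^ 9)⁻¹ := by
    rw [← Real.rpow_natCast, ← Real.rpow_mul hb.le, ← Real.rpow_natCast, ← Real.rpow_neg hb.le]; norm_num
  rw [e1, e2, ← mul_assoc, ← div_eq_mul_inv, le_div_iff₀ (by positivity)]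
  rcases le_total (b ^ 2) a with h | h
  · have h3 : b ^ 4 ≤ a ^ 2 := by nlinarith [sq_nonneg b]
    calc X * b ^ 9 = X * b ^ 5 * b ^ 4 := by ring
      _ ≤ A * a ^ 5 * b ^ 4 := by gcongr
      _ ≤ A * a ^ 5 * a ^ 2 := by gcongr
      _ = _ := by ring
  · have hc : B * a ^ 5 ≤ b ^ 5 := by
      have h3 : a ^ 5 ≤ (b ^ 2) ^ 5 := by gcongr
      have h4 : (B * a ^ 5) ^ 2 ≤ (b ^ 5) ^ 2 := by
        calc (B * a ^ 5) ^ 2 = (B ^ 2 * a ^ 5) * a ^ 5 := by ring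
          _ ≤ 1 * a ^ 5 := by gcongr
          _ ≤ (b ^ 5) ^ 2 := by rw [one_mul]; calc _ ≤ _ := h3
                                _ = _ := by ring
      exact (abs_le_of_sq_le_sq' h4 (by positivity)).2
    have h5 := h2 hc
    have h6 : a ^ 3 ≤ b ^ 6 := by
      calc a ^ 3 ≤ (b ^ 2) ^ 3 := by gcongr
        _ = _ := by ring
    have h7 : X * b ^ 9 * b ^ 6 ≤ A * a ^ 7 * b ^ 6 := by
      calc X * b ^ 9 * b ^ 6 = X * (b ^ 5) ^ 3 := by ring
        _ ≤ A * (a ^ 5) ^ 2 := h5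
        _ = A * a ^ 7 * a ^ 3 := by ring
        _ ≤ _ := by gcongr
    exact le_of_mul_le_mul_right h7 (by positivity)

lemma stabE {g t z G : ℂ} {C ε a : ℝ} (hg : g.im < 0) (hg1 : ‖g‖ < 1) (hgz : g + g⁻¹ = z)
    (ht : t.im < 0) (hC : 1 ≤ C) (hε : 0 < ε) (hCε : 256 * C ^ 2 * ε ≤ 1) (ha : |a| ≤ C)
    (ht1 : ‖t‖ ≤ 1 + C * ε) (hr : ‖t + t⁻¹ - z‖ ≤ C * ε * ‖t‖)
    (hr2 : ‖t + t⁻¹ - z + a * ε * t ^ 2‖ ≤ C * ε ^ 2 * ‖t‖)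
    (hG : ‖G - t‖ ≤ C * ε ^ 2 * ‖t‖ ^ 3) :
    ‖G - g - a * ε * (g ^ 4 / (1 - g ^ 2))‖ ≤
      1006000 * C ^ 2 * ε ^ (7 / 5 : ℝ) * (‖g‖ ^ 2 * ‖1 - g ^ 2‖ ^ (-(9 / 5) : ℝ)) := by
  have hC2 : C ≤ C ^ 2 := by nlinarith
  have hCε' : 32 * C * ε ≤ 1 := by
    have : C * ε ≤ C ^ 2 * ε := by gcongr
    nlinarith
  obtain ⟨t9, ρp, ρ2, hA, hB⟩ := stab hg hg1 hgz ht hC hε hCε' ha ht1 hr hr2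
  have hint := interp (A := 1000000 * C ^ 2 * ‖g‖ ^ 2) (B := 16 * C) (by positivity) hε ρp hA hB
    (by nlinarith)
  have e : G - g - a * ε * (g ^ 4 / (1 - g ^ 2)) = (G - t) + (t - g - a * ε * (g ^ 4 / (1 - g ^ 2))) := by
    ring
  rw [e]
  refine (norm_add_le _ _).trans ?_
  have ε1 : ε ≤ 1 := by nlinarith
  have h1 : ε ^ 2 ≤ ε ^ (7 / 5 : ℝ) := by
    rw [← Real.rpow_natCast]
    exact Real.rpow_le_rpow_of_exponent_ge hε ε1 (by norm_num)
  have h2 : 1 / 4 ≤ ‖1 - g ^ 2‖ ^ (-(9 / 5) : ℝ) := by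
    have h3 : (2 : ℝ) ^ (-(9 / 5) : ℝ) ≤ ‖1 - g ^ 2‖ ^ (-(9 / 5) : ℝ) :=
      Real.rpow_le_rpow_of_nonpos ρp ρ2 (by norm_num)
    have h4 : (2 : ℝ) ^ (-2 : ℝ) ≤ (2 : ℝ) ^ (-(9 / 5) : ℝ) :=
      Real.rpow_le_rpow_of_exponent_le (by norm_num) (by norm_num)
    have h5 : (2 : ℝ) ^ (-2 : ℝ) = 1 / 4 := by
      rw [show (-2 : ℝ) = -((2 : ℕ) : ℝ) by norm_num, Real.rpow_neg (by norm_num), Real.rpow_natCast]; norm_num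
    linarith
  have h6 : ‖G - t‖ ≤ 729 * C ^ 2 * (ε ^ (7 / 5 : ℝ)) * ‖g‖ ^ 2 := by
    have h7 : ‖g‖ ^ 3 ≤ ‖g‖ ^ 2 := by nlinarith [norm_nonneg g, sq_nonneg ‖g‖]
    calc _ ≤ C * ε ^ 2 * ‖t‖ ^ 3 := hG
      _ ≤ C * ε ^ 2 * (9 * ‖g‖) ^ 3 := by gcongr
      _ = 729 * C * ε ^ 2 * ‖g‖ ^ 3 := by ring
      _ ≤ 729 * C ^ 2 * (ε ^ (7 / 5 : ℝ)) * ‖g‖ ^ 2 := by gcongr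
  set Q := ‖1 - g ^ 2‖ ^ (-(9 / 5) : ℝ)
  set P := ε ^ (7 / 5 : ℝ)
  have h8 : 0 ≤ C ^ 2 * P * ‖g‖ ^ 2 := by positivity
  have h9 : C ^ 2 * P * ‖g‖ ^ 2 * (1 / 4) ≤ C ^ 2 * P * ‖g‖ ^ 2 * Q := by gcongr
  nlinarith

def sg (z : ℂ) : ℂ := (z - I * ((4 - z ^ 2) ^ (1 / 2 : ℂ))) / 2

lemma csqrt_sq (a : ℂ) : (a ^ (1 / 2 : ℂ)) ^ 2 = a := by
  rw [← Complex.cpow_nat_mul]; norm_num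

lemma csqrt_re (a : ℂ) : 0 ≤ (a ^ (1 / 2 : ℂ)).re := by
  by_cases ha : a = 0
  · subst ha; rw [Complex.zero_cpow (by norm_num)]; simp
  have e : (Complex.log a * (1 / 2)).im = a.arg / 2 := by
    rw [mul_one_div, show (2 : ℂ) = ((2 : ℝ) : ℂ) by norm_num, Complex.div_ofReal_im, Complex.log_im]
  rw [Complex.cpow_def_of_ne_zero ha, Complex.exp_re, e]
  refine mul_nonneg (Real.exp_pos _).le (Real.cos_nonneg_of_neg_pi_div_two_le_of_le ?_ ?_)
  · have := Complex.neg_pi_lt_arg a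
    linarith
  · have := Complex.arg_le_pi a
    linarith

lemma sg_mul (z : ℂ) : sg z * ((z + I * ((4 - z ^ 2) ^ (1 / 2 : ℂ))) / 2) = 1 := by
  have h := csqrt_sq (4 - z ^ 2)
  set s := (4 - z ^ 2) ^ (1 / 2 : ℂ)
  have : sg z * ((z + I * s) / 2) = (z ^ 2 - I ^ 2 * s ^ 2) / 4 := by rw [sg]; ring
  rw [this, h, I_sq]; ring

lemma sg_ne (z : ℂ) : sg z ≠ 0 := left_ne_zero_of_mul_eq_one (sg_mul z)

lemma sg_inv (z : ℂ) : (sg z)⁻¹ = (z + I * ((4 - z ^ 2) ^ (1 / 2 : ℂ))) / 2 :=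
  inv_eq_of_mul_eq_one_right (sg_mul z)

lemma sg_add (z : ℂ) : sg z + (sg z)⁻¹ = z := by
  rw [sg_inv, sg]; ring

lemma sg_im {z : ℂ} (hz : 0 < z.im) : (sg z).im < 0 := by
  have h : 0 < ((sg z)⁻¹).im := by
    rw [sg_inv]
    have := csqrt_re (4 - z ^ 2)
    have e : ((z + I * ((4 - z ^ 2) ^ (1 / 2 : ℂ))) / 2).im
      = (z.im + ((4 - z ^ 2) ^ (1 / 2 : ℂ)).re) / 2 := by
      rw [show (2 : ℂ) = ((2 : ℝ) : ℂ) by norm_num, Complex.div_ofReal_im]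
      simp
    rw [e]; linarith
  rw [Complex.inv_im] at h
  have := Complex.normSq_pos.mpr (sg_ne z)
  rw [div_pos_iff_of_pos_right this] at h
  linarith

lemma J_im {g : ℂ} (hg : g ≠ 0) : (g + g⁻¹).im = -g.im * (1 - ‖g‖ ^ 2) / ‖g‖ ^ 2 := by
  have h : ‖g‖ ^ 2 ≠ 0 := by simpa using hg
  rw [Complex.add_im, Complex.inv_im, Complex.normSq_eq_norm_sq]
  field_simp; ring

lemma sg_norm {z : ℂ} (hz : 0 < z.im) : ‖sg z‖ < 1 := by
  have h := J_im (sg_ne z)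
  rw [sg_add] at h
  have h1 := sg_im hz
  have h2 : 0 < ‖sg z‖ := norm_pos_iff.mpr (sg_ne z)
  rw [h] at hz
  have h3 : 0 < -(sg z).im * (1 - ‖sg z‖ ^ 2) := by
    rwa [div_pos_iff_of_pos_right (by positivity)] at hz
  have h4 : 0 < 1 - ‖sg z‖ ^ 2 := by
    by_contra h5
    push Not at h5
    nlinarith
  nlinarith

lemma J_inj {g t : ℂ} (hg : ‖g‖ < 1) (ht : ‖t‖ < 1) (hg0 : g ≠ 0) (ht0 : t ≠ 0)
    (h : g + g⁻¹ = t + t⁻¹) : g = t := by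
  have h1 : (g - t) * (1 - g * t) = 0 := by
    field_simp at h
    linear_combination -h
  rcases mul_eq_zero.mp h1 with h2 | h2
  · exact sub_eq_zero.mp h2
  · exfalso
    have : ‖g * t‖ = 1 := by rw [← sub_eq_zero.mp h2]; simp
    rw [norm_mul] at this
    nlinarith [norm_nonneg g, norm_nonneg t]

lemma sg_J {g : ℂ} (hg : g.im < 0) (hg1 : ‖g‖ < 1) : 0 < (g + g⁻¹).im ∧ sg (g + g⁻¹) = g := by
  have hg0 : g ≠ 0 := by rintro rfl; simp at hg
  have h : 0 < (g + g⁻¹).im := by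
    rw [J_im hg0]
    have : 0 < ‖g‖ := norm_pos_iff.mpr hg0
    have : 0 < 1 - ‖g‖ ^ 2 := by nlinarith
    have : 0 < -g.im := by linarith
    positivity
  exact ⟨h, J_inj (sg_norm h) hg1 (sg_ne _) hg0 (sg_add _)⟩

lemma slit_of_im {z : ℂ} (hz : 0 < z.im) : 4 - z ^ 2 ∈ slitPlane := by
  rw [Complex.mem_slitPlane_iff]
  have e1 : (4 - z ^ 2).re = 4 - z.re ^ 2 + z.im ^ 2 := by simp [pow_two]; ring
  have e2 : (4 - z ^ 2).im = -2 * z.re * z.im := by simp [pow_two]; ring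
  rw [e1, e2]
  by_cases h : z.re = 0
  · left; rw [h]; positivity
  · right; exact mul_ne_zero (mul_ne_zero (by norm_num) h) hz.ne'

lemma sg_diff {z : ℂ} (hz : 4 - z ^ 2 ∈ slitPlane) : DifferentiableAt ℂ sg z := by
  unfold sg
  have : DifferentiableAt ℂ (fun z : ℂ => (4 - z ^ 2) ^ (1 / 2 : ℂ)) z :=
    DifferentiableAt.cpow_const (by fun_prop) hz
  fun_prop

lemma sg_hasDeriv {z : ℂ} (hz : 0 < z.im) :
    HasDerivAt sg (sg z ^ 2 / (sg z ^ 2 - 1)) z := by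
  have hd := (sg_diff (slit_of_im hz)).hasDerivAt
  have h0 := sg_ne z
  have h1 : HasDerivAt (fun z => sg z + (sg z)⁻¹) (deriv sg z + -(deriv sg z) / sg z ^ 2) z :=
    hd.add (hd.inv h0)
  have h2 : HasDerivAt (fun z => sg z + (sg z)⁻¹) 1 z := by
    have : (fun z => sg z + (sg z)⁻¹) = id := by ext z; exact sg_add z
    rw [this]; exact hasDerivAt_id z
  have h3 := h1.unique h2
  have h4 : sg z ^ 2 - 1 ≠ 0 := by
    intro h
    have : ‖sg z ^ 2‖ = 1 := by rw [sub_eq_zero.mp h]; simp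
    rw [norm_pow] at this
    nlinarith [sg_norm hz, norm_nonneg (sg z)]
  have h5 : deriv sg z = sg z ^ 2 / (sg z ^ 2 - 1) := by
    rw [eq_div_iff h4]; field_simp at h3; linear_combination h3
  rwa [h5] at hd

lemma sg_ray {z : ℂ} (hz : 0 < z.im) :
    HasDerivAt (fun z => sg z ^ 2 / 2 - Complex.log (I * sg z)) (sg z) z := by
  have hd := sg_hasDeriv hz
  have h0 := sg_ne z
  have h4 : sg z ^ 2 - 1 ≠ 0 := by
    intro h
    have : ‖sg z ^ 2‖ = 1 := by rw [sub_eq_zero.mp h]; simp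
    rw [norm_pow] at this
    nlinarith [sg_norm hz, norm_nonneg (sg z)]
  have hs : I * sg z ∈ slitPlane := by
    rw [Complex.mem_slitPlane_iff]; left; simp; exact sg_im hz
  have := ((hd.pow 2).div_const 2).sub ((hd.const_mul I).clog hs)
  refine HasDerivAt.congr_deriv this ?_
  have : I ≠ 0 := I_ne_zero
  simp only [Nat.cast_ofNat]
  field_simp
  ring

/-- antiderivative along vertical lines -/
lemma sg_vert (x : ℝ) {y : ℝ} (hy : 0 < y) :
    HasDerivAt (fun y : ℝ => (sg (x + y * I) ^ 2 / 2).re - Real.log ‖sg (x + y * I)‖)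
      (-(sg (x + y * I)).im) y := by
  have hz : 0 < ((x : ℂ) + y * I).im := by simpa using hy
  have h1 := sg_ray hz
  have h2 : HasDerivAt (fun y : ℂ => (x : ℂ) + y * I) I (y : ℂ) := by
    simpa using ((hasDerivAt_id (y : ℂ)).mul_const I).const_add (x : ℂ)
  have h3 := (h1.comp (y : ℂ) h2).real_of_complex
  convert h3 using 1
  · ext y
    simp [Complex.log_re]
  · simp

lemma sg_meas : Measurable sg := by
  unfold sg
  fun_prop

def sc : Measure ℝ := Measure.map (fun θ : ℝ => 2 * Real.cos θ)
  ((volume.restrict (Ioc 0 (2 * Real.pi))).withDensity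
    (fun θ => ENNReal.ofReal (Real.sin θ ^ 2 / Real.pi)))

lemma sc_int {E : Type*} [NormedAddCommGroup E] [NormedSpace ℝ E] (f : ℝ → E)
    (hf : StronglyMeasurable f) :
    ∫ x, f x ∂sc = ∫ θ in (0 : ℝ)..(2 * Real.pi), (Real.sin θ ^ 2 / Real.pi) • f (2 * Real.cos θ) := by
  rw [sc, integral_map (by fun_prop) hf.aestronglyMeasurable,
    integral_withDensity_eq_integral_toReal_smul (by fun_prop) (by simp),
    intervalIntegral.integral_of_le (by positivity)]
  congr 1; ext θ
  rw [ENNReal.toReal_ofReal (by positivity)]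

lemma sc_univ : sc univ = 1 := by
  rw [sc, Measure.map_apply (by fun_prop) MeasurableSet.univ, preimage_univ,
    withDensity_apply _ MeasurableSet.univ, Measure.restrict_univ,
    ← ofReal_integral_eq_lintegral_ofReal]
  · rw [← intervalIntegral.integral_of_le (by positivity), intervalIntegral.integral_div,
      integral_sin_sq]
    simp
  · have : Continuous (fun θ : ℝ => Real.sin θ ^ 2 / Real.pi) := by fun_prop
    exact (this.integrableOn_Ioc)
  · exact Eventually.of_forall fun θ => by positivity

instance : IsProbabilityMeasure sc := ⟨sc_univ⟩

lemma sc_ae : ∀ᵐ x ∂sc, |x| ≤ 2 := by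
  rw [sc, ae_map_iff (by fun_prop) (measurableSet_le (by fun_prop) (by fun_prop))]
  refine Eventually.of_forall fun θ => ?_
  rw [abs_mul]; have := Real.abs_cos_le_one θ; norm_num; linarith

lemma sc_sq_integrable : Integrable (fun x : ℝ => x ^ 2) sc := by
  refine Integrable.of_bound (C := 4) (by fun_prop) ?_
  filter_upwards [sc_ae] with x hx
  rw [Real.norm_eq_abs, abs_pow]
  nlinarith [abs_nonneg x]

lemma sc_sq : ∫ x, x ^ 2 ∂sc = 1 := by
  rw [sc_int _ (by fun_prop)]
  have e : ∀ θ : ℝ, (Real.sin θ ^ 2 / Real.pi) • (2 * Real.cos θ) ^ 2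
      = (4 / Real.pi) * (Real.sin θ ^ 2 * Real.cos θ ^ 2) := by
    intro θ; simp; ring
  simp_rw [e]
  rw [intervalIntegral.integral_const_mul, integral_sin_sq_mul_cos_sq]
  have h8 : Real.sin (4 * (2 * Real.pi)) = 0 := by
    have := Real.sin_nat_mul_pi 8
    rw [← this]; congr 1; push_cast; ring
  rw [h8]; simp
  have := Real.pi_ne_zero
  field_simp; norm_num

lemma sc_poisson {g : ℂ} (hg : ‖g‖ < 1) (hg0 : g ≠ 0) (hz : ∀ θ : ℝ, g + g⁻¹ - 2 * Complex.cos θ ≠ 0) :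
    ∫ θ in (0 : ℝ)..(2 * Real.pi), (g + g⁻¹ - 2 * Complex.cos θ)⁻¹ = 2 * Real.pi * (g / (1 - g ^ 2)) := by
  have hne : ∀ ζ : ℂ, ‖ζ‖ ≤ 1 → 1 - g * ζ ≠ 0 := by
    intro ζ hζ h
    have : ‖g * ζ‖ = 1 := by rw [← sub_eq_zero.mp h]; simp
    rw [norm_mul] at this
    nlinarith [norm_nonneg g, norm_nonneg ζ]
  have hd : DiffContOnCl ℂ (fun ζ => g / (1 - g * ζ)) (Metric.ball 0 1) := by
    refine DifferentiableOn.diffContOnCl_ball (U := Metric.closedBall 0 1) ?_ subset_rfl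
    intro ζ hζ
    have := hne ζ (by simpa using hζ)
    have hq : DifferentiableAt ℂ (fun ζ : ℂ => 1 - g * ζ) ζ := by fun_prop
    exact DifferentiableAt.differentiableWithinAt (DifferentiableAt.fun_div (differentiableAt_const g) hq this)
  have h := hd.circleIntegral_sub_inv_smul (w := g) (by simpa using hg)
  rw [circleIntegral] at h
  have e : ∀ θ : ℝ, deriv (circleMap 0 1) θ • ((circleMap 0 1 θ - g)⁻¹ • (g / (1 - g * circleMap 0 1 θ)))
      = I * (g + g⁻¹ - 2 * Complex.cos θ)⁻¹ := by
    intro θ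
    have hc : circleMap 0 1 θ = exp (θ * I) := by simp [circleMap]
    have hζ : ‖circleMap 0 1 θ‖ = 1 := by simp
    rw [deriv_circleMap, smul_eq_mul, smul_eq_mul]
    have hcos : 2 * Complex.cos θ = circleMap 0 1 θ + (circleMap 0 1 θ)⁻¹ := by
      rw [hc, Complex.cos, ← Complex.exp_neg]; ring_nf
    have hz' := hz θ
    rw [hcos] at hz' ⊢
    set ζ := circleMap 0 1 θ
    have hζ0 : ζ ≠ 0 := by intro h; rw [h] at hζ; simp at hζ
    have h1 := hne ζ hζ.le
    have h2 : ζ - g ≠ 0 := by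
      intro h; rw [sub_eq_zero] at h; rw [h] at hζ; linarith
    have h3 : (ζ - g) * (1 - g * ζ) = ζ * g * (g + g⁻¹ - (ζ + ζ⁻¹)) := by
      field_simp; ring
    have h4 : (g + g⁻¹ - (ζ + ζ⁻¹)) = (ζ - g) * (1 - g * ζ) / (ζ * g) := by
      rw [h3]; field_simp
    rw [h4]
    field_simp
  simp_rw [e] at h
  rw [intervalIntegral.integral_const_mul, smul_eq_mul] at h
  have : I ≠ 0 := I_ne_zero
  refine mul_left_cancel₀ this ?_
  rw [h]; ring

lemma sc_cauchy {z : ℂ} (hz : 0 < z.im) : cauchy sc z = sg z := by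
  have hg0 := sg_ne z
  have hza := sg_add z
  have hne : ∀ θ : ℝ, z - 2 * Complex.cos θ ≠ 0 := by
    intro θ h
    have := sub_ne hz (2 * Real.cos θ)
    apply this; push_cast; exact h
  have hP := sc_poisson (sg_norm hz) hg0 (by rw [hza]; exact hne)
  rw [hza] at hP
  have h4 : 1 - sg z ^ 2 ≠ 0 := by
    intro h
    have : ‖sg z ^ 2‖ = 1 := by rw [← sub_eq_zero.mp h]; simp
    rw [norm_pow] at this
    nlinarith [sg_norm hz, norm_nonneg (sg z)]
  rw [cauchy, sc_int _ (meas_inv_sub z).stronglyMeasurable]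
  have e : ∀ θ : ℝ, (Real.sin θ ^ 2 / Real.pi) • (z - ((2 * Real.cos θ : ℝ) : ℂ))⁻¹
      = ((4 - z ^ 2) / (4 * Real.pi)) * (z - 2 * Complex.cos θ)⁻¹ + (1 / (4 * Real.pi)) * (z + 2 * Complex.cos θ) := by
    intro θ
    have h1 := hne θ
    have hs : (Complex.sin θ) ^ 2 = 1 - Complex.cos θ ^ 2 := Complex.sin_sq _
    have hpi : (Real.pi : ℂ) ≠ 0 := by exact_mod_cast Real.pi_ne_zero
    rw [Complex.real_smul]
    push_cast
    rw [hs]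
    have h2 := inv_mul_cancel₀ h1
    linear_combination (z + 2 * Complex.cos θ) / (4 * Real.pi) * h2
  simp_rw [e]
  have c1 : Continuous (fun θ : ℝ => (z - 2 * Complex.cos θ)⁻¹) :=
    Continuous.inv₀ (by fun_prop) hne
  have c2 : ∫ θ in (0 : ℝ)..(2 * Real.pi), (z + 2 * Complex.cos θ) = 2 * Real.pi * z := by
    rw [intervalIntegral.integral_add (by simp) (Continuous.intervalIntegrable (by fun_prop) _ _)]
    rw [intervalIntegral.integral_const_mul]
    have : ∫ θ in (0 : ℝ)..(2 * Real.pi), Complex.cos θ = 0 := by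
      have := @integral_cos 0 (2 * Real.pi)
      simp_rw [← Complex.ofReal_cos]
      rw [intervalIntegral.integral_ofReal, this]; simp
    rw [this]; simp
  rw [intervalIntegral.integral_add (Continuous.intervalIntegrable (by fun_prop) _ _)
    (Continuous.intervalIntegrable (by fun_prop) _ _), intervalIntegral.integral_const_mul,
    intervalIntegral.integral_const_mul, hP, c2]
  have hpi : (Real.pi : ℂ) ≠ 0 := by exact_mod_cast Real.pi_ne_zero
  have hz2 : z = (sg z ^ 2 + 1) / sg z := by
    rw [eq_div_iff hg0]; nth_rw 1 [← hza]; field_simp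
  set g := sg z
  rw [hz2]
  field_simp
  ring

structure Nice (α : Measure ℝ) : Prop where
  prob : IsProbabilityMeasure α
  sq : Integrable (fun x => x ^ 2) α
  bd : ∃ B : ℝ, ∀ z : ℂ, 0 < z.im → ‖cauchy α z‖ ≤ B

def Kf (α : Measure ℝ) (s y : ℝ) : ℝ := -(cauchy α (s + y * I)).im - y / (1 + y ^ 2)

def Vf (α : Measure ℝ) (s : ℝ) : ℝ := ∫ y in Ioi (0 : ℝ), Kf α s y

def Qf (α β : Measure ℝ) (y : ℝ) : ℝ := ∫ s, -(cauchy α (s + y * I)).im ∂β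

lemma nice_sc : Nice sc :=
  ⟨inferInstance, sc_sq_integrable, 1, fun z hz => by rw [sc_cauchy hz]; exact (sg_norm hz).le⟩

lemma cauchy_meas (α : Measure ℝ) [SFinite α] : Measurable (cauchy α) := by
  have : StronglyMeasurable (fun z : ℂ => ∫ u, (fun p : ℂ × ℝ => (p.1 - (p.2 : ℂ))⁻¹) (z, u) ∂α) :=
    StronglyMeasurable.integral_prod_right (by
      refine Measurable.stronglyMeasurable ?_
      fun_prop)
  exact this.measurable

lemma Kf_meas (α : Measure ℝ) [SFinite α] : Measurable (fun p : ℝ × ℝ => Kf α p.1 p.2) := by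
  have := cauchy_meas α
  unfold Kf
  fun_prop

lemma norm_line (s t y : ℝ) : ‖((s : ℂ) + y * I) - t‖ ^ 2 = (s - t) ^ 2 + y ^ 2 := by
  rw [← Complex.normSq_eq_norm_sq, Complex.normSq_apply]
  simp; ring

lemma im_line (s y : ℝ) : ((s : ℂ) + y * I).im = y := by simp

lemma pois_int (α : Measure ℝ) [IsProbabilityMeasure α] (s : ℝ) {y : ℝ} (hy : 0 < y) :
    Integrable (fun t => y / ((s - t) ^ 2 + y ^ 2)) α ∧
    -(cauchy α (s + y * I)).im = ∫ t, y / ((s - t) ^ 2 + y ^ 2) ∂α := by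
  have h1 := cauchy_im α (z := (s : ℂ) + y * I) (by simpa using hy)
  have h2 := integrable_pois α (z := (s : ℂ) + y * I) (by simpa using hy)
  simp_rw [norm_line, im_line] at h1 h2
  exact ⟨h2, by rw [h1]; ring⟩

lemma Kf_eq (α : Measure ℝ) [IsProbabilityMeasure α] (s : ℝ) {y : ℝ} (hy : 0 < y) :
    Kf α s y = ∫ t, (y / ((s - t) ^ 2 + y ^ 2) - y / (1 + y ^ 2)) ∂α := by
  obtain ⟨h1, h2⟩ := pois_int α s hy
  rw [integral_sub h1 (integrable_const _), Kf, h2]; simp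

lemma Kf_bd {α : Measure ℝ} (h : Nice α) : ∃ C : ℝ, ∀ s y : ℝ, 0 < y →
    |Kf α s y| ≤ C * (1 + s ^ 2) * (1 + y ^ 2)⁻¹ := by
  have := h.prob
  obtain ⟨B, hB⟩ := h.bd
  have hB0 : 0 ≤ B := (norm_nonneg _).trans (hB I (by simp))
  set m := ∫ t, t ^ 2 ∂α with hm
  have hm0 : 0 ≤ m := integral_nonneg fun t => by positivity
  refine ⟨2 * (B + 1) + 2 * (2 + 2 * m), fun s y hy => ?_⟩
  have hs : 0 ≤ s ^ 2 := by positivity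
  rw [← div_eq_mul_inv, le_div_iff₀ (by positivity)]
  rcases le_total y 1 with h1 | h1
  · have a1 : |Kf α s y| ≤ B + 1 := by
      rw [Kf]
      refine (abs_sub _ _).trans ?_
      have e1 : |-(cauchy α (s + y * I)).im| ≤ B := by
        rw [abs_neg]; exact (Complex.abs_im_le_norm _).trans (hB _ (by simpa using hy))
      have e2 : |y / (1 + y ^ 2)| ≤ 1 := by
        rw [abs_of_nonneg (by positivity), div_le_one (by positivity)]; nlinarith
      linarith
    have a2 : 1 + y ^ 2 ≤ 2 := by nlinarith
    calc _ ≤ (B + 1) * 2 := by gcongr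
      _ ≤ (2 * (B + 1) + 2 * (2 + 2 * m)) * 1 := by linarith
      _ ≤ _ := by gcongr; linarith
  · have a1 : |Kf α s y| ≤ ∫ t, (1 + 2 * s ^ 2 + 2 * t ^ 2) / y ^ 3 ∂α := by
      rw [Kf_eq α s hy]
      refine (abs_integral_le_integral_abs).trans ?_
      refine integral_mono_of_nonneg (Eventually.of_forall fun t => abs_nonneg _) ?_
        (Eventually.of_forall fun t => ?_)
      · exact Integrable.div_const ((integrable_const _).add (h.sq.const_mul 2)) _
      · have e : y / ((s - t) ^ 2 + y ^ 2) - y / (1 + y ^ 2)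
          = (1 - (s - t) ^ 2) * (y / (((s - t) ^ 2 + y ^ 2) * (1 + y ^ 2))) := by
          field_simp; ring
        show |_| ≤ _
        rw [e, abs_mul]
        have e1 : |1 - (s - t) ^ 2| ≤ 1 + 2 * s ^ 2 + 2 * t ^ 2 := by
          rw [abs_le]; constructor <;> nlinarith [sq_nonneg (s + t), sq_nonneg (s - t)]
        have e2 : |y / (((s - t) ^ 2 + y ^ 2) * (1 + y ^ 2))| ≤ 1 / y ^ 3 := by
          rw [abs_of_nonneg (by positivity), div_le_div_iff₀ (by positivity) (by positivity)]
          have : y ^ 2 * y ^ 2 ≤ ((s - t) ^ 2 + y ^ 2) * (1 + y ^ 2) := by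
            gcongr <;> nlinarith [sq_nonneg (s - t)]
          nlinarith
        calc _ ≤ (1 + 2 * s ^ 2 + 2 * t ^ 2) * (1 / y ^ 3) := by gcongr
          _ = _ := by ring
    have a2 : ∫ t, (1 + 2 * s ^ 2 + 2 * t ^ 2) / y ^ 3 ∂α = (1 + 2 * s ^ 2 + 2 * m) / y ^ 3 := by
      rw [integral_div, integral_add (integrable_const _) (h.sq.const_mul 2), integral_const_mul]
      simp [hm]
    rw [a2] at a1
    have a3 : (1 + y ^ 2) / y ^ 3 ≤ 2 := by
      rw [div_le_iff₀ (by positivity)]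
      have : 1 ≤ y ^ 2 := by nlinarith
      nlinarith
    calc _ ≤ (1 + 2 * s ^ 2 + 2 * m) / y ^ 3 * (1 + y ^ 2) := by gcongr
      _ = (1 + 2 * s ^ 2 + 2 * m) * ((1 + y ^ 2) / y ^ 3) := by ring
      _ ≤ (1 + 2 * s ^ 2 + 2 * m) * 2 := by gcongr
      _ ≤ _ := by nlinarith [mul_nonneg hm0 hs, mul_nonneg hB0 hs]

lemma Kf_int {α β : Measure ℝ} (h : Nice α) (hβ : Nice β) :
    Integrable (fun p : ℝ × ℝ => Kf α p.1 p.2) (β.prod (volume.restrict (Ioi 0))) := by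
  have := h.prob
  have := hβ.prob
  obtain ⟨C, hC⟩ := Kf_bd h
  have hb : Integrable (fun p : ℝ × ℝ => (C * (1 + p.1 ^ 2)) * (1 + p.2 ^ 2)⁻¹)
      (β.prod (volume.restrict (Ioi 0))) := by
    refine Integrable.mul_prod (f := fun s => C * (1 + s ^ 2)) (g := fun y : ℝ => (1 + y ^ 2)⁻¹) ?_ ?_
    · exact ((integrable_const _).add hβ.sq).const_mul C
    · exact integrable_inv_one_add_sq.restrict
  refine hb.mono' (Kf_meas α).aestronglyMeasurable ?_
  have hpos : ∀ᵐ p ∂(β.prod (volume.restrict (Ioi (0 : ℝ)))), 0 < p.2 :=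
    Measure.quasiMeasurePreserving_snd.ae (ae_restrict_mem measurableSet_Ioi)
  filter_upwards [hpos] with p hp
  exact hC p.1 p.2 hp

lemma Kf_int1 {α : Measure ℝ} (h : Nice α) (s : ℝ) : IntegrableOn (fun y => Kf α s y) (Ioi 0) := by
  have := h.prob
  obtain ⟨C, hC⟩ := Kf_bd h
  refine Integrable.mono' (g := fun y => C * (1 + s ^ 2) * (1 + y ^ 2)⁻¹) ?_ ?_ ?_
  · exact (integrable_inv_one_add_sq.restrict).const_mul _
  · exact ((Kf_meas α).comp (measurable_const.prodMk measurable_id)).aestronglyMeasurable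
  · filter_upwards [ae_restrict_mem measurableSet_Ioi] with y hy
    exact hC s y hy

lemma Qf_eq {α β : Measure ℝ} (h : Nice α) (hβ : Nice β) :
    Integrable (Vf α) β ∧
    IntegrableOn (fun y => Qf α β y - y / (1 + y ^ 2)) (Ioi 0) ∧
    ∫ y in Ioi (0 : ℝ), (Qf α β y - y / (1 + y ^ 2)) = ∫ s, Vf α s ∂β := by
  have := h.prob
  have := hβ.prob
  have hi := Kf_int h hβ
  have hQ : ∀ y ∈ Ioi (0 : ℝ), ∫ s, Kf α s y ∂β = Qf α β y - y / (1 + y ^ 2) := by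
    intro y hy
    unfold Kf Qf
    have hint : Integrable (fun s : ℝ => -(cauchy α (s + y * I)).im) β := by
      obtain ⟨B, hB⟩ := h.bd
      refine Integrable.of_bound (C := B) ?_ (Eventually.of_forall fun s => ?_)
      · have := cauchy_meas α
        exact Measurable.aestronglyMeasurable (by fun_prop)
      · rw [norm_neg]; exact (Complex.abs_im_le_norm _).trans (hB _ (by simpa using hy))
    rw [integral_sub hint (integrable_const _)]; simp
  refine ⟨hi.integral_prod_left, ?_, ?_⟩
  · refine (hi.integral_prod_right).congr ?_
    filter_upwards [ae_restrict_mem measurableSet_Ioi] with y hy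
    exact hQ y hy
  · have := integral_integral_swap (f := fun s y => Kf α s y) (μ := β)
      (ν := volume.restrict (Ioi (0 : ℝ))) hi
    unfold Vf
    rw [this]
    exact (setIntegral_congr_fun measurableSet_Ioi hQ).symm

lemma sg_le {z : ℂ} (hz : 0 < z.im) : ‖sg z‖ ≤ 1 / z.im := by
  have h1 : sg z * (z - sg z) = 1 := by
    have := sg_add z
    have h0 := sg_ne z
    have : z - sg z = (sg z)⁻¹ := by linear_combination -this
    rw [this, mul_inv_cancel₀ h0]
  have h2 : z.im ≤ ‖z - sg z‖ := by
    have := Complex.abs_im_le_norm (z - sg z)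
    have h3 := sg_im hz
    rw [Complex.sub_im] at this
    exact le_trans (by linarith) ((le_abs_self _).trans this)
  rw [le_div_iff₀ hz]
  calc _ ≤ ‖sg z‖ * ‖z - sg z‖ := by gcongr
    _ = 1 := by rw [← norm_mul, h1, norm_one]

lemma sg_top (x : ℝ) : Tendsto (fun y : ℝ => sg (x + y * I)) atTop (𝓝 0) := by
  rw [tendsto_zero_iff_norm_tendsto_zero]
  refine squeeze_zero' (g := fun y : ℝ => y⁻¹) (Eventually.of_forall fun y => norm_nonneg _) ?_ tendsto_inv_atTop_zero
  filter_upwards [eventually_gt_atTop 0] with y hy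
  have := sg_le (z := (x : ℂ) + y * I) (by simpa using hy)
  rwa [im_line, one_div] at this

lemma ratio_lim (a b : ℝ) : Tendsto (fun x : ℝ => (a + x ^ 2) / (b + x ^ 2)) atTop (𝓝 1) := by
  have h1 : ∀ c : ℝ, Tendsto (fun x : ℝ => c / x ^ 2 + 1) atTop (𝓝 1) := by
    intro c
    have : Tendsto (fun x : ℝ => c / x ^ 2) atTop (𝓝 0) :=
      tendsto_const_nhds.div_atTop (tendsto_pow_atTop (by norm_num))
    simpa using this.add_const 1
  have h2 := (h1 a).div (h1 b) (by norm_num)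
  rw [div_one] at h2
  refine h2.congr' ?_
  filter_upwards [eventually_gt_atTop 0] with x hx
  show (a / x ^ 2 + 1) / (b / x ^ 2 + 1) = _
  field_simp

lemma anti_lim (x : ℝ) : Tendsto (fun y : ℝ => (sg (x + y * I) ^ 2 / 2).re
    - Real.log ‖sg (x + y * I)‖ - 1 / 2 * Real.log (1 + y ^ 2)) atTop (𝓝 0) := by
  have h1 := sg_top x
  have h2 : Tendsto (fun y : ℝ => (sg (x + y * I) ^ 2 / 2).re
    - Real.log ‖1 + sg (x + y * I) ^ 2‖ + 1 / 2 * Real.log ((x ^ 2 + y ^ 2) / (1 + y ^ 2))) atTop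
    (𝓝 ((((0:ℂ) ^ 2 / 2).re - Real.log ‖1 + (0:ℂ) ^ 2‖) + 1 / 2 * Real.log 1)) := by
    refine Tendsto.add (Tendsto.sub ?_ ?_) ?_
    · exact (Complex.continuous_re.tendsto _).comp ((h1.pow 2).div_const 2)
    · exact ((((h1.pow 2).const_add 1)).norm).log (by simp)
    · exact ((ratio_lim (x ^ 2) 1).log (by norm_num)).const_mul _
  have h3 : ((((0:ℂ) ^ 2 / 2).re - Real.log ‖1 + (0:ℂ) ^ 2‖) + 1 / 2 * Real.log 1) = 0 := by simp
  rw [h3] at h2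
  refine h2.congr' ?_
  filter_upwards [eventually_gt_atTop 0] with y hy
  have hz : 0 < ((x : ℂ) + y * I).im := by simpa using hy
  have h0 := sg_ne ((x : ℂ) + y * I)
  have h4 : 1 + sg (x + y * I) ^ 2 = sg (x + y * I) * (x + y * I) := by
    have := sg_add ((x : ℂ) + y * I)
    have h7 := mul_inv_cancel₀ h0
    linear_combination sg (x + y * I) * this - h7
  have h5 : ‖(x : ℂ) + y * I‖ ^ 2 = x ^ 2 + y ^ 2 := by
    have := norm_line x 0 y
    simpa using this
  have h6 : 0 < ‖(x : ℂ) + y * I‖ := norm_pos_iff.mpr (by intro h; rw [h] at hz; simp at hz)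
  rw [h4, norm_mul, Real.log_mul (norm_ne_zero_iff.mpr h0) h6.ne', ← h5,
    Real.log_div (by positivity) (by positivity), Real.log_pow]
  push_cast
  ring

lemma Vsc_of_lim (x : ℝ) {g0 : ℂ} (h0 : g0 ≠ 0)
    (hl : Tendsto (fun y : ℝ => sg (x + y * I)) (𝓝[>] 0) (𝓝 g0)) :
    Vf sc x = Real.log ‖g0‖ - (g0 ^ 2 / 2).re := by
  set A : ℝ → ℝ := fun y => (sg (x + y * I) ^ 2 / 2).re
    - Real.log ‖sg (x + y * I)‖ - 1 / 2 * Real.log (1 + y ^ 2) with hA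
  set L := (g0 ^ 2 / 2).re - Real.log ‖g0‖ with hL
  have hlim : Tendsto A (𝓝[>] 0) (𝓝 L) := by
    have h2 : Tendsto A (𝓝[>] 0) (𝓝 (L - 1 / 2 * Real.log (1 + 0 ^ 2))) := by
      refine Tendsto.sub (Tendsto.sub ?_ ?_) ?_
      · exact (Complex.continuous_re.tendsto _).comp ((hl.pow 2).div_const 2)
      · exact hl.norm.log (by simpa using h0)
      · refine Tendsto.mono_left ?_ nhdsWithin_le_nhds
        have : ContinuousAt (fun y : ℝ => 1 / 2 * Real.log (1 + y ^ 2)) 0 :=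
          ContinuousAt.mul continuousAt_const (ContinuousAt.log (by fun_prop) (by norm_num))
        exact this
    simpa using h2
  have hder : ∀ y ∈ Ioi (0 : ℝ), HasDerivAt (Function.update A 0 L) (Kf sc x y) y := by
    intro y hy
    have hy' : (0 : ℝ) < y := hy
    have h1 := sg_vert x hy'
    have h2 : HasDerivAt (fun y : ℝ => 1 / 2 * Real.log (1 + y ^ 2)) (1 / 2 * ((2 * y) / (1 + y ^ 2))) y := by
      refine HasDerivAt.const_mul _ (HasDerivAt.log ?_ (by positivity))
      simpa using (hasDerivAt_pow 2 y).const_add 1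
    have h3 : HasDerivAt A (Kf sc x y) y := by
      have := h1.sub h2
      refine HasDerivAt.congr_deriv this ?_
      rw [Kf, sc_cauchy (by simpa using hy')]
      field_simp
    refine h3.congr_of_eventuallyEq ?_
    filter_upwards [isOpen_Ioi.mem_nhds hy] with t ht
    exact Function.update_of_ne (ne_of_gt ht) _ _
  have h := integral_Ioi_of_hasDerivAt_of_tendsto (f := Function.update A 0 L) (a := 0) (m := 0)
    (f' := fun y => Kf sc x y) ?_ hder (Kf_int1 nice_sc x) ?_
  · rw [Vf, h]; simp [hL]
  · rw [continuousWithinAt_update_same]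
    rwa [show Ici (0 : ℝ) \ {0} = Ioi 0 from by ext t; simp [lt_iff_le_and_ne, eq_comm]]
  · refine (anti_lim x).congr' ?_
    filter_upwards [eventually_gt_atTop 0] with y hy
    exact (Function.update_of_ne (ne_of_gt hy) L A).symm

lemma line_tendsto (x : ℝ) : Tendsto (fun y : ℝ => (x : ℂ) + y * I) (𝓝[>] 0) (𝓝 (x : ℂ)) := by
  refine Tendsto.mono_left ?_ nhdsWithin_le_nhds
  have : Continuous (fun y : ℝ => (x : ℂ) + y * I) := by fun_prop
  simpa using this.tendsto 0

lemma Vsc_in {x : ℝ} (hx : |x| < 2) : Vf sc x = 1 / 2 - x ^ 2 / 4 := by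
  have hx2 : 0 < 4 - x ^ 2 := by
    have := sq_lt_sq' (abs_lt.mp hx).1 (abs_lt.mp hx).2; linarith
  have hcast : (4 : ℂ) - (x : ℂ) ^ 2 = ((4 - x ^ 2 : ℝ) : ℂ) := by push_cast; ring
  have hs : (4 - (x : ℂ) ^ 2) ∈ slitPlane := by
    rw [hcast]; exact Complex.ofReal_mem_slitPlane.mpr hx2
  have hc := (sg_diff hs).continuousAt.tendsto.comp (line_tendsto x)
  rw [Vsc_of_lim x (sg_ne _) hc]
  have hsq : ((4 : ℂ) - (x : ℂ) ^ 2) ^ (1 / 2 : ℂ) = ((√(4 - x ^ 2) : ℝ) : ℂ) := by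
    rw [hcast, Real.sqrt_eq_rpow, Complex.ofReal_cpow hx2.le]; push_cast; rfl
  have e : sg x = ((x / 2 : ℝ) : ℂ) + ((-√(4 - x ^ 2) / 2 : ℝ) : ℂ) * I := by
    rw [sg, hsq]; push_cast; ring
  have hss := Real.sq_sqrt hx2.le
  have hn : ‖sg (x : ℂ)‖ ^ 2 = 1 := by
    rw [← Complex.normSq_eq_norm_sq, e, Complex.normSq_add_mul_I]
    linear_combination hss / 4
  have hn1 : ‖sg (x : ℂ)‖ = 1 := by
    have := norm_nonneg (sg (x : ℂ)); nlinarith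
  have hre : (sg (x : ℂ) ^ 2 / 2).re = (x ^ 2 - 2) / 4 := by
    rw [show (2 : ℂ) = ((2 : ℝ) : ℂ) by norm_num, Complex.div_ofReal_re, e]
    simp [pow_two]
    ring_nf
    rw [hss]; ring
  rw [hn1, hre]; simp; ring

lemma Vsc_out {x : ℝ} (hx : 2 < |x|) : ∃ r : ℝ, 0 < r ∧ r < 1 ∧ |x| = r + r⁻¹ ∧
    √(x ^ 2 - 4) = r⁻¹ - r ∧ Vf sc x = Real.log r - r ^ 2 / 2 := by
  have hx2 : 0 < x ^ 2 - 4 := by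
    have := sq_abs x; nlinarith
  obtain ⟨σ, hσ, hσx⟩ : ∃ σ : ℝ, σ ^ 2 = 1 ∧ x = σ * |x| := by
    rcases le_total 0 x with h | h
    · exact ⟨1, by norm_num, by rw [abs_of_nonneg h]; ring⟩
    · exact ⟨-1, by norm_num, by rw [abs_of_nonpos h]; ring⟩
  set S := √(x ^ 2 - 4) with hS
  have hS2 : S ^ 2 = x ^ 2 - 4 := Real.sq_sqrt hx2.le
  have hS0 : 0 < S := Real.sqrt_pos.mpr hx2
  have hSx : S < |x| := by
    have := sq_abs x; nlinarith [abs_nonneg x]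
  set r := (|x| - S) / 2 with hr
  have hr0 : 0 < r := by rw [hr]; linarith
  have hrinv : r⁻¹ = (|x| + S) / 2 := by
    refine inv_eq_of_mul_eq_one_right ?_
    rw [hr]; have := sq_abs x; nlinarith
  have hr1 : r < 1 := by
    have h1 : 1 < r⁻¹ := by rw [hrinv]; linarith
    exact (one_lt_inv₀ hr0).mp h1
  refine ⟨r, hr0, hr1, by rw [hrinv, hr]; ring, by rw [hrinv, hr]; ring, ?_⟩
  set gt : ℂ → ℂ := fun z => (z - σ * ((z ^ 2 - 4) ^ (1 / 2 : ℂ))) / 2 with hgt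
  have hcast : (x : ℂ) ^ 2 - 4 = ((x ^ 2 - 4 : ℝ) : ℂ) := by push_cast; ring
  have hs : ((x : ℂ) ^ 2 - 4) ∈ slitPlane := by
    rw [hcast]; exact Complex.ofReal_mem_slitPlane.mpr hx2
  have hsq : ((x : ℂ) ^ 2 - 4) ^ (1 / 2 : ℂ) = ((S : ℝ) : ℂ) := by
    rw [hcast, hS, Real.sqrt_eq_rpow, Complex.ofReal_cpow hx2.le]; push_cast; rfl
  have hgx : gt x = ((σ * r : ℝ) : ℂ) := by
    rw [hgt]; simp only; rw [hsq, hr]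
    have : (x : ℂ) = σ * ((|x| : ℝ) : ℂ) := by exact_mod_cast hσx
    nth_rw 1 [this]; push_cast; ring
  have hσa : |σ| = 1 := by
    rw [← sq_eq_sq₀ (abs_nonneg _) (by norm_num), sq_abs, hσ]; norm_num
  have hgn : ‖gt x‖ = r := by
    rw [hgx, Complex.norm_real, Real.norm_eq_abs, abs_mul, hσa, one_mul, abs_of_pos hr0]
  have hcont : ContinuousAt gt x := by
    have : DifferentiableAt ℂ (fun z : ℂ => (z ^ 2 - 4) ^ (1 / 2 : ℂ)) x :=
      DifferentiableAt.cpow_const (by fun_prop) hs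
    have h2 := this.continuousAt
    rw [hgt]
    fun_prop
  have hlim : Tendsto (fun y : ℝ => gt (x + y * I)) (𝓝[>] 0) (𝓝 (gt x)) :=
    hcont.tendsto.comp (line_tendsto x)
  have hev : ∀ᶠ y : ℝ in 𝓝[>] 0, ‖gt (x + y * I)‖ < 1 :=
    hlim.norm.eventually_lt_const (by rw [hgn]; exact hr1)
  have hlim2 : Tendsto (fun y : ℝ => sg (x + y * I)) (𝓝[>] 0) (𝓝 (gt x)) := by
    refine hlim.congr' ?_
    filter_upwards [hev, self_mem_nhdsWithin] with y hy1 hy2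
    have hz : 0 < ((x : ℂ) + y * I).im := by simpa using hy2
    set z := (x : ℂ) + y * I
    have hσc : (σ : ℂ) ^ 2 = 1 := by exact_mod_cast hσ
    have hm : gt z * ((z + σ * ((z ^ 2 - 4) ^ (1 / 2 : ℂ))) / 2) = 1 := by
      have h := csqrt_sq (z ^ 2 - 4)
      rw [hgt]; simp only
      set s := (z ^ 2 - 4) ^ (1 / 2 : ℂ)
      linear_combination -(s ^ 2 / 4) * hσc - h / 4
    have hne := left_ne_zero_of_mul_eq_one hm
    refine J_inj hy1 (sg_norm hz) hne (sg_ne _) ?_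
    rw [sg_add, inv_eq_of_mul_eq_one_right hm, hgt]; simp only; ring
  rw [Vsc_of_lim x (by rw [← norm_ne_zero_iff, hgn]; exact hr0.ne') hlim2, hgn, hgx]
  have : ((((σ * r : ℝ) : ℂ)) ^ 2 / 2).re = (σ * r) ^ 2 / 2 := by
    rw [← Complex.ofReal_pow, show (2 : ℂ) = ((2 : ℝ) : ℂ) by norm_num, ← Complex.ofReal_div,
      Complex.ofReal_re]
  rw [this, mul_pow, hσ, one_mul]

def Hf (x : ℝ) : ℝ := Vf sc x + x ^ 2 / 4 - 1 / 2

lemma Hf_in {x : ℝ} (hx : |x| < 2) : Hf x = 0 := by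
  rw [Hf, Vsc_in hx]; ring

lemma Hf_out {x : ℝ} (hx : 2 < |x|) : 0 ≤ Hf x ∧ Hf x ≤ x ^ 2 / 4 ∧
    Hf x ≤ √(x ^ 2 - 4) ^ 3 / 4 := by
  obtain ⟨r, h0, h1, h2, h3, h4⟩ := Vsc_out hx
  have hq1 : 1 < r⁻¹ := (one_lt_inv₀ h0).mpr h1
  have hH : Hf x = Real.log r + ((r⁻¹) ^ 2 - r ^ 2) / 4 := by
    rw [Hf, h4, ← sq_abs x, h2]
    have : r * r⁻¹ = 1 := mul_inv_cancel₀ h0.ne'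
    linear_combination this / 2
  set q := (r⁻¹) ^ 2 with hq
  have hqp : 1 < q := by rw [hq]; nlinarith
  have hlogq : Real.log q = -2 * Real.log r := by
    rw [hq, Real.log_pow, Real.log_inv]; push_cast; ring
  have hr2 : r ^ 2 = q⁻¹ := by rw [hq, inv_pow, inv_inv]
  have hlq : 0 < Real.log q := Real.log_pos hqp
  have u1 : Real.log q ≤ (q - q⁻¹) / 2 := by
    rw [← Real.sinh_log (by linarith)]
    exact Real.self_le_sinh_iff.mpr hlq.le
  have u2 : 2 * (q - 1) / (q - 1 + 2) ≤ Real.log q := by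
    have := Real.le_log_one_add_of_nonneg (x := q - 1) (by linarith)
    rwa [add_sub_cancel] at this
  refine ⟨?_, ?_, ?_⟩
  · rw [hH, hr2]; linarith
  · rw [hH, ← sq_abs x, h2]
    have : r * r⁻¹ = 1 := mul_inv_cancel₀ h0.ne'
    nlinarith
  · rw [hH, h3]
    have hlr : Real.log r ≤ - ((q - 1) / (q - 1 + 2)) := by
      have : 2 * (q - 1) / (q - 1 + 2) = 2 * ((q - 1) / (q - 1 + 2)) := by ring
      linarith
    have e1 : - ((q - 1) / (q - 1 + 2)) + (q - r ^ 2) / 4 = (1 - r ^ 2) ^ 3 / (4 * r ^ 2 * (1 + r ^ 2)) := by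
      have h5 : q - 1 + 2 = (1 + r ^ 2) / r ^ 2 := by rw [hq]; field_simp; ring
      rw [h5, hq]; field_simp; ring
    have e2 : (r⁻¹ - r) ^ 3 / 4 = (1 - r ^ 2) ^ 3 / (4 * r ^ 3) := by field_simp
    have e3 : (1 - r ^ 2) ^ 3 / (4 * r ^ 2 * (1 + r ^ 2)) ≤ (1 - r ^ 2) ^ 3 / (4 * r ^ 3) := by
      have : 0 ≤ 1 - r ^ 2 := by nlinarith
      apply div_le_div_of_nonneg_left (by positivity) (by positivity)
      have : r ≤ 1 + r ^ 2 := by nlinarith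
      calc 4 * r ^ 3 = 4 * r ^ 2 * r := by ring
        _ ≤ _ := by gcongr
    linarith

def kr (η x s t : ℝ) : ℝ := ((x - s) * (x - t) + η ^ 2) / (((x - s) ^ 2 + η ^ 2) * ((x - t) ^ 2 + η ^ 2))

lemma lor_int {η : ℝ} (hη : 0 < η) : Integrable (fun x : ℝ => (x ^ 2 + η ^ 2)⁻¹) := by
  have h := (integrable_inv_one_add_sq.comp_div hη.ne').const_mul (η ^ 2)⁻¹
  refine h.congr (Eventually.of_forall fun x => ?_)
  simp only
  field_simp
  ring

lemma kr_le {η : ℝ} (hη : 0 < η) (x s t : ℝ) :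
    |kr η x s t| ≤ 1 / 2 * (((x - s) ^ 2 + η ^ 2)⁻¹ + ((x - t) ^ 2 + η ^ 2)⁻¹) := by
  have hP : 0 < (x - s) ^ 2 + η ^ 2 := by positivity
  have hQ : 0 < (x - t) ^ 2 + η ^ 2 := by positivity
  have e : 1 / 2 * (((x - s) ^ 2 + η ^ 2)⁻¹ + ((x - t) ^ 2 + η ^ 2)⁻¹)
    = (1 / 2 * (((x - s) ^ 2 + η ^ 2) + ((x - t) ^ 2 + η ^ 2))) / (((x - s) ^ 2 + η ^ 2) * ((x - t) ^ 2 + η ^ 2)) := by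
    field_simp; ring
  rw [e, kr, abs_div, abs_of_pos (mul_pos hP hQ)]
  gcongr
  rw [abs_le]
  constructor <;> nlinarith [sq_nonneg ((x - s) - (x - t)), sq_nonneg ((x - s) + (x - t))]

lemma kr_intx {η : ℝ} (hη : 0 < η) (s t : ℝ) : Integrable (fun x => kr η x s t) := by
  refine Integrable.mono' (((lor_int hη).comp_sub_right s).add ((lor_int hη).comp_sub_right t) |>.const_mul (1 / 2)) ?_
    (Eventually.of_forall fun x => kr_le hη x s t)
  refine Measurable.aestronglyMeasurable ?_
  unfold kr; fun_prop

lemma arctan_lim_top (s : ℝ) {η : ℝ} (hη : 0 < η) :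
    Tendsto (fun x : ℝ => Real.arctan ((x - s) / η)) atTop (𝓝 (Real.pi / 2)) := by
  have h1 : Tendsto (fun x : ℝ => (x - s) / η) atTop atTop :=
    (tendsto_atTop_add_const_right _ (-s) tendsto_id).atTop_div_const hη
  exact (Real.tendsto_arctan_atTop.mono_right nhdsWithin_le_nhds).comp h1

lemma arctan_lim_bot (s : ℝ) {η : ℝ} (hη : 0 < η) :
    Tendsto (fun x : ℝ => Real.arctan ((x - s) / η)) atBot (𝓝 (-(Real.pi / 2))) := by
  have h1 : Tendsto (fun x : ℝ => (x - s) / η) atBot atBot :=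
    (tendsto_atBot_add_const_right _ (-s) tendsto_id).atBot_div_const hη
  exact (Real.tendsto_arctan_atBot.mono_right nhdsWithin_le_nhds).comp h1

lemma log_lim_top (s t η : ℝ) (hη : 0 < η) :
    Tendsto (fun x : ℝ => Real.log ((x - s) ^ 2 + η ^ 2) - Real.log ((x - t) ^ 2 + η ^ 2)) atTop (𝓝 0) := by
  have h1 : Tendsto (fun x : ℝ => x⁻¹) atTop (𝓝 0) := tendsto_inv_atTop_zero
  have h2 : Tendsto (fun x : ℝ => ((1 - s * x⁻¹) ^ 2 + (η * x⁻¹) ^ 2) / ((1 - t * x⁻¹) ^ 2 + (η * x⁻¹) ^ 2)) atTop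
      (𝓝 (((1 - s * 0) ^ 2 + (η * 0) ^ 2) / ((1 - t * 0) ^ 2 + (η * 0) ^ 2))) := by
    refine Tendsto.div ?_ ?_ (by simp) <;>
    exact (((h1.const_mul _).const_sub 1).pow 2).add ((h1.const_mul _).pow 2)
  have h3 := h2.log (by simp)
  simp only [mul_zero, sub_zero, one_pow, ne_eq, OfNat.ofNat_ne_zero, not_false_eq_true, zero_pow, add_zero, div_one, Real.log_one] at h3
  refine h3.congr' ?_
  filter_upwards [eventually_gt_atTop 0] with x hx
  rw [← Real.log_div (by positivity) (by positivity)]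
  congr 1
  field_simp

lemma log_lim_bot (s t η : ℝ) (hη : 0 < η) :
    Tendsto (fun x : ℝ => Real.log ((x - s) ^ 2 + η ^ 2) - Real.log ((x - t) ^ 2 + η ^ 2)) atBot (𝓝 0) := by
  have := (log_lim_top (-s) (-t) η hη).comp tendsto_neg_atBot_atTop
  refine this.congr fun x => ?_
  simp only [Function.comp]
  congr 3 <;> ring

lemma kr_val {η : ℝ} (hη : 0 < η) (s t : ℝ) :
    ∫ x, kr η x s t = 2 * Real.pi * ((2 * η) / ((t - s) ^ 2 + (2 * η) ^ 2)) := by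
  set D := (t - s) ^ 2 + (2 * η) ^ 2 with hD
  have hD0 : 0 < D := by positivity
  set f : ℝ → ℝ := fun x => ((s - t) / 2 * (Real.log ((x - s) ^ 2 + η ^ 2) - Real.log ((x - t) ^ 2 + η ^ 2))
    + 2 * η * (Real.arctan ((x - s) / η) + Real.arctan ((x - t) / η))) / D with hf
  have hder : ∀ x, HasDerivAt f (kr η x s t) x := by
    intro x
    have hl : ∀ a : ℝ, HasDerivAt (fun x : ℝ => Real.log ((x - a) ^ 2 + η ^ 2)) ((2 * (x - a)) / ((x - a) ^ 2 + η ^ 2)) x := by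
      intro a
      refine HasDerivAt.log ?_ (by positivity)
      have := (((hasDerivAt_id x).sub_const a).pow 2).add_const (η ^ 2)
      simpa using this
    have ha : ∀ a : ℝ, HasDerivAt (fun x : ℝ => Real.arctan ((x - a) / η)) (1 / (1 + ((x - a) / η) ^ 2) * (1 / η)) x := by
      intro a
      exact HasDerivAt.arctan (((hasDerivAt_id x).sub_const a).div_const η)
    have := ((((hl s).sub (hl t)).const_mul ((s - t) / 2)).add (((ha s).add (ha t)).const_mul (2 * η))).div_const D
    refine HasDerivAt.congr_deriv this ?_
    have hP : (x - s) ^ 2 + η ^ 2 ≠ 0 := by positivity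
    have hQ : (x - t) ^ 2 + η ^ 2 ≠ 0 := by positivity
    have e : ∀ a : ℝ, (x - a) ^ 2 + η ^ 2 ≠ 0 → 1 / (1 + ((x - a) / η) ^ 2) * (1 / η) = η / ((x - a) ^ 2 + η ^ 2) := by
      intro a ha
      have : 1 + ((x - a) / η) ^ 2 = ((x - a) ^ 2 + η ^ 2) / η ^ 2 := by field_simp; ring
      rw [this]; field_simp
    rw [e s hP, e t hQ, kr, div_eq_div_iff hD0.ne' (by positivity), hD]
    field_simp
    ring
  have h := integral_of_hasDerivAt_of_tendsto hder (kr_intx hη s t) (m := ((s - t) / 2 * 0 + 2 * η * (-(Real.pi / 2) + -(Real.pi / 2))) / D)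
    (n := ((s - t) / 2 * 0 + 2 * η * (Real.pi / 2 + Real.pi / 2)) / D) ?_ ?_
  · rw [h]; field_simp; ring
  · exact ((((log_lim_bot s t η hη).const_mul _).add (((arctan_lim_bot s hη).add (arctan_lim_bot t hη)).const_mul _)).div_const D)
  · exact ((((log_lim_top s t η hη).const_mul _).add (((arctan_lim_top s hη).add (arctan_lim_top t hη)).const_mul _)).div_const D)

lemma kr_intprod (α β : Measure ℝ) [IsProbabilityMeasure α] [IsProbabilityMeasure β] {η : ℝ} (hη : 0 < η) :
    Integrable (fun p : ℝ × (ℝ × ℝ) => kr η p.1 p.2.1 p.2.2) (volume.prod (α.prod β)) := by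
  have hl : ∀ u : ℝ × ℝ → ℝ, Measurable u →
      Integrable (fun p : ℝ × (ℝ × ℝ) => ((p.1 - u p.2) ^ 2 + η ^ 2)⁻¹) (volume.prod (α.prod β)) := by
    intro u hu
    rw [integrable_prod_iff' (Measurable.aestronglyMeasurable (by fun_prop))]
    refine ⟨Eventually.of_forall fun q => (lor_int hη).comp_sub_right (u q), ?_⟩
    refine (integrable_const (∫ x : ℝ, (x ^ 2 + η ^ 2)⁻¹)).congr (Eventually.of_forall fun q => ?_)
    simp only
    rw [← integral_sub_right_eq_self (fun x : ℝ => (x ^ 2 + η ^ 2)⁻¹) (u q)]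
    congr 1; ext x
    rw [Real.norm_eq_abs, abs_of_pos (by positivity)]
  refine Integrable.mono' (((hl Prod.fst measurable_fst).add (hl Prod.snd measurable_snd)).const_mul (1 / 2)) ?_
    (Eventually.of_forall fun p => kr_le hη _ _ _)
  refine Measurable.aestronglyMeasurable ?_
  unfold kr; fun_prop

lemma prod_kr (α β : Measure ℝ) [IsProbabilityMeasure α] [IsProbabilityMeasure β] {η : ℝ} (hη : 0 < η) (x : ℝ) :
    (cauchy α (x + η * I) * (starRingEnd ℂ) (cauchy β (x + η * I))).re
      = ∫ q : ℝ × ℝ, kr η x q.1 q.2 ∂(α.prod β) := by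
  set z : ℂ := x + η * I with hz
  have hzi : 0 < z.im := by simpa [hz] using hη
  have h1 := integrable_inv_sub α hzi
  have h2 : Integrable (fun u : ℝ => (starRingEnd ℂ) ((z - (u : ℂ))⁻¹)) β := by
    have := integrable_inv_sub β hzi
    exact (integrable_norm_iff (Measurable.aestronglyMeasurable (by fun_prop))).mp (by simp_rw [RCLike.norm_conj]; exact this.norm)
  unfold cauchy
  rw [← integral_conj, ← integral_prod_mul]
  have h3 := h1.mul_prod h2
  have h4 := integral_re (𝕜 := ℂ) h3
  simp only [RCLike.re_to_complex] at h4
  rw [← h4]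
  congr 1; ext q
  have e1 : ∀ u : ℝ, (z - (u : ℂ))⁻¹.re = (x - u) / ((x - u) ^ 2 + η ^ 2) := fun u => by
    rw [Complex.inv_re, Complex.normSq_eq_norm_sq, hz, norm_line]; simp
  have e2 : ∀ u : ℝ, (z - (u : ℂ))⁻¹.im = -η / ((x - u) ^ 2 + η ^ 2) := fun u => by
    rw [Complex.inv_im, Complex.normSq_eq_norm_sq, hz, norm_line]; simp
  rw [Complex.mul_re, Complex.conj_re, Complex.conj_im, e1, e1, e2, e2, kr]
  field_simp
  ring

lemma lev (α β : Measure ℝ) [IsProbabilityMeasure α] [IsProbabilityMeasure β] {η : ℝ} (hη : 0 < η) :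
    Integrable (fun x : ℝ => (cauchy α (x + η * I) * (starRingEnd ℂ) (cauchy β (x + η * I))).re) ∧
    ∫ x : ℝ, (cauchy α (x + η * I) * (starRingEnd ℂ) (cauchy β (x + η * I))).re
      = 2 * Real.pi * Qf α β (2 * η) := by
  have hi := kr_intprod α β hη
  simp_rw [prod_kr α β hη]
  refine ⟨hi.integral_prod_left, ?_⟩
  have hs := integral_integral_swap (f := fun x (q : ℝ × ℝ) => kr η x q.1 q.2) hi
  rw [hs]
  have hi2 := hi.integral_prod_right
  simp_rw [kr_val hη] at hi2 ⊢
  rw [integral_prod_symm _ hi2, Qf, ← integral_const_mul]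
  congr 1; ext t
  have := (pois_int α t (y := 2 * η) (by positivity)).2
  rw [this, ← integral_const_mul]

lemma lev_diff (α β : Measure ℝ) [IsProbabilityMeasure α] [IsProbabilityMeasure β] {η : ℝ} (hη : 0 < η) :
    ∫ x : ℝ, ‖cauchy α (x + η * I) - cauchy β (x + η * I)‖ ^ 2
      = 2 * Real.pi * (Qf α α (2 * η) - 2 * Qf β α (2 * η) + Qf β β (2 * η)) := by
  obtain ⟨a1, a2⟩ := lev α α hη
  obtain ⟨b1, b2⟩ := lev β α hη
  obtain ⟨c1, c2⟩ := lev β β hη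
  have e : ∀ u v : ℂ, ‖u - v‖ ^ 2 = ((u * (starRingEnd ℂ) u).re - 2 * (v * (starRingEnd ℂ) u).re)
      + (v * (starRingEnd ℂ) v).re := by
    intro u v
    rw [← Complex.normSq_eq_norm_sq, Complex.normSq_apply]
    simp; ring
  simp_rw [e]
  rw [integral_add (isub a1 (b1.const_mul 2)) c1, integral_sub a1 (b1.const_mul 2), integral_const_mul, a2, b2, c2]
  ring

lemma sc_ae2 : ∀ᵐ x ∂sc, |x| < 2 := by
  rw [sc, ae_map_iff (by fun_prop) (measurableSet_lt (by fun_prop) (by fun_prop)),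
    ae_withDensity_iff (by fun_prop)]
  refine Eventually.of_forall fun θ hθ => ?_
  have hs : Real.sin θ ≠ 0 := by
    intro h; apply hθ; simp [h]
  have h2 := Real.sin_sq_add_cos_sq θ
  have h3 : 0 < Real.sin θ ^ 2 := by positivity
  rw [abs_mul, abs_two]
  have h4 : |Real.cos θ| < 1 := by
    rw [abs_lt]; constructor <;> nlinarith
  linarith

lemma Vsc_sc : ∫ x, Vf sc x ∂sc = 1 / 4 := by
  have : ∫ x, Vf sc x ∂sc = ∫ x, (1 / 2 - x ^ 2 / 4) ∂sc := by
    refine integral_congr_ae ?_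
    filter_upwards [sc_ae2] with x hx using Vsc_in hx
  rw [this, integral_sub (integrable_const _) (sc_sq_integrable.div_const 4), integral_div (4:ℝ) (fun x : ℝ => x ^ 2), sc_sq]
  simp; norm_num

lemma energyD {α : Measure ℝ} (h : Nice α) (hm : ∫ x, x ^ 2 ∂α = 1) :
    Integrable Hf α ∧
    ∫ s, Vf α s ∂α = 1 / 4 + 2 * ∫ x, Hf x ∂α
      + (1 / Real.pi) * ∫ η in Ioi (0 : ℝ), ∫ x : ℝ, ‖cauchy α (x + η * I) - sg (x + η * I)‖ ^ 2 := by
  have := h.prob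
  obtain ⟨a1, a2, a3⟩ := Qf_eq h h
  obtain ⟨b1, b2, b3⟩ := Qf_eq nice_sc h
  obtain ⟨c1, c2, c3⟩ := Qf_eq nice_sc nice_sc
  have hq := h.sq
  have hH : Integrable Hf α := isub (iadd b1 (hq.div_const 4)) (integrable_const (1 / 2 : ℝ))
  refine ⟨hH, ?_⟩
  have hV : ∫ s, Vf sc s ∂α = ∫ x, Hf x ∂α + 1 / 4 := by
    have e : ∀ s, Vf sc s = Hf s - (s ^ 2 / 4 - 1 / 2) := fun s => by rw [Hf]; ring
    simp_rw [e]
    rw [integral_sub hH (isub (hq.div_const 4) (integrable_const _)),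
      integral_sub (hq.div_const 4) (integrable_const _), integral_div (4:ℝ) (fun x : ℝ => x ^ 2), hm]
    simp; ring
  have hD : ∫ η in Ioi (0 : ℝ), ∫ x : ℝ, ‖cauchy α (x + η * I) - sg (x + η * I)‖ ^ 2
      = ∫ η in Ioi (0 : ℝ), 2 * Real.pi * (Qf α α (2 * η) - 2 * Qf sc α (2 * η) + Qf sc sc (2 * η)) := by
    refine setIntegral_congr_fun measurableSet_Ioi fun η hη => ?_
    rw [← lev_diff α sc hη]
    congr 1; ext x
    rw [sc_cauchy (by simpa using hη)]
  have hD2 : ∫ y in Ioi (0 : ℝ), (Qf α α y - 2 * Qf sc α y + Qf sc sc y)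
      = ∫ s, Vf α s ∂α - 2 * ∫ s, Vf sc s ∂α + ∫ s, Vf sc s ∂sc := by
    rw [← a3, ← b3, ← c3, ← integral_const_mul, ← integral_sub a2 (b2.const_mul 2),
      ← integral_add (isub a2 (b2.const_mul 2)) c2]
    congr 1; ext y; ring
  have hD3 := integral_comp_mul_left_Ioi (fun y => Qf α α y - 2 * Qf sc α y + Qf sc sc y) (0:ℝ) (two_pos (α := ℝ))
  rw [hD, integral_const_mul, hD3, mul_zero, hD2, hV, Vsc_sc, smul_eq_mul]
  have := Real.pi_ne_zero
  field_simp
  ring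

lemma log_ker {d : ℝ} (hd : d ≠ 0) :
    IntegrableOn (fun y : ℝ => y / (d ^ 2 + y ^ 2) - y / (1 + y ^ 2)) (Ioi 0) ∧
    ∫ y in Ioi (0 : ℝ), (y / (d ^ 2 + y ^ 2) - y / (1 + y ^ 2)) = -Real.log |d| ∧
    ∫ y in Ioi (0 : ℝ), ‖y / (d ^ 2 + y ^ 2) - y / (1 + y ^ 2)‖ = |Real.log (|d|)| := by
  have hd2 : 0 < d ^ 2 := by positivity
  have e : ∀ y : ℝ, y / (d ^ 2 + y ^ 2) - y / (1 + y ^ 2)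
      = (1 - d ^ 2) * (y / ((d ^ 2 + y ^ 2) * (1 + y ^ 2))) := by
    intro y
    have : d ^ 2 + y ^ 2 ≠ 0 := by positivity
    field_simp; ring
  have hi : IntegrableOn (fun y : ℝ => y / (d ^ 2 + y ^ 2) - y / (1 + y ^ 2)) (Ioi 0) := by
    refine Integrable.mono' (g := fun y => |1 - d ^ 2| * (1 / d ^ 2 + 1) * (1 + y ^ 2)⁻¹)
      ((integrable_inv_one_add_sq.restrict).const_mul _) ?_ ?_
    · exact Measurable.aestronglyMeasurable (by fun_prop)
    · filter_upwards [ae_restrict_mem measurableSet_Ioi] with y hy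
      have hy' : (0 : ℝ) < y := hy
      rw [e, norm_mul, Real.norm_eq_abs, Real.norm_eq_abs, mul_assoc]
      gcongr
      rw [abs_of_pos (by positivity), div_le_iff₀ (by positivity)]
      have h1 : y ≤ (1 / d ^ 2 + 1) * (d ^ 2 + y ^ 2) := by
        have : (1 / d ^ 2 + 1) * (d ^ 2 + y ^ 2) = 1 + y ^ 2 / d ^ 2 + d ^ 2 + y ^ 2 := by field_simp; ring
        rw [this]
        have : 0 ≤ y ^ 2 / d ^ 2 := by positivity
        nlinarith [sq_nonneg (y - 1)]
      calc y ≤ _ := h1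
        _ = _ := by field_simp
  have hv : ∫ y in Ioi (0 : ℝ), (y / (d ^ 2 + y ^ 2) - y / (1 + y ^ 2)) = -Real.log |d| := by
    have h := integral_Ioi_of_hasDerivAt_of_tendsto' (f := fun y : ℝ => 1 / 2 * Real.log ((d ^ 2 + y ^ 2) / (1 + y ^ 2)))
      (f' := fun y : ℝ => y / (d ^ 2 + y ^ 2) - y / (1 + y ^ 2)) (a := 0) (m := 1 / 2 * Real.log 1) ?_ hi ?_
    · rw [h]; simp
    · intro y _
      have hl : ∀ c : ℝ, 0 < c → HasDerivAt (fun y : ℝ => Real.log (c + y ^ 2)) ((2 * y) / (c + y ^ 2)) y := by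
        intro c hc
        refine HasDerivAt.log ?_ (by positivity)
        simpa using (hasDerivAt_pow 2 y).const_add c
      have h1 := ((hl (d ^ 2) hd2).sub (hl 1 one_pos)).const_mul (1 / 2)
      have h2 : (fun y : ℝ => 1 / 2 * Real.log ((d ^ 2 + y ^ 2) / (1 + y ^ 2)))
          = fun y : ℝ => 1 / 2 * (Real.log (d ^ 2 + y ^ 2) - Real.log (1 + y ^ 2)) := by
        ext y; rw [Real.log_div (by positivity) (by positivity)]
      rw [h2]
      refine HasDerivAt.congr_deriv h1 ?_
      field_simp
    · exact ((ratio_lim (d ^ 2) 1).log (by norm_num)).const_mul _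
  refine ⟨hi, hv, ?_⟩
  rw [← abs_neg, ← hv]
  rcases le_total (d ^ 2) 1 with h1 | h1
  · have hn : ∀ y ∈ Ioi (0 : ℝ), 0 ≤ y / (d ^ 2 + y ^ 2) - y / (1 + y ^ 2) := by
      intro y hy
      have hy' : (0 : ℝ) < y := hy
      rw [e]; exact mul_nonneg (by linarith) (by positivity)
    rw [abs_of_nonneg (setIntegral_nonneg measurableSet_Ioi hn)]
    refine setIntegral_congr_fun measurableSet_Ioi fun y hy => ?_
    exact Real.norm_of_nonneg (hn y hy)
  · have hn : ∀ y ∈ Ioi (0 : ℝ), y / (d ^ 2 + y ^ 2) - y / (1 + y ^ 2) ≤ 0 := by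
      intro y hy
      have hy' : (0 : ℝ) < y := hy
      rw [e]; exact mul_nonpos_of_nonpos_of_nonneg (by linarith) (by positivity)
    rw [abs_of_nonpos (setIntegral_nonpos measurableSet_Ioi hn), ← integral_neg]
    refine setIntegral_congr_fun measurableSet_Ioi fun y hy => ?_
    exact Real.norm_of_nonpos (hn y hy)

lemma wd_int (p f : ℝ → ℝ) (hp : Continuous p) (hp0 : ∀ x, 0 ≤ p x) :
    ∫ x, f x ∂(volume.withDensity (fun x => ENNReal.ofReal (p x))) = ∫ x, p x * f x := by
  rw [integral_withDensity_eq_integral_toReal_smul (by fun_prop) (by simp)]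
  congr 1; ext x
  rw [ENNReal.toReal_ofReal (hp0 x), smul_eq_mul]

lemma wd_integrable (p f : ℝ → ℝ) (hp : Continuous p) (hp0 : ∀ x, 0 ≤ p x) :
    Integrable f (volume.withDensity (fun x => ENNReal.ofReal (p x))) ↔ Integrable (fun x => p x * f x) := by
  rw [integrable_withDensity_iff_integrable_smul' (by fun_prop) (by simp)]
  have : (fun x => (ENNReal.ofReal (p x)).toReal • f x) = fun x => p x * f x := by
    ext x; rw [ENNReal.toReal_ofReal (hp0 x), smul_eq_mul]
  rw [this]

lemma log_loc (s : ℝ) : Integrable (fun t : ℝ => (Icc (-1 : ℝ) 1).indicator (fun u => |Real.log (|u|)|) (s - t)) := by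
  have h1 : IntegrableOn (fun u : ℝ => |Real.log (|u|)|) (Icc (-1) 1) := by
    have : IntervalIntegrable Real.log volume (-1) 1 := intervalIntegral.intervalIntegrable_log'
    rw [intervalIntegrable_iff_integrableOn_Icc_of_le (by norm_num)] at this
    simp_rw [Real.log_abs]
    exact this.abs
  exact ((integrable_indicator_iff measurableSet_Icc).mpr h1).comp_sub_left s

lemma log_int {p : ℝ → ℝ} {M : ℝ} (hp : Continuous p) (hp0 : ∀ x, 0 ≤ p x) (hM : ∀ x, p x ≤ M)
    {α : Measure ℝ} (hα : α = volume.withDensity (fun x => ENNReal.ofReal (p x))) (h : Nice α) (s : ℝ) :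
    Integrable (fun t => Real.log |s - t|) α := by
  have := h.prob
  have h1 : Integrable (fun t : ℝ => (Icc (-1 : ℝ) 1).indicator (fun u => |Real.log (|u|)|) (s - t)) α := by
    rw [hα, wd_integrable p _ hp hp0]
    exact (log_loc s).bdd_mul (c := M) hp.aestronglyMeasurable
      (Eventually.of_forall fun x => by rw [Real.norm_of_nonneg (hp0 x)]; exact hM x)
  have h2 : Integrable (fun t : ℝ => 1 + 2 * s ^ 2 + 2 * t ^ 2) α :=
    iadd (integrable_const _) (h.sq.const_mul 2)
  refine Integrable.mono' (h1.add h2) (Measurable.aestronglyMeasurable (by fun_prop)) ?_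
  refine Eventually.of_forall fun t => ?_
  show ‖_‖ ≤ (Icc (-1 : ℝ) 1).indicator (fun u => |Real.log (|u|)|) (s - t) + (1 + 2 * s ^ 2 + 2 * t ^ 2)
  rw [Real.norm_eq_abs]
  by_cases hu : s - t ∈ Icc (-1 : ℝ) 1
  · rw [indicator_of_mem hu]; nlinarith [sq_nonneg s, sq_nonneg t]
  · rw [indicator_of_notMem hu]
    have h3 : 1 < |s - t| := by
      by_contra h4; push Not at h4; exact hu (abs_le.mp h4)
    rw [abs_of_pos (Real.log_pos h3)]
    have h4 := Real.log_le_sub_one_of_pos (x := |s - t|) (by linarith)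
    have h5 : |s - t| ^ 2 ≤ 2 * s ^ 2 + 2 * t ^ 2 := by rw [sq_abs]; nlinarith [sq_nonneg (s + t)]
    nlinarith

lemma V_log {p : ℝ → ℝ} {M : ℝ} (hp : Continuous p) (hp0 : ∀ x, 0 ≤ p x) (hM : ∀ x, p x ≤ M)
    {α : Measure ℝ} (hα : α = volume.withDensity (fun x => ENNReal.ofReal (p x))) (h : Nice α) (s : ℝ) :
    ∫ t, Real.log |s - t| ∂α = - Vf α s := by
  have := h.prob
  have hl := log_int hp hp0 hM hα h s
  have hne : ∀ᵐ t ∂α, s - t ≠ 0 := by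
    have : α ≪ volume := by rw [hα]; exact withDensity_absolutelyContinuous _ _
    refine this.ae_le ?_
    have h3 : ∀ᵐ t : ℝ, t ≠ s := by simp [ae_iff]
    filter_upwards [h3] with t ht hc
    exact ht (by linarith)
  have hi : Integrable (fun q : ℝ × ℝ => q.2 / ((s - q.1) ^ 2 + q.2 ^ 2) - q.2 / (1 + q.2 ^ 2))
      (α.prod (volume.restrict (Ioi 0))) := by
    rw [integrable_prod_iff (Measurable.aestronglyMeasurable (by fun_prop))]
    constructor
    · filter_upwards [hne] with t ht using (log_ker ht).1
    · refine hl.abs.congr ?_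
      filter_upwards [hne] with t ht using (log_ker ht).2.2.symm
  have hs := integral_integral_swap (f := fun t y : ℝ => y / ((s - t) ^ 2 + y ^ 2) - y / (1 + y ^ 2)) hi
  have e1 : ∫ t, (∫ y in Ioi (0 : ℝ), (y / ((s - t) ^ 2 + y ^ 2) - y / (1 + y ^ 2))) ∂α = ∫ t, -Real.log |s - t| ∂α := by
    refine integral_congr_ae ?_
    filter_upwards [hne] with t ht using (log_ker ht).2.1
  have e2 : Vf α s = ∫ y in Ioi (0 : ℝ), ∫ t, (y / ((s - t) ^ 2 + y ^ 2) - y / (1 + y ^ 2)) ∂α := by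
    rw [Vf]
    exact setIntegral_congr_fun measurableSet_Ioi fun y hy => Kf_eq α s hy
  rw [e2, ← hs, e1, integral_neg, neg_neg]

lemma energy_log {p : ℝ → ℝ} {M : ℝ} (hp : Continuous p) (hp0 : ∀ x, 0 ≤ p x) (hM : ∀ x, p x ≤ M)
    {α : Measure ℝ} (hα : α = volume.withDensity (fun x => ENNReal.ofReal (p x))) (h : Nice α) :
    (∫ x : ℝ, ∫ y : ℝ, Real.log |x - y| * p x * p y) = - ∫ s, Vf α s ∂α := by
  rw [← integral_neg]
  have e : ∀ x, ∫ y : ℝ, Real.log |x - y| * p x * p y = p x * (- Vf α x) := by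
    intro x
    rw [← V_log hp hp0 hM hα h x, hα, wd_int p _ hp hp0, ← integral_const_mul]
    congr 1; ext y; ring
  simp_rw [e]
  have h2 := wd_int p (fun x => - Vf α x) hp hp0
  rw [← hα] at h2
  exact h2.symm

structure Sub (a K N : ℝ) (z w F : ℂ) (S : ℝ) : Prop where
  wim : 0 < w.im
  S0 : 0 ≤ S
  Fim : F.im = w.im * (1 + S)
  c2 : ‖w * (w - F) - 1‖ ≤ K * √S
  c4 : 1 ≤ ‖w‖ → S ≤ 1 → S ≤ (1 + K / ‖w‖) / ‖w‖ ^ 2 + K / (‖w‖ ^ 6 * w.im ^ 2)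
  heq : (N : ℂ) * z = (N : ℂ) ^ 2 * w - ((N : ℂ) ^ 2 - 1) * F
  tim : ((N : ℂ) / w).im < 0
  tn : ‖(N : ℂ) / w‖ ≤ 1 + 6 * K / N
  r1 : ‖(N : ℂ) / w + w / N - z‖ ≤ 6 * K / N * ‖(N : ℂ) / w‖
  r2 : ‖(N : ℂ) / w + w / N - z + a / N * ((N : ℂ) / w) ^ 2‖ ≤ 6 * K / N ^ 2 * ‖(N : ℂ) / w‖
  r3 : ‖(N : ℂ) / F - (N : ℂ) / w‖ ≤ 6 * K / N ^ 2 * ‖(N : ℂ) / w‖ ^ 3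
  wN : N / 2 ≤ ‖w‖
  Fw : ‖w‖ / 2 ≤ ‖F‖
  SN : √S ≤ 2 / N
  wF : ‖w - F‖ ≤ 2 / ‖w‖
  zim : N * z.im = w.im * (1 - (N ^ 2 - 1) * S)

def Good (a K N : ℝ) (α : Measure ℝ) : Prop :=
  IsProbabilityMeasure α ∧ 1 ≤ K ∧ 8 * K ≤ N ∧
    ∀ z : ℂ, 0 < z.im → ∃ (w F : ℂ) (S : ℝ), Sub a K N z w F S ∧ cauchy α z = N / F

lemma cauchy_rescale (n : ℕ) (hn : 1 ≤ n) (ν : Measure ℝ) {z : ℂ} :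
    cauchy (rescale n ν) z = (√n : ℝ) * cauchy ν ((√n : ℝ) * z) := by
  have hN : 0 < √(n : ℝ) := Real.sqrt_pos.mpr (by exact_mod_cast hn)
  have hNc : ((√(n : ℝ) : ℝ) : ℂ) ≠ 0 := by exact_mod_cast hN.ne'
  unfold cauchy rescale
  rw [integral_map (by fun_prop) (meas_inv_sub z).aestronglyMeasurable, ← integral_const_mul]
  congr 1; ext u
  push_cast
  have : z - u / ((√(n : ℝ) : ℝ) : ℂ) = (((√(n : ℝ) : ℝ) : ℂ) * z - u) / ((√(n : ℝ) : ℝ) : ℂ) := by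
    field_simp
  rw [this, inv_div, div_eq_mul_inv]

lemma good_of (μ : Measure ℝ) [IsProbabilityMeasure μ]
    (h8 : Integrable (fun u : ℝ => u ^ 8) μ)
    (h1 : mom μ 1 = 0) (h2 : mom μ 2 = 1)
    (Z : ℕ → ℂ → ℂ) (ν : ℕ → Measure ℝ)
    (hbox : ∀ n : ℕ, 1 ≤ n → IsBoxPow μ n (Z n) (ν n)) :
    ∃ K : ℝ, 1 ≤ K ∧ ∀ n : ℕ, 1 ≤ n → 8 * K ≤ √n → Good (mom μ 3) K √n (rescale n (ν n)) := by
  obtain ⟨K, hK, hl⟩ := layer1 μ h8 h1 h2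
  refine ⟨K, hK, fun n hn hKn => ?_⟩
  obtain ⟨⟨⟨β, hβ, hZ⟩, hs⟩, hν, hr⟩ := hbox n hn
  have hN : 0 < √(n : ℝ) := Real.sqrt_pos.mpr (by exact_mod_cast hn)
  have hNc : ((√(n : ℝ) : ℝ) : ℂ) ≠ 0 := by exact_mod_cast hN.ne'
  have hpr : IsProbabilityMeasure (rescale n (ν n)) := Measure.isProbabilityMeasure_map (by fun_prop)
  refine ⟨hpr, hK, hKn, fun z hz => ?_⟩
  have hz' : 0 < (((√(n : ℝ) : ℝ) : ℂ) * z).im := by rw [Complex.im_ofReal_mul]; exact mul_pos hN hz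
  set w := Z n (((√(n : ℝ) : ℝ) : ℂ) * z) with hw
  have hwi : 0 < w.im := by rw [hw, hZ _ hz']; exact recip_im_pos β hz'
  obtain ⟨S, S0, d1, d2, d3, d4, d5⟩ := hl w hwi
  have hsq : ((√(n : ℝ) : ℝ) : ℂ) ^ 2 = n := by
    rw [← Complex.ofReal_pow, Real.sq_sqrt (by positivity)]; simp
  have heq : ((√(n : ℝ) : ℝ) : ℂ) * z = ((√(n : ℝ) : ℝ) : ℂ) ^ 2 * w - (((√(n : ℝ) : ℝ) : ℂ) ^ 2 - 1) * recip μ w := by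
    rw [hsq]; exact hs _ hz'
  obtain ⟨e1, e2, e3, e4, e5, e6, e7, e8, e9, e10⟩ := layer2 hK hKn hz hwi S0 d1 d2 d3 d4 heq
  refine ⟨w, recip μ w, S, ⟨hwi, S0, d1, d3, d5, heq, e1, e2, e3, e4, e5, e6, e7, e8, e9, e10⟩, ?_⟩
  rw [cauchy_rescale n hn, div_eq_mul_inv, ← hr _ hz', recip, inv_inv]

lemma good_bd {a K N : ℝ} {α : Measure ℝ} (h : Good a K N α) {z : ℂ} (hz : 0 < z.im) :
    ‖cauchy α z‖ ≤ 4 := by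
  obtain ⟨_, hK, hN, h⟩ := h
  obtain ⟨w, F, S, hs, he⟩ := h z hz
  have hN0 : 0 < N := by linarith
  have h1 := hs.wN
  have h2 := hs.Fw
  rw [he, norm_div, Complex.norm_real, Real.norm_of_nonneg hN0.le, div_le_iff₀ (by linarith)]
  linarith

lemma tend_one {f : ℕ → ℂ} {c : ℝ} (h : ∀ k : ℕ, ‖f k - 1‖ ≤ c * (1 / ((k : ℝ) + 1))) :
    Tendsto f atTop (𝓝 1) := by
  rw [tendsto_iff_norm_sub_tendsto_zero]
  refine squeeze_zero (fun _ => norm_nonneg _) h ?_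
  simpa using (tendsto_one_div_add_atTop_nhds_zero_nat (𝕜 := ℝ)).const_mul c

lemma good_lim {a K N : ℝ} {α : Measure ℝ} (h : Good a K N α) :
    Tendsto (fun k : ℕ => (((k + 1 : ℝ) : ℂ) * I) ^ 2 * ((((k + 1 : ℝ) : ℂ) * I) * cauchy α (((k + 1 : ℝ) : ℂ) * I) - 1))
      atTop (𝓝 1) := by
  obtain ⟨_, hK, hN, h⟩ := h
  have hN0 : 0 < N := by linarith
  have hz : ∀ k : ℕ, 0 < (((k + 1 : ℝ) : ℂ) * I).im := fun k => by
    simp; positivity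
  choose w F S hs he using fun k : ℕ => h _ (hz k)
  have hw : ∀ k : ℕ, (k : ℝ) + 1 ≤ ‖w k‖ ∧ (k : ℝ) + 1 ≤ (w k).im := fun k => by
    have h1 := (hs k).zim
    have h2 := (hs k).S0
    have h3 := (hs k).wim
    have h4 : (((k + 1 : ℝ) : ℂ) * I).im = k + 1 := by simp
    rw [h4] at h1
    have h5 : 0 ≤ (w k).im * ((N ^ 2 - 1) * S k) := by
      refine mul_nonneg h3.le (mul_nonneg (by nlinarith) h2)
    have h6 : (k : ℝ) + 1 ≤ (w k).im := by
      have : (0 : ℝ) ≤ k := by positivity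
      nlinarith
    exact ⟨h6.trans ((le_abs_self _).trans (Complex.abs_im_le_norm _)), h6⟩
  have hw1 : ∀ k : ℕ, 1 ≤ ‖w k‖ := fun k => by
    have : (0 : ℝ) ≤ k := by positivity
    linarith [(hw k).1]
  have hwc : ∀ k : ℕ, w k ≠ 0 := fun k => norm_pos_iff.mp (by linarith [hw1 k])
  have hFc : ∀ k : ℕ, F k ≠ 0 := fun k => norm_pos_iff.mp (by linarith [hw1 k, (hs k).Fw])
  have hinv : ∀ k : ℕ, 1 / ‖w k‖ ^ 2 ≤ 1 / ((k : ℝ) + 1) := fun k => by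
    refine one_div_le_one_div_of_le (by positivity) ?_
    nlinarith [(hw k).1, hw1 k]
  have A : Tendsto (fun k : ℕ => (N : ℂ) * (((k + 1 : ℝ) : ℂ) * I) / w k) atTop (𝓝 1) := by
    refine tend_one (c := (N ^ 2 - 1) * 2) fun k => ?_
    have e : (N : ℂ) * (((k + 1 : ℝ) : ℂ) * I) / w k - 1 = ((N ^ 2 - 1 : ℝ) : ℂ) * ((w k - F k) / w k) := by
      rw [(hs k).heq]
      have := hwc k
      push_cast
      field_simp; ring
    rw [e, norm_mul, Complex.norm_real, Real.norm_of_nonneg (by nlinarith), mul_assoc, norm_div]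
    refine mul_le_mul_of_nonneg_left ?_ (by nlinarith)
    calc ‖w k - F k‖ / ‖w k‖ ≤ (2 / ‖w k‖) / ‖w k‖ := by gcongr; exact (hs k).wF
      _ = 2 * (1 / ‖w k‖ ^ 2) := by ring
      _ ≤ _ := mul_le_mul_of_nonneg_left (hinv k) (by norm_num)
  have B : Tendsto (fun k => w k / F k) atTop (𝓝 1) := by
    refine tend_one (c := 4) fun k => ?_
    have hp := hw1 k
    have e : w k / F k - 1 = (w k - F k) / F k := by
      have := hFc k
      field_simp
    rw [e, norm_div]
    calc ‖w k - F k‖ / ‖F k‖ ≤ (2 / ‖w k‖) / (‖w k‖ / 2) := by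
          gcongr
          · exact (hs k).wF
          · exact (hs k).Fw
      _ = 4 * (1 / ‖w k‖ ^ 2) := by field_simp; ring
      _ ≤ _ := mul_le_mul_of_nonneg_left (hinv k) (by norm_num)
  have C : Tendsto (fun k => w k * (w k - F k)) atTop (𝓝 1) := by
    refine tend_one (c := K * √(1 + 2 * K)) fun k => ?_
    refine ((hs k).c2).trans ?_
    rw [mul_assoc]
    refine mul_le_mul_of_nonneg_left ?_ (by linarith)
    have hS1 : S k ≤ 1 := by
      have h1 := (hs k).SN
      have h2 : 2 / N ≤ 1 := by rw [div_le_one hN0]; linarith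
      have h3 := h1.trans h2
      rwa [Real.sqrt_le_one] at h3
    have h4 := (hs k).c4 (hw1 k) hS1
    set r : ℝ := (k : ℝ) + 1 with hr
    have hr1 : 1 ≤ r := by
      have : (0 : ℝ) ≤ k := by positivity
      linarith
    have hr0 : 0 < r := by linarith
    have h5 : S k ≤ (1 + 2 * K) * (1 / r) ^ 2 := by
      refine h4.trans ?_
      have b1 : (1 + K / ‖w k‖) / ‖w k‖ ^ 2 ≤ (1 + K / 1) / r ^ 2 := by
        have := hw1 k
        gcongr
        exact (hw k).1
      have b2 : K / (‖w k‖ ^ 6 * (w k).im ^ 2) ≤ K / (1 ^ 6 * r ^ 2) := by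
        have := (hw k).2
        gcongr
        exact hw1 k
      refine (add_le_add b1 b2).trans (le_of_eq ?_)
      field_simp; ring
    calc √(S k) ≤ √((1 + 2 * K) * (1 / r) ^ 2) := Real.sqrt_le_sqrt h5
      _ = _ := by rw [Real.sqrt_mul (by linarith), Real.sqrt_sq (by positivity)]
  have D := ((A.pow 2).mul C).mul B
  simp only [one_pow, one_mul] at D
  refine D.congr fun k => ?_
  rw [he k]
  have h1 := hwc k
  have h2 := hFc k
  have e : (((k + 1 : ℝ) : ℂ) * I) * (N / F k) - 1 = N ^ 2 * (w k - F k) / F k := by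
    have : (((k + 1 : ℝ) : ℂ) * I) * (N / F k) = (N * (((k + 1 : ℝ) : ℂ) * I)) / F k := by ring
    rw [this, (hs k).heq]
    field_simp; ring
  rw [e]
  field_simp

lemma cauchy_re2 (α : Measure ℝ) [IsProbabilityMeasure α] {y : ℝ} (hy : 0 < y) :
    Integrable (fun x : ℝ => y ^ 2 * x ^ 2 / (x ^ 2 + y ^ 2)) α ∧
    (((y : ℂ) * I) ^ 2 * (((y : ℂ) * I) * cauchy α ((y : ℂ) * I) - 1)).re
      = ∫ x, y ^ 2 * x ^ 2 / (x ^ 2 + y ^ 2) ∂α := by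
  have hz : 0 < ((y : ℂ) * I).im := by simpa using hy
  have hi := integrable_inv_sub α hz
  have e : ((y : ℂ) * I) ^ 2 * (((y : ℂ) * I) * cauchy α ((y : ℂ) * I) - 1)
      = ∫ x : ℝ, ((y : ℂ) * I) ^ 2 * (((y : ℂ) * I) * ((y : ℂ) * I - x)⁻¹ - 1) ∂α := by
    rw [integral_const_mul, integral_sub (hi.const_mul _) (integrable_const _), integral_const_mul, cauchy]
    simp
  have hi2 : Integrable (fun x : ℝ => ((y : ℂ) * I) ^ 2 * (((y : ℂ) * I) * ((y : ℂ) * I - x)⁻¹ - 1)) α :=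
    (isub (hi.const_mul _) (integrable_const _)).const_mul _
  have e2 : ∀ x : ℝ, (((y : ℂ) * I) ^ 2 * (((y : ℂ) * I) * ((y : ℂ) * I - x)⁻¹ - 1)).re
      = y ^ 2 * x ^ 2 / (x ^ 2 + y ^ 2) := by
    intro x
    have hne := sub_ne hz x
    have : ((y : ℂ) * I) ^ 2 * (((y : ℂ) * I) * ((y : ℂ) * I - x)⁻¹ - 1)
        = ((-(y ^ 2 * x) : ℝ) : ℂ) * ((y : ℂ) * I - x)⁻¹ := by
      rw [mul_pow, I_sq]; push_cast
      field_simp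
      ring
    rw [this, Complex.re_ofReal_mul, Complex.inv_re, Complex.normSq_apply]
    simp
    have h0 : x ^ 2 + y ^ 2 ≠ 0 := by positivity
    have h1 : x * x + y * y ≠ 0 := by nlinarith [sq_nonneg x, mul_pos hy hy]
    field_simp
  constructor
  · refine hi2.re.congr (Eventually.of_forall fun x => ?_)
    simpa using e2 x
  · rw [e]
    have := integral_re (𝕜 := ℂ) hi2
    simp only [RCLike.re_to_complex] at this
    rw [← this]
    exact integral_congr_ae (Eventually.of_forall e2)

lemma good_sq {a K N : ℝ} {α : Measure ℝ} (h : Good a K N α) :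
    Integrable (fun x : ℝ => x ^ 2) α ∧ ∫ x, x ^ 2 ∂α = 1 := by
  have hpr := h.1
  have hl : Tendsto (fun k : ℕ => ∫ x, (k + 1 : ℝ) ^ 2 * x ^ 2 / (x ^ 2 + (k + 1 : ℝ) ^ 2) ∂α) atTop (𝓝 1) := by
    have := (Complex.continuous_re.tendsto _).comp (good_lim h)
    simp only [Complex.one_re] at this
    refine this.congr fun k => ?_
    exact (cauchy_re2 α (by positivity)).2
  have hl2 : Tendsto (fun k : ℕ => ∫⁻ x, ENNReal.ofReal ((k + 1 : ℝ) ^ 2 * x ^ 2 / (x ^ 2 + (k + 1 : ℝ) ^ 2)) ∂α) atTop (𝓝 1) := by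
    have := ENNReal.tendsto_ofReal hl
    rw [ENNReal.ofReal_one] at this
    refine this.congr fun k => ?_
    exact ofReal_integral_eq_lintegral_ofReal (cauchy_re2 α (by positivity)).1 (Eventually.of_forall fun x => by positivity)
  have hm := lintegral_tendsto_of_tendsto_of_monotone (μ := α)
    (f := fun (k : ℕ) (x : ℝ) => ENNReal.ofReal ((k + 1 : ℝ) ^ 2 * x ^ 2 / (x ^ 2 + (k + 1 : ℝ) ^ 2)))
    (F := fun x => ENNReal.ofReal (x ^ 2)) (fun k => by fun_prop) ?_ ?_
  · have h1 := tendsto_nhds_unique hm hl2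
    have hI : Integrable (fun x : ℝ => x ^ 2) α := by
      refine ⟨by fun_prop, ?_⟩
      rw [hasFiniteIntegral_iff_ofReal (Eventually.of_forall fun x => by positivity), h1]
      simp
    refine ⟨hI, ?_⟩
    rw [integral_eq_lintegral_of_nonneg_ae (Eventually.of_forall fun x => by positivity) (by fun_prop), h1]
    simp
  · refine Eventually.of_forall fun x k l hkl => ?_
    have hkl' : (k : ℝ) ≤ l := by exact_mod_cast hkl
    have e : ∀ c : ℝ, 0 < c → c ^ 2 * x ^ 2 / (x ^ 2 + c ^ 2) = x ^ 2 - x ^ 4 / (x ^ 2 + c ^ 2) := by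
      intro c hc
      field_simp; ring
    refine ENNReal.ofReal_le_ofReal ?_
    rw [e _ (by positivity), e _ (by positivity)]
    gcongr
  · refine Eventually.of_forall fun x => ENNReal.tendsto_ofReal ?_
    have e : ∀ k : ℕ, x ^ 2 - x ^ 4 * (1 / (x ^ 2 + (k + 1 : ℝ) ^ 2)) = (k + 1 : ℝ) ^ 2 * x ^ 2 / (x ^ 2 + (k + 1 : ℝ) ^ 2) := by
      intro k
      field_simp; ring
    refine Tendsto.congr e ?_
    have : Tendsto (fun k : ℕ => 1 / (x ^ 2 + ((k : ℝ) + 1) ^ 2)) atTop (𝓝 0) := by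
      refine squeeze_zero (fun k => by positivity) (fun k => ?_) (tendsto_one_div_add_atTop_nhds_zero_nat (𝕜 := ℝ))
      refine one_div_le_one_div_of_le (by positivity) ?_
      have : (0 : ℝ) ≤ k := by positivity
      nlinarith [sq_nonneg x]
    simpa using (this.const_mul (x ^ 4)).const_sub (x ^ 2)

lemma good_nice {a K N : ℝ} {α : Measure ℝ} (h : Good a K N α) : Nice α :=
  ⟨h.1, (good_sq h).1, 4, fun _ hz => good_bd h hz⟩

def Dm : Set ℂ := {g | g.im < 0 ∧ ‖g‖ < 1}

def Up : Set ℂ := {z | 0 < z.im}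

lemma Dm_meas : MeasurableSet Dm :=
  (measurableSet_lt Complex.measurable_im measurable_const).inter (measurableSet_lt measurable_norm measurable_const)

lemma Up_meas : MeasurableSet Up := measurableSet_lt measurable_const Complex.measurable_im

lemma Dm_ne {g : ℂ} (hg : g ∈ Dm) : g ≠ 0 := by
  rintro rfl; have := hg.1; simp at this

lemma J_image : (fun g : ℂ => g + g⁻¹) '' Dm = Up := by
  ext z
  constructor
  · rintro ⟨g, hg, rfl⟩
    exact (sg_J hg.1 hg.2).1
  · intro hz
    exact ⟨sg z, ⟨sg_im hz, sg_norm hz⟩, sg_add z⟩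

lemma J_injOn : InjOn (fun g : ℂ => g + g⁻¹) Dm := fun _ hg _ ht h =>
  J_inj hg.2 ht.2 (Dm_ne hg) (Dm_ne ht) h

lemma det_smul1 (c : ℂ) : (c • (1 : ℂ →L[ℝ] ℂ)).det = ‖c‖ ^ 2 := by
  have e : ((c • (1 : ℂ →L[ℝ] ℂ) : ℂ →L[ℝ] ℂ) : ℂ →ₗ[ℝ] ℂ) = LinearMap.mulLeft ℝ c := by
    ext x <;> simp
  rw [ContinuousLinearMap.det, e, ← Complex.normSq_eq_norm_sq, ← Algebra.norm_complex_apply, Algebra.norm_apply]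
  rfl

lemma J_deriv {g : ℂ} (hg : g ∈ Dm) :
    HasFDerivWithinAt (fun g : ℂ => g + g⁻¹) ((1 - (g ^ 2)⁻¹) • (1 : ℂ →L[ℝ] ℂ)) Dm g := by
  refine (HasDerivAt.complexToReal_fderiv ?_).hasFDerivWithinAt
  have := (hasDerivAt_id g).add (hasDerivAt_inv (Dm_ne hg))
  exact this.congr_deriv (by ring)

lemma one_sub_sq_ne {g : ℂ} (hg : g ∈ Dm) : 0 < ‖1 - g ^ 2‖ := by
  have h1 : ‖g ^ 2‖ < 1 := by
    rw [norm_pow]; have := hg.2; nlinarith [norm_nonneg g]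
  have h2 := norm_sub_norm_le (1 : ℂ) (g ^ 2)
  rw [norm_one] at h2
  linarith

lemma jac {g : ℂ} (hg : g ∈ Dm) :
    |((1 - (g ^ 2)⁻¹) • (1 : ℂ →L[ℝ] ℂ)).det| = ‖1 - g ^ 2‖ ^ 2 / ‖g‖ ^ 4 := by
  have h0 := Dm_ne hg
  rw [det_smul1, abs_of_nonneg (by positivity)]
  have : 1 - (g ^ 2)⁻¹ = -((1 - g ^ 2) / g ^ 2) := by field_simp; ring
  rw [this, norm_neg, norm_div, norm_pow, div_pow]
  ring

lemma cov_int (f h : ℂ → ℝ) (hfh : ∀ g ∈ Dm, ‖1 - g ^ 2‖ ^ 2 / ‖g‖ ^ 4 * f g = h g) :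
    (IntegrableOn (fun z => f (sg z)) Up ↔ IntegrableOn h Dm) ∧
    ∫ z in Up, f (sg z) = ∫ g in Dm, h g := by
  have e : ∀ g ∈ Dm, |((1 - (g ^ 2)⁻¹) • (1 : ℂ →L[ℝ] ℂ)).det| • f (sg (g + g⁻¹)) = h g := by
    intro g hg
    rw [jac hg, (sg_J hg.1 hg.2).2, smul_eq_mul, hfh g hg]
  constructor
  · rw [← J_image, integrableOn_image_iff_integrableOn_abs_det_fderiv_smul volume Dm_meas (fun g hg => J_deriv hg) J_injOn]
    exact integrableOn_congr_fun e Dm_meas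
  · rw [← J_image, integral_image_eq_integral_abs_det_fderiv_smul volume Dm_meas (fun g hg => J_deriv hg) J_injOn]
    exact setIntegral_congr_fun Dm_meas e

lemma Dm_four : ∫ g in Dm, ‖g‖ ^ 4 = Real.pi / 6 := by
  rw [← integral_indicator Dm_meas, ← Complex.integral_comp_polarCoord_symm]
  have e : ∀ p ∈ polarCoord.target, p.1 • Dm.indicator (fun g : ℂ => ‖g‖ ^ 4) (Complex.polarCoord.symm p)
      = (Ioo (0 : ℝ) 1 ×ˢ Ioo (-Real.pi) 0).indicator (fun p : ℝ × ℝ => p.1 ^ 5 * 1) p := by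
    rintro ⟨r, θ⟩ hp
    simp only [polarCoord_target, mem_prod, mem_Ioi, mem_Ioo] at hp
    obtain ⟨hr, h1, h2⟩ := hp
    have hn : ‖Complex.polarCoord.symm (r, θ)‖ = r := by
      rw [Complex.norm_polarCoord_symm, abs_of_pos hr]
    have him : (Complex.polarCoord.symm (r, θ)).im = r * Real.sin θ := by
      rw [Complex.polarCoord_symm_apply, Complex.im_ofReal_mul]; simp [← Complex.ofReal_sin, ← Complex.ofReal_cos]
    by_cases hm : (r, θ) ∈ (Ioo (0 : ℝ) 1 ×ˢ Ioo (-Real.pi) 0)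
    · have hm' := hm
      simp only [mem_prod, mem_Ioo] at hm'
      rw [indicator_of_mem hm, indicator_of_mem, hn]
      · simp; ring
      · refine ⟨?_, by rw [hn]; exact hm'.1.2⟩
        rw [him]
        exact mul_neg_of_pos_of_neg hr (Real.sin_neg_of_neg_of_neg_pi_lt hm'.2.2 hm'.2.1)
    · rw [indicator_of_notMem hm, indicator_of_notMem, smul_zero]
      rintro ⟨h3, h4⟩
      rw [him] at h3
      rw [hn] at h4
      refine hm ⟨⟨hr, h4⟩, h1, ?_⟩
      by_contra h5
      push Not at h5
      have := Real.sin_nonneg_of_nonneg_of_le_pi h5 h2.le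
      nlinarith
  rw [setIntegral_congr_fun polarCoord.open_target.measurableSet e,
    setIntegral_indicator (measurableSet_Ioo.prod measurableSet_Ioo)]
  have hs : polarCoord.target ∩ Ioo (0 : ℝ) 1 ×ˢ Ioo (-Real.pi) 0 = Ioo (0 : ℝ) 1 ×ˢ Ioo (-Real.pi) 0 := by
    apply inter_eq_right.mpr
    rintro ⟨r, θ⟩ ⟨⟨h1, h2⟩, h3, h4⟩
    rw [polarCoord_target]
    have := Real.pi_pos
    exact ⟨h1, h3, lt_trans h4 this⟩
  rw [hs, Measure.volume_eq_prod, setIntegral_prod_mul (fun r : ℝ => r ^ 5) (fun _ => (1 : ℝ)),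
    ← integral_Ioc_eq_integral_Ioo, ← intervalIntegral.integral_of_le zero_le_one]
  simp [Real.pi_pos.le]
  ring

lemma pow_ball_int : IntegrableOn (fun x : ℂ => ‖x‖ ^ (-(8 / 5) : ℝ)) (Metric.ball 0 2) := by
  rw [← integrable_indicator_iff Metric.isOpen_ball.measurableSet]
  have e : (Metric.ball (0 : ℂ) 2).indicator (fun x : ℂ => ‖x‖ ^ (-(8 / 5) : ℝ))
      = fun x : ℂ => (Iio (2 : ℝ)).indicator (fun r => r ^ (-(8 / 5) : ℝ)) ‖x‖ := by
    ext x
    by_cases h : ‖x‖ < 2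
    · rw [indicator_of_mem (by simpa using h), indicator_of_mem (by simpa using h)]
    · rw [indicator_of_notMem (by simpa using h), indicator_of_notMem (by simpa using h)]
  rw [e, integrable_fun_norm_addHaar]
  have h1 : IntegrableOn (fun y : ℝ => y ^ (-(3 / 5) : ℝ)) (Ioo 0 2) :=
    (intervalIntegral.integrableOn_Ioo_rpow_iff two_pos).mpr (by norm_num)
  have h2 : IntegrableOn ((Iio (2 : ℝ)).indicator (fun y : ℝ => y ^ (-(3 / 5) : ℝ))) (Ioi 0) := by
    rw [integrableOn_indicator_iff measurableSet_Iio, inter_comm]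
    exact h1
  refine h2.congr_fun (fun y hy => ?_) measurableSet_Ioi
  have hy' : (0 : ℝ) < y := hy
  by_cases h : y < 2
  · simp only [Complex.finrank_real_complex]
    rw [indicator_of_mem (by simpa using h), indicator_of_mem (by simpa using h), smul_eq_mul]
    norm_num
    rw [← Real.rpow_one_add' hy'.le (by norm_num)]
    norm_num
  · simp only [Complex.finrank_real_complex]
    rw [indicator_of_notMem (by simpa using h), indicator_of_notMem (by simpa using h), smul_zero]

lemma Dm_rho : IntegrableOn (fun g : ℂ => ‖1 - g ^ 2‖ ^ (-(8 / 5) : ℝ)) Dm := by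
  have h1 : IntegrableOn (fun g : ℂ => ‖1 - g‖ ^ (-(8 / 5) : ℝ)) (Metric.ball 1 2) := by
    have h := pow_ball_int
    rw [← integrable_indicator_iff Metric.isOpen_ball.measurableSet] at h ⊢
    refine (h.comp_sub_left 1).congr (Eventually.of_forall fun g => ?_)
    simp [indicator, dist_eq_norm, norm_sub_rev]
  have h2 : IntegrableOn (fun g : ℂ => ‖1 + g‖ ^ (-(8 / 5) : ℝ)) (Metric.ball (-1) 2) := by
    have h := pow_ball_int
    rw [← integrable_indicator_iff Metric.isOpen_ball.measurableSet] at h ⊢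
    refine (h.comp_add_left 1).congr (Eventually.of_forall fun g => ?_)
    simp [indicator, dist_eq_norm, add_comm]
  have s1 : Dm ⊆ Metric.ball 1 2 := fun g hg => by
    rw [mem_ball_iff_norm]
    have := norm_sub_le g 1
    rw [norm_one] at this; linarith [hg.2]
  have s2 : Dm ⊆ Metric.ball (-1) 2 := fun g hg => by
    rw [mem_ball_iff_norm]
    have := norm_sub_le g (-1)
    rw [norm_neg, norm_one] at this; linarith [hg.2]
  refine Integrable.mono' (iadd (h1.mono_set s1) (h2.mono_set s2)) (Measurable.aestronglyMeasurable (by fun_prop)) ?_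
  filter_upwards [ae_restrict_mem Dm_meas] with g hg
  rw [Real.norm_of_nonneg (by positivity)]
  have e : ‖1 - g ^ 2‖ = ‖1 - g‖ * ‖1 + g‖ := by rw [← norm_mul]; congr 1; ring
  have hp := one_sub_sq_ne hg
  have q1 : 0 < ‖1 - g‖ := by
    by_contra h; have : ‖1 - g‖ = 0 := le_antisymm (not_lt.mp h) (norm_nonneg _)
    rw [e, this] at hp; simp at hp
  have q2 : 0 < ‖1 + g‖ := by
    by_contra h; have : ‖1 + g‖ = 0 := le_antisymm (not_lt.mp h) (norm_nonneg _)
    rw [e, this] at hp; simp at hp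
  rcases le_total 0 g.re with h | h
  · have h3 : 1 ≤ ‖1 + g‖ := by
      have := Complex.re_le_norm (1 + g)
      simp at this; linarith
    have : ‖1 - g ^ 2‖ ^ (-(8 / 5) : ℝ) ≤ ‖1 - g‖ ^ (-(8 / 5) : ℝ) :=
      Real.rpow_le_rpow_of_nonpos q1 (by rw [e]; nlinarith) (by norm_num)
    have h4 : 0 ≤ ‖1 + g‖ ^ (-(8 / 5) : ℝ) := by positivity
    linarith
  · have h3 : 1 ≤ ‖1 - g‖ := by
      have := Complex.re_le_norm (1 - g)
      simp at this; linarith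
    have : ‖1 - g ^ 2‖ ^ (-(8 / 5) : ℝ) ≤ ‖1 + g‖ ^ (-(8 / 5) : ℝ) :=
      Real.rpow_le_rpow_of_nonpos q2 (by rw [e]; nlinarith) (by norm_num)
    have h4 : 0 ≤ ‖1 - g‖ ^ (-(8 / 5) : ℝ) := by positivity
    linarith

lemma Up_phi : IntegrableOn (fun z => ‖sg z ^ 4 / (1 - sg z ^ 2)‖ ^ 2) Up ∧
    ∫ z in Up, ‖sg z ^ 4 / (1 - sg z ^ 2)‖ ^ 2 = Real.pi / 6 := by
  have h := cov_int (fun g => ‖g ^ 4 / (1 - g ^ 2)‖ ^ 2) (fun g => ‖g‖ ^ 4) (fun g hg => by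
    have h0 := norm_pos_iff.mpr (Dm_ne hg)
    have h1 := one_sub_sq_ne hg
    rw [norm_div, norm_pow]
    field_simp)
  refine ⟨h.1.mpr ?_, by rw [h.2, Dm_four]⟩
  by_contra hn
  have h3 := Dm_four
  rw [integral_undef hn] at h3
  linarith [Real.pi_pos]

lemma Up_err : IntegrableOn (fun z => ‖sg z‖ ^ 4 * ‖1 - sg z ^ 2‖ ^ (-(18 / 5) : ℝ)) Up := by
  have h := cov_int (fun g => ‖g‖ ^ 4 * ‖1 - g ^ 2‖ ^ (-(18 / 5) : ℝ)) (fun g => ‖1 - g ^ 2‖ ^ (-(8 / 5) : ℝ)) (fun g hg => by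
    have h0 := norm_pos_iff.mpr (Dm_ne hg)
    have h1 := one_sub_sq_ne hg
    have e : ‖1 - g ^ 2‖ ^ (-(8 / 5) : ℝ) = ‖1 - g ^ 2‖ ^ 2 * ‖1 - g ^ 2‖ ^ (-(18 / 5) : ℝ) := by
      rw [← Real.rpow_natCast, ← Real.rpow_add h1]; norm_num
    rw [e]
    field_simp)
  exact h.1.mpr Dm_rho

lemma Up_fubini {f : ℂ → ℝ} (hf : IntegrableOn f Up) :
    ∫ η in Ioi (0 : ℝ), ∫ x : ℝ, f (x + η * I) = ∫ z in Up, f z := by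
  have hmp := Complex.volume_preserving_equiv_real_prod.symm
  have hp : Complex.measurableEquivRealProd.symm ⁻¹' Up = univ ×ˢ Ioi (0 : ℝ) := by
    ext ⟨x, y⟩; simp [Up]
  have e := hmp.setIntegral_preimage_emb (MeasurableEquiv.measurableEmbedding _) f Up
  have hi := (hmp.integrableOn_comp_preimage (MeasurableEquiv.measurableEmbedding _) (f := f) (s := Up)).mpr hf
  rw [← e]
  rw [hp] at hi ⊢
  rw [Measure.volume_eq_prod, IntegrableOn, ← Measure.prod_restrict] at hi
  rw [Measure.volume_eq_prod, ← Measure.prod_restrict, integral_prod_symm (fun q => f (Complex.measurableEquivRealProd.symm q)) hi, Measure.restrict_univ]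
  refine setIntegral_congr_fun measurableSet_Ioi fun η _ => ?_
  congr 1; ext x
  rw [Complex.measurableEquivRealProd_symm_apply, Complex.mk_eq_add_mul_I]

lemma good_pt {a K N C : ℝ} {α : Measure ℝ} (h : Good a K N α) (hC1 : 6 * K ≤ C) (hC2 : |a| ≤ C)
    (hCN : 256 * C ^ 2 ≤ N) {z : ℂ} (hz : 0 < z.im) :
    ‖cauchy α z - sg z - a * ((1 / N : ℝ) : ℂ) * (sg z ^ 4 / (1 - sg z ^ 2))‖ ≤
      1006000 * C ^ 2 * (1 / N) ^ (7 / 5 : ℝ) * (‖sg z‖ ^ 2 * ‖1 - sg z ^ 2‖ ^ (-(9 / 5) : ℝ)) := by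
  obtain ⟨_, hK, hN, h⟩ := h
  obtain ⟨w, F, S, hs, he⟩ := h z hz
  have hN0 : 0 < N := by linarith
  have hinv : ((N : ℂ) / w)⁻¹ = w / N := inv_div _ _
  rw [he]
  have hd : 6 * K / N ≤ C * (1 / N) := by rw [mul_one_div]; gcongr
  have hd2 : 6 * K / N ^ 2 ≤ C * (1 / N) ^ 2 := by rw [one_div, inv_pow, ← div_eq_mul_inv]; gcongr
  refine stabE (t := N / w) (sg_im hz) (sg_norm hz) (sg_add z) hs.tim (by linarith) (by positivity) ?_ hC2 ?_ ?_ ?_ ?_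
  · rw [mul_one_div, div_le_one hN0]; exact hCN
  · linarith [hs.tn]
  · rw [hinv]; exact hs.r1.trans (by gcongr)
  · rw [hinv]
    have := hs.r2
    have e : (a : ℂ) * ((1 / N : ℝ) : ℂ) = a / N := by push_cast; ring
    rw [e]
    exact this.trans (by gcongr)
  · exact hs.r3.trans (by gcongr)

lemma sq_diff {x p : ℂ} {r e : ℝ} (h : ‖x - p‖ ≤ r) (hr : r ^ 2 + 2 * r * ‖p‖ ≤ e) :
    |‖x‖ ^ 2 - ‖p‖ ^ 2| ≤ e := by
  have h1 := norm_sub_norm_le x p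
  have h2 := norm_sub_norm_le p x
  rw [norm_sub_rev] at h2
  have := norm_nonneg x
  have := norm_nonneg p
  have := norm_nonneg (x - p)
  rw [abs_le]; constructor <;> nlinarith

lemma rho_le {z : ℂ} (hz : 0 < z.im) : 0 < ‖1 - sg z ^ 2‖ ∧ ‖1 - sg z ^ 2‖ ≤ 2 := by
  refine ⟨one_sub_sq_ne ⟨sg_im hz, sg_norm hz⟩, ?_⟩
  have h1 := norm_sub_le (1 : ℂ) (sg z ^ 2)
  rw [norm_pow, norm_one] at h1
  have := sg_norm hz
  nlinarith [norm_nonneg (sg z)]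

lemma good_pt2 {a K N C : ℝ} {α : Measure ℝ} (h : Good a K N α) (hC1 : 6 * K ≤ C) (hC2 : |a| ≤ C)
    (hCN : 256 * C ^ 2 ≤ N) {z : ℂ} (hz : 0 < z.im) :
    |‖cauchy α z - sg z‖ ^ 2 - a ^ 2 * (1 / N) ^ 2 * ‖sg z ^ 4 / (1 - sg z ^ 2)‖ ^ 2| ≤
      ((1006000 * C ^ 2) ^ 2 + 4 * C * (1006000 * C ^ 2)) * (1 / N) ^ (12 / 5 : ℝ) *
        (‖sg z‖ ^ 4 * ‖1 - sg z ^ 2‖ ^ (-(18 / 5) : ℝ)) := by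
  have hp := good_pt h hC1 hC2 hCN hz
  have hN0 : 0 < N := by linarith [h.2.1, h.2.2.1]
  have hN1 : 1 ≤ N := by linarith [h.2.1, h.2.2.1]
  have hC0 : 0 ≤ C := by linarith [h.2.1]
  obtain ⟨ρ0, ρ2⟩ := rho_le hz
  have e : a ^ 2 * (1 / N) ^ 2 * ‖sg z ^ 4 / (1 - sg z ^ 2)‖ ^ 2 = ‖(a : ℂ) * ((1 / N : ℝ) : ℂ) * (sg z ^ 4 / (1 - sg z ^ 2))‖ ^ 2 := by
    rw [norm_mul, norm_mul, Complex.norm_real, Complex.norm_real, mul_pow, mul_pow, Real.norm_eq_abs, Real.norm_eq_abs, sq_abs, sq_abs]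
  rw [e]
  refine sq_diff hp ?_
  rw [norm_mul, norm_mul, Complex.norm_real, Complex.norm_real, Real.norm_eq_abs, Real.norm_of_nonneg (by positivity), norm_div, norm_pow]
  have hg1 := (sg_norm hz).le
  have hg0 := norm_nonneg (sg z)
  generalize ‖sg z‖ = γ at *
  generalize ‖1 - sg z ^ 2‖ = ρ at *
  set L := 1006000 * C ^ 2 with hL
  have hL0 : 0 ≤ L := by positivity
  set ε := 1 / N with hε
  have hε0 : 0 < ε := by positivity
  have hε1 : ε ≤ 1 := by rw [hε, div_le_one hN0]; exact hN1
  have a1 : (ε ^ (7 / 5 : ℝ)) ^ 2 ≤ ε ^ (12 / 5 : ℝ) := by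
    rw [← Real.rpow_natCast, ← Real.rpow_mul hε0.le]
    exact Real.rpow_le_rpow_of_exponent_ge hε0 hε1 (by norm_num)
  have a2 : ε ^ (7 / 5 : ℝ) * ε = ε ^ (12 / 5 : ℝ) := by
    rw [← Real.rpow_add_one hε0.ne']; norm_num
  have a3 : (ρ ^ (-(9 / 5) : ℝ)) ^ 2 = ρ ^ (-(18 / 5) : ℝ) := by
    rw [← Real.rpow_natCast, ← Real.rpow_mul ρ0.le]; norm_num
  have a4 : ρ ^ (-(9 / 5) : ℝ) / ρ ≤ 2 * ρ ^ (-(18 / 5) : ℝ) := by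
    have b1 : ρ ^ (-(9 / 5) : ℝ) / ρ = ρ ^ (4 / 5 : ℝ) * ρ ^ (-(18 / 5) : ℝ) := by
      rw [← Real.rpow_sub_one ρ0.ne', ← Real.rpow_add ρ0]; norm_num
    rw [b1]
    gcongr
    calc ρ ^ (4 / 5 : ℝ) ≤ 2 ^ (4 / 5 : ℝ) := by gcongr
      _ ≤ 2 ^ (1 : ℝ) := Real.rpow_le_rpow_of_exponent_le (by norm_num) (by norm_num)
      _ = 2 := by norm_num
  have t1 : (L * ε ^ (7 / 5 : ℝ) * (γ ^ 2 * ρ ^ (-(9 / 5) : ℝ))) ^ 2 ≤ L ^ 2 * ε ^ (12 / 5 : ℝ) * (γ ^ 4 * ρ ^ (-(18 / 5) : ℝ)) := by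
    calc _ = L ^ 2 * (ε ^ (7 / 5 : ℝ)) ^ 2 * (γ ^ 4 * (ρ ^ (-(9 / 5) : ℝ)) ^ 2) := by ring
      _ ≤ _ := by rw [a3]; gcongr
  have t2 : 2 * (L * ε ^ (7 / 5 : ℝ) * (γ ^ 2 * ρ ^ (-(9 / 5) : ℝ))) * (|a| * ε * (γ ^ 4 / ρ))
      ≤ 4 * C * L * ε ^ (12 / 5 : ℝ) * (γ ^ 4 * ρ ^ (-(18 / 5) : ℝ)) := by
    calc _ = 2 * L * |a| * (ε ^ (7 / 5 : ℝ) * ε) * (γ ^ 2 * γ ^ 4) * (ρ ^ (-(9 / 5) : ℝ) / ρ) := by ring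
      _ ≤ 2 * L * C * (ε ^ (7 / 5 : ℝ) * ε) * (1 * γ ^ 4) * (2 * ρ ^ (-(18 / 5) : ℝ)) := by
        gcongr
        nlinarith
      _ = _ := by rw [a2]; ring
  calc _ ≤ L ^ 2 * ε ^ (12 / 5 : ℝ) * (γ ^ 4 * ρ ^ (-(18 / 5) : ℝ)) + 4 * C * L * ε ^ (12 / 5 : ℝ) * (γ ^ 4 * ρ ^ (-(18 / 5) : ℝ)) := add_le_add t1 t2
    _ = _ := by ring

lemma D_est (a K C : ℝ) (hC1 : 6 * K ≤ C) (hC2 : |a| ≤ C) : ∃ c : ℝ, 0 ≤ c ∧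
    ∀ (N : ℝ) (α : Measure ℝ), Good a K N α → 256 * C ^ 2 ≤ N →
      |(1 / Real.pi) * (∫ η in Ioi (0 : ℝ), ∫ x : ℝ, ‖cauchy α (x + η * I) - sg (x + η * I)‖ ^ 2)
        - a ^ 2 / (6 * N ^ 2)| ≤ c * (1 / N) ^ (12 / 5 : ℝ) := by
  set L := (1006000 * C ^ 2) ^ 2 + 4 * |C| * (1006000 * C ^ 2) with hL
  have hL0 : 0 ≤ L := by positivity
  set I0 := ∫ z in Up, (‖sg z‖ ^ 4 * ‖1 - sg z ^ 2‖ ^ (-(18 / 5) : ℝ)) with hI0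
  have hI : 0 ≤ I0 := setIntegral_nonneg Up_meas fun z _ => by positivity
  refine ⟨L * I0 / Real.pi, by positivity, fun N α h hCN => ?_⟩
  have hC0 : 0 ≤ C := by linarith [h.2.1]
  have hpr := h.1
  obtain ⟨p1, p2⟩ := Up_phi
  have p3 := Up_err
  have hm : AEStronglyMeasurable (fun z => ‖cauchy α z - sg z‖ ^ 2) (volume.restrict Up) := by
    have := cauchy_meas α
    have := sg_meas
    exact Measurable.aestronglyMeasurable (by fun_prop)
  have hb : ∀ z ∈ Up, |‖cauchy α z - sg z‖ ^ 2 - a ^ 2 * (1 / N) ^ 2 * ‖sg z ^ 4 / (1 - sg z ^ 2)‖ ^ 2| ≤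
      L * (1 / N) ^ (12 / 5 : ℝ) * (‖sg z‖ ^ 4 * ‖1 - sg z ^ 2‖ ^ (-(18 / 5) : ℝ)) := by
    intro z hz
    have := good_pt2 h hC1 hC2 hCN hz
    rwa [hL, abs_of_nonneg hC0]
  have i1 : IntegrableOn (fun z => a ^ 2 * (1 / N) ^ 2 * ‖sg z ^ 4 / (1 - sg z ^ 2)‖ ^ 2) Up := p1.const_mul _
  have i2 : IntegrableOn (fun z => L * (1 / N) ^ (12 / 5 : ℝ) * (‖sg z‖ ^ 4 * ‖1 - sg z ^ 2‖ ^ (-(18 / 5) : ℝ))) Up := p3.const_mul _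
  have i3 : IntegrableOn (fun z => ‖cauchy α z - sg z‖ ^ 2 - a ^ 2 * (1 / N) ^ 2 * ‖sg z ^ 4 / (1 - sg z ^ 2)‖ ^ 2) Up := by
    refine Integrable.mono' i2 (hm.sub i1.aestronglyMeasurable) ?_
    filter_upwards [ae_restrict_mem Up_meas] with z hz using hb z hz
  have i4 : IntegrableOn (fun z => ‖cauchy α z - sg z‖ ^ 2) Up := by
    refine (iadd i3 i1).congr (Eventually.of_forall fun z => ?_)
    simp
  rw [Up_fubini i4]
  have e1 : |∫ z in Up, (‖cauchy α z - sg z‖ ^ 2 - a ^ 2 * (1 / N) ^ 2 * ‖sg z ^ 4 / (1 - sg z ^ 2)‖ ^ 2)|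
      ≤ L * (1 / N) ^ (12 / 5 : ℝ) * I0 := by
    rw [← Real.norm_eq_abs, hI0, ← integral_const_mul]
    refine norm_integral_le_of_norm_le i2 ?_
    filter_upwards [ae_restrict_mem Up_meas] with z hz using hb z hz
  rw [integral_sub i4 i1, integral_const_mul, p2] at e1
  have hpi := Real.pi_pos
  have e2 : (1 / Real.pi) * (∫ z in Up, ‖cauchy α z - sg z‖ ^ 2) - a ^ 2 / (6 * N ^ 2)
      = (1 / Real.pi) * ((∫ z in Up, ‖cauchy α z - sg z‖ ^ 2) - a ^ 2 * (1 / N) ^ 2 * (Real.pi / 6)) := by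
    have hN0 : 0 < N := by linarith [h.2.1, h.2.2.1]
    field_simp
  rw [e2, abs_mul, abs_of_pos (by positivity)]
  calc _ ≤ 1 / Real.pi * (L * (1 / N) ^ (12 / 5 : ℝ) * I0) := by gcongr
    _ = _ := by ring

lemma tail_s {s q X : ℝ} (q0 : 0 < q) (q1 : q ≤ 1) (hs : 1 ≤ s * (1 + q ^ 2)) (hs0 : 0 < s)
    (hX : X ≤ s + (1 + q ^ 2) / s) (hX2 : 2 + 10 * q ^ 2 ≤ X) : 1 + 2 * q ≤ s := by
  have h1 : X * s ≤ s ^ 2 + (1 + q ^ 2) := by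
    calc X * s ≤ (s + (1 + q ^ 2) / s) * s := by gcongr
      _ = _ := by field_simp
  have h2 : (2 + 10 * q ^ 2) * s ≤ s ^ 2 + (1 + q ^ 2) := le_trans (by gcongr) h1
  have q2 : q ^ 2 ≤ 1 := by nlinarith
  have hs2 : 1 / 2 ≤ s := by nlinarith
  have h3 : 4 * q ^ 2 ≤ (s - 1) ^ 2 := by nlinarith [mul_le_mul_of_nonneg_left hs2 (sq_nonneg q)]
  by_contra hc
  push Not at hc
  rcases le_total 1 s with h | h
  · nlinarith
  · have h4 : 1 - s ≤ q ^ 2 := by nlinarith [mul_le_mul_of_nonneg_right h (sq_nonneg q)]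
    have h5 : 1 - s ≤ q := by nlinarith
    nlinarith

lemma tail_v {v s y N K q S R : ℝ} (v0 : 0 < v) (q0 : 0 < q) (q1 : q ≤ 1) (hs : 1 + 2 * q ≤ s)
    (N0 : 0 < N) (hq : q ^ 2 = 6 * K / N) (S0 : 0 ≤ S) (y0 : 0 < y) (R0 : 0 ≤ R) (hR : R ^ 2 = K / q)
    (hS : S ≤ (1 + K / (N * s)) / (N * s) ^ 2 + K / ((N * s) ^ 6 * v ^ 2))
    (he : N * y = v * (1 - (N ^ 2 - 1) * S)) : v ≤ 4 * (N * y / q) + 2 * (R / (N ^ 2 * s ^ 3)) := by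
  have s0 : 0 < s := by linarith
  have hK : K = q ^ 2 * N / 6 := by rw [hq]; field_simp
  have h1 : N ^ 2 * S ≤ (1 - q / 2) + K / (N ^ 4 * s ^ 6 * v ^ 2) := by
    calc N ^ 2 * S ≤ N ^ 2 * ((1 + K / (N * s)) / (N * s) ^ 2 + K / ((N * s) ^ 6 * v ^ 2)) := by gcongr
      _ = (1 + K / (N * s)) / s ^ 2 + K / (N ^ 4 * s ^ 6 * v ^ 2) := by field_simp
      _ ≤ _ := by
        gcongr
        rw [div_le_iff₀ (by positivity)]
        have : K / (N * s) ≤ q ^ 2 / 6 := by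
          rw [hK, div_le_iff₀ (by positivity)]
          have : 0 ≤ q ^ 2 * N * (s - 1) := mul_nonneg (by positivity) (by linarith)
          nlinarith
        have h2 : (1 + 2 * q) ^ 2 ≤ s ^ 2 := by gcongr
        have h3 : (1 - q / 2) * (1 + 2 * q) ^ 2 ≤ (1 - q / 2) * s ^ 2 := mul_le_mul_of_nonneg_left h2 (by linarith)
        have h4 : q ^ 3 ≤ q ^ 2 := by nlinarith [sq_nonneg q]
        nlinarith
  set A := R / (N ^ 2 * s ^ 3) with hA
  set B := N * y / q with hB
  have hB0 : 0 ≤ B := by positivity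
  have hA0 : 0 ≤ A := by positivity
  have hA2 : q * A ^ 2 = K / (N ^ 4 * s ^ 6) := by
    rw [hA, div_pow, hR]; field_simp
  have h2 : v * (q / 2) ≤ N * y + q * A ^ 2 / v := by
    have e : q * A ^ 2 / v = v * (K / (N ^ 4 * s ^ 6 * v ^ 2)) := by
      rw [hA2]; field_simp
    rw [e, he]
    nlinarith [mul_le_mul_of_nonneg_left h1 v0.le, mul_nonneg v0.le S0]
  have h3 : v ^ 2 / 2 ≤ B * v + A ^ 2 := by
    have h4 : v * (q / 2) * v ≤ (N * y + q * A ^ 2 / v) * v := by gcongr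
    have e : (N * y + q * A ^ 2 / v) * v = q * (B * v + A ^ 2) := by
      rw [hB]; field_simp
    rw [e] at h4
    have : q * (v ^ 2 / 2) ≤ q * (B * v + A ^ 2) := by linarith
    exact le_of_mul_le_mul_left this q0
  by_contra hc
  push Not at hc
  have : A ^ 2 < v ^ 2 / 4 := by nlinarith
  nlinarith

lemma tail_pt {a K N : ℝ} {α : Measure ℝ} (h : Good a K N α) {x y q R : ℝ} (y0 : 0 < y)
    (q0 : 0 < q) (hq : q ^ 2 = 6 * K / N) (R0 : 0 ≤ R) (hR : R ^ 2 = K / q)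
    (hx : 2 + 60 * K / N ≤ |x|) :
    -(cauchy α (x + y * I)).im ≤ 72 / (N * x ^ 2) * (4 * (N * y / q)) + 3888 * R / (N ^ 3 * |x| ^ 5) := by
  obtain ⟨_, hK, hN, h⟩ := h
  have hz : 0 < ((x : ℂ) + y * I).im := by simpa using y0
  obtain ⟨w, F, S, hs, he⟩ := h _ hz
  have N0 : 0 < N := by linarith
  have N8 : 8 ≤ N := by linarith
  have q1 : q ≤ 1 := by
    have : q ^ 2 ≤ 1 := by rw [hq, div_le_one N0]; linarith
    nlinarith
  have w0 : 0 < ‖w‖ := by linarith [hs.wN]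
  set s := ‖w‖ / N with hsd
  have s0 : 0 < s := by positivity
  have hwN : ‖w‖ = N * s := by rw [hsd]; field_simp
  have ht : ‖(N : ℂ) / w‖ = 1 / s := by
    rw [norm_div, Complex.norm_real, Real.norm_of_nonneg N0.le, hwN]; field_simp
  have ht' : ‖w / (N : ℂ)‖ = s := by
    rw [norm_div, Complex.norm_real, Real.norm_of_nonneg N0.le]
  have k1 : 1 ≤ s * (1 + q ^ 2) := by
    have := hs.tn
    rw [ht, ← hq, div_le_iff₀ s0] at this
    linarith
  have k2 : |x| ≤ s + (1 + q ^ 2) / s := by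
    have r1 := hs.r1
    rw [ht, ← hq] at r1
    have hxz : |x| ≤ ‖(x : ℂ) + y * I‖ := by
      have := Complex.abs_re_le_norm ((x : ℂ) + y * I)
      simpa using this
    have t1 : ‖(x : ℂ) + y * I‖ ≤ ‖(N : ℂ) / w + w / N‖ + ‖(N : ℂ) / w + w / N - (x + y * I)‖ := by
      have := norm_sub_le ((N : ℂ) / w + w / N) ((N : ℂ) / w + w / N - (x + y * I))
      rwa [sub_sub_cancel] at this
    have t2 := norm_add_le ((N : ℂ) / w) (w / N)
    rw [ht, ht'] at t2
    have e : s + (1 + q ^ 2) / s = s + 1 / s + q ^ 2 * (1 / s) := by ring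
    rw [e]; linarith
  have k3 : 2 + 10 * q ^ 2 ≤ |x| := by
    rw [hq]; refine le_trans (le_of_eq ?_) hx; ring
  have k4 := tail_s q0 q1 k1 s0 k2 k3
  have hx3 : |x| ≤ 3 * s := by
    have : (1 + q ^ 2) / s ≤ 2 := by
      rw [div_le_iff₀ s0]; nlinarith
    linarith
  have x0 : 0 < |x| := by nlinarith
  have hsx : |x| / 3 ≤ s := by linarith
  have S1 : S ≤ 1 := by
    have h1 := hs.SN
    have h2 : 2 / N ≤ 1 := by rw [div_le_one N0]; linarith
    have h3 := h1.trans h2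
    rwa [Real.sqrt_le_one] at h3
  have c4 := hs.c4 (by rw [hwN]; nlinarith) S1
  rw [hwN] at c4
  have zim := hs.zim
  have e1 : ((x : ℂ) + y * I).im = y := by simp
  rw [e1] at zim
  have hv := tail_v hs.wim q0 q1 k4 N0 hq hs.S0 y0 R0 hR c4 zim
  have hv2 : w.im ≤ 4 * (N * y / q) + 54 * R / (N ^ 2 * |x| ^ 3) := by
    refine hv.trans (add_le_add le_rfl ?_)
    calc 2 * (R / (N ^ 2 * s ^ 3)) ≤ 2 * (R / (N ^ 2 * (|x| / 3) ^ 3)) := by gcongr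
      _ = _ := by field_simp; ring
  have hFn : N * |x| / 6 ≤ ‖F‖ := by
    have := hs.Fw
    rw [hwN] at this
    nlinarith
  have hF0 : 0 < N * |x| / 6 := by positivity
  rw [he]
  have e2 : -((N : ℂ) / F).im = N * F.im / ‖F‖ ^ 2 := by
    rw [div_eq_mul_inv, Complex.im_ofReal_mul, Complex.inv_im, Complex.normSq_eq_norm_sq]; ring
  rw [e2, hs.Fim]
  have := hs.wim
  have := hs.S0
  calc N * (w.im * (1 + S)) / ‖F‖ ^ 2 ≤ N * (w.im * (1 + 1)) / (N * |x| / 6) ^ 2 := by gcongr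
    _ = 72 / (N * x ^ 2) * w.im := by rw [← sq_abs x]; field_simp; norm_num
    _ ≤ 72 / (N * x ^ 2) * (4 * (N * y / q) + 54 * R / (N ^ 2 * |x| ^ 3)) := by gcongr
    _ = _ := by rw [← sq_abs x]; field_simp; ring

lemma inv_lim {p : ℝ → ℝ} (hp : Continuous p) (hp0 : ∀ x, 0 ≤ p x)
    {α : Measure ℝ} (hpr : IsProbabilityMeasure α)
    (hα : α = volume.withDensity (fun x => ENNReal.ofReal (p x))) (x : ℝ) :
    Tendsto (fun c : ℝ => Real.pi⁻¹ * -(cauchy α (x + (c⁻¹ : ℝ) * I)).im) atTop (𝓝 (p x)) := by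
  have hpi : Integrable p := by
    have h1 : Integrable (fun _ : ℝ => (1 : ℝ)) α := integrable_const _
    rw [hα, wd_integrable p _ hp hp0] at h1
    simpa using h1
  have h := tendsto_integral_comp_smul_smul_of_integrable' (μ := (volume : Measure ℝ))
    (φ := fun u : ℝ => Real.pi⁻¹ * (1 + u ^ 2)⁻¹) (g := p) (x₀ := x)
    (fun u => by positivity) ?_ ?_ hpi hp.continuousAt
  · refine h.congr' ?_
    filter_upwards [eventually_gt_atTop 0] with c hc
    have hz : 0 < ((x : ℂ) + (c⁻¹ : ℝ) * I).im := by simpa using hc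
    rw [cauchy_im α hz, neg_neg]
    have e1 : ((x : ℂ) + (c⁻¹ : ℝ) * I).im = c⁻¹ := by simp
    rw [e1, hα, wd_int p _ hp hp0, ← integral_const_mul]
    congr 1; ext u
    rw [norm_line]
    simp only [Module.finrank_self, smul_eq_mul, pow_one]
    have : (x - u) ^ 2 + c⁻¹ ^ 2 ≠ 0 := by positivity
    have : 1 + (c * (x - u)) ^ 2 ≠ 0 := by positivity
    field_simp
    ring
  · rw [integral_const_mul, integral_univ_inv_one_add_sq, inv_mul_cancel₀ Real.pi_ne_zero]
  · simp only [Module.finrank_self, pow_one]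
    refine squeeze_zero (fun u => by positivity) (fun u => ?_)
      (tendsto_norm_cobounded_atTop (E := ℝ)).inv_tendsto_atTop
    rcases eq_or_ne u 0 with rfl | hu
    · simp
    · have hu' : 0 < ‖u‖ := norm_pos_iff.mpr hu
      have h1 : Real.pi⁻¹ ≤ 1 := inv_le_one_of_one_le₀ (by linarith [Real.pi_gt_three])
      have h2 : (1 + u ^ 2)⁻¹ ≤ (‖u‖ ^ 2)⁻¹ := by
        rw [Real.norm_eq_abs, sq_abs]
        exact inv_anti₀ (by positivity) (by linarith)
      calc ‖u‖ * (Real.pi⁻¹ * (1 + u ^ 2)⁻¹) ≤ ‖u‖ * (1 * (‖u‖ ^ 2)⁻¹) := by gcongr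
        _ = ‖u‖⁻¹ := by field_simp

lemma dens_bd {a K N : ℝ} {α : Measure ℝ} (h : Good a K N α) {p : ℝ → ℝ} (hp : Continuous p) (hp0 : ∀ x, 0 ≤ p x)
    (hα : α = volume.withDensity (fun x => ENNReal.ofReal (p x))) (x : ℝ) : p x ≤ 4 := by
  refine le_of_tendsto (inv_lim hp hp0 h.1 hα x) ?_
  filter_upwards [eventually_gt_atTop 0] with c hc
  have h1 : Real.pi⁻¹ ≤ 1 := inv_le_one_of_one_le₀ (by linarith [Real.pi_gt_three])
  have h2 : (0:ℝ) ≤ Real.pi⁻¹ := by positivity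
  have h3 := good_bd h (z := (x : ℂ) + (c⁻¹ : ℝ) * I) (by simpa using hc)
  have h4 := (neg_le_abs _).trans ((Complex.abs_im_le_norm (cauchy α ((x : ℂ) + (c⁻¹ : ℝ) * I))).trans h3)
  nlinarith

lemma dens_tail {a K N : ℝ} {α : Measure ℝ} (h : Good a K N α) {p : ℝ → ℝ} (hp : Continuous p) (hp0 : ∀ x, 0 ≤ p x)
    (hα : α = volume.withDensity (fun x => ENNReal.ofReal (p x))) {x q R : ℝ}
    (q0 : 0 < q) (hq : q ^ 2 = 6 * K / N) (R0 : 0 ≤ R) (hR : R ^ 2 = K / q)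
    (hx : 2 + 60 * K / N ≤ |x|) : p x ≤ 3888 * R / (N ^ 3 * |x| ^ 5) := by
  have hl : Tendsto (fun c : ℝ => 72 / (N * x ^ 2) * (4 * (N * c⁻¹ / q)) + 3888 * R / (N ^ 3 * |x| ^ 5)) atTop
      (𝓝 (72 / (N * x ^ 2) * (4 * (N * 0 / q)) + 3888 * R / (N ^ 3 * |x| ^ 5))) :=
    ((((tendsto_inv_atTop_zero.const_mul N).div_const q).const_mul 4).const_mul _).add_const _
  have := le_of_tendsto_of_tendsto (inv_lim hp hp0 h.1 hα x) hl ?_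
  · simpa using this
  · filter_upwards [eventually_gt_atTop 0] with c hc
    have h1 : Real.pi⁻¹ ≤ 1 := inv_le_one_of_one_le₀ (by linarith [Real.pi_gt_three])
    have hpr := h.1
    have h2 := (cauchy_im_neg α (z := (x : ℂ) + (c⁻¹ : ℝ) * I) (by simpa using hc)).le
    refine le_trans ?_ (tail_pt h (inv_pos.mpr hc) q0 hq R0 hR hx)
    nlinarith

lemma near_H {K N x : ℝ} (hK : 1 ≤ K) (hN : 8 * K ≤ N) (h2 : 2 < |x|) (hx : |x| ≤ 2 + 60 * K / N) :
    Hf x ≤ (√(720 * K / N)) ^ 3 / 4 := by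
  refine (Hf_out h2).2.2.trans ?_
  have N0 : 0 < N := by linarith
  have h1 : 60 * K / N ≤ 8 := by rw [div_le_iff₀ N0]; linarith
  have e : 720 * K / N = 12 * (60 * K / N) := by ring
  gcongr
  rw [← sq_abs x, e]
  nlinarith

lemma excess (K : ℝ) (hK : 1 ≤ K) : ∃ c : ℝ, 0 ≤ c ∧ ∀ (a N : ℝ) (α : Measure ℝ) (p : ℝ → ℝ), Good a K N α → Continuous p →
    (∀ x, 0 ≤ p x) → α = volume.withDensity (fun x => ENNReal.ofReal (p x)) →
    |∫ x, Hf x ∂α| ≤ c * (1 / N) ^ (5 / 2 : ℝ) := by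
  refine ⟨120 * K * √(720 * K) ^ 3 * 1 + 972 * K * Real.pi, by positivity, fun a N α p h hp hp0 hα => ?_⟩
  obtain ⟨_, _, hN, _⟩ := id h
  have N0 : 0 < N := by linarith
  have N1 : 1 ≤ N := by linarith
  set q := √(6 * K / N) with hqd
  have q0 : 0 < q := Real.sqrt_pos.mpr (by positivity)
  have hq : q ^ 2 = 6 * K / N := Real.sq_sqrt (by positivity)
  set R := √(K / q) with hRd
  have R0 : 0 ≤ R := Real.sqrt_nonneg _
  have hR : R ^ 2 = K / q := Real.sq_sqrt (by positivity)
  have s0 : 0 < √N := Real.sqrt_pos.mpr N0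
  have ss : √N ^ 2 = N := Real.sq_sqrt N0.le
  have s1 : 1 ≤ √N := Real.one_le_sqrt.mpr N1
  have hRle : R ≤ K * √N := by
    have h1 : 1 / √N ≤ q := by
      have e1 : 1 / √N = √(1 / N) := by rw [Real.sqrt_div' _ N0.le, Real.sqrt_one]
      rw [hqd, e1]
      refine Real.sqrt_le_sqrt ?_
      gcongr; linarith
    have h2 : K / q ≤ K * √N := by
      calc K / q ≤ K / (1 / √N) := by gcongr
        _ = _ := by field_simp
    rw [hRd, Real.sqrt_le_left (by positivity)]
    refine h2.trans ?_
    have : 1 ≤ K * √N := by nlinarith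
    nlinarith
  have e5 : (1 / N) ^ (5 / 2 : ℝ) = √N / N ^ 3 := by
    rw [Real.sqrt_eq_rpow, ← Real.rpow_natCast, ← Real.rpow_sub N0, one_div, Real.inv_rpow N0.le, ← Real.rpow_neg N0.le]
    norm_num
  set δ := 60 * K / N with hδ
  have hδ0 : 0 < δ := by positivity
  set A := √(720 * K / N) ^ 3 with hA
  have hA0 : 0 ≤ A := by positivity
  set B := 972 * K * √N / N ^ 3 with hB
  have hB0 : 0 ≤ B := by positivity
  have hne : ∀ᵐ x : ℝ, |x| ≠ 2 := by
    have h1 : ∀ᵐ x : ℝ, x ≠ 2 := by simp [ae_iff]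
    have h2 : ∀ᵐ x : ℝ, x ≠ -2 := by simp [ae_iff]
    filter_upwards [h1, h2] with x h3 h4 h5
    rcases eq_or_eq_neg_of_abs_eq h5 with h | h
    · exact h3 h
    · exact h4 h
  have hpt : ∀ᵐ x : ℝ, ‖p x * Hf x‖ ≤ (Icc 2 (2 + δ)).indicator (fun _ => A) x
      + (Icc (-(2 + δ)) (-2)).indicator (fun _ => A) x + B * (1 + x ^ 2)⁻¹ := by
    filter_upwards [hne] with x hx
    have hi1 : 0 ≤ (Icc 2 (2 + δ)).indicator (fun _ => A) x := indicator_nonneg (fun _ _ => hA0) x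
    have hi2 : 0 ≤ (Icc (-(2 + δ)) (-2)).indicator (fun _ => A) x := indicator_nonneg (fun _ _ => hA0) x
    have hi3 : 0 ≤ B * (1 + x ^ 2)⁻¹ := by positivity
    rcases lt_or_gt_of_ne hx with h2 | h2
    · rw [Hf_in h2]; simp only [mul_zero, norm_zero]; positivity
    · have H0 := (Hf_out h2).1
      rw [Real.norm_of_nonneg (mul_nonneg (hp0 x) H0)]
      rcases le_total |x| (2 + δ) with h3 | h3
      · have h4 := near_H hK hN h2 h3
        have h5 : p x * Hf x ≤ A := by
          calc p x * Hf x ≤ 4 * (A / 4) := mul_le_mul (dens_bd h hp hp0 hα x) h4 H0 (by norm_num)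
            _ = A := by ring
        rcases le_total 0 x with h6 | h6
        · rw [abs_of_nonneg h6] at h2 h3
          rw [indicator_of_mem (show x ∈ Icc 2 (2 + δ) from ⟨h2.le, h3⟩)]
          linarith
        · rw [abs_of_nonpos h6] at h2 h3
          rw [indicator_of_mem (show x ∈ Icc (-(2 + δ)) (-2) from ⟨by linarith, by linarith⟩)]
          linarith
      · have h4 := dens_tail h hp hp0 hα q0 hq R0 hR h3
        have h5 := (Hf_out h2).2.1
        have x0 : 0 < |x| := by linarith
        have h6 : 1 + x ^ 2 ≤ |x| ^ 3 := by rw [← sq_abs x]; nlinarith [sq_nonneg |x|]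
        have h7 : p x * Hf x ≤ B * (1 + x ^ 2)⁻¹ := by
          calc p x * Hf x ≤ 3888 * (K * √N) / (N ^ 3 * |x| ^ 5) * (x ^ 2 / 4) := by
                refine mul_le_mul (h4.trans (by gcongr)) h5 H0 (by positivity)
            _ = B * (|x| ^ 3)⁻¹ := by rw [← sq_abs x, hB]; field_simp; norm_num
            _ ≤ _ := by gcongr
        linarith
  have g1 : Integrable ((Icc 2 (2 + δ)).indicator (fun _ : ℝ => A)) :=
    (integrable_indicator_iff measurableSet_Icc).mpr (integrableOn_const (by simp))
  have g2 : Integrable ((Icc (-(2 + δ)) (-2)).indicator (fun _ : ℝ => A)) :=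
    (integrable_indicator_iff measurableSet_Icc).mpr (integrableOn_const (by simp))
  have g3 : Integrable (fun x : ℝ => B * (1 + x ^ 2)⁻¹) := integrable_inv_one_add_sq.const_mul B
  rw [hα, wd_int p _ hp hp0, ← Real.norm_eq_abs]
  refine (norm_integral_le_of_norm_le (iadd (iadd g1 g2) g3) hpt).trans ?_
  rw [integral_add (iadd g1 g2) g3, integral_add g1 g2, integral_const_mul, integral_univ_inv_one_add_sq,
    integral_indicator measurableSet_Icc, integral_indicator measurableSet_Icc, setIntegral_const, setIntegral_const,
    Real.volume_real_Icc_of_le (by linarith), Real.volume_real_Icc_of_le (by linarith), e5]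
  have hA2 : A ≤ √(720 * K) ^ 3 * (√N / N ^ 2) := by
    rw [hA, Real.sqrt_div' _ N0.le, div_pow]
    have : √N / N ^ 2 = 1 / √N ^ 3 := by
      rw [div_eq_div_iff (by positivity) (by positivity)]
      nlinarith
    rw [this, mul_one_div]
  simp only [smul_eq_mul]
  have e6 : (2 + δ - 2) * A + (-2 - -(2 + δ)) * A = 2 * δ * A := by ring
  rw [e6]
  have e7 : 2 * δ * A ≤ 2 * δ * (√(720 * K) ^ 3 * (√N / N ^ 2)) := by gcongr
  refine (add_le_add e7 le_rfl).trans (le_of_eq ?_)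
  rw [hδ, hB]; field_simp; ring

theorem stmt_3
    (μ : Measure ℝ) [IsProbabilityMeasure μ]
    (hnotdirac : ¬ ∃ c : ℝ, μ = Measure.dirac c)
    (h8 : Integrable (fun u => u ^ 8) μ)
    (h1 : mom μ 1 = 0) (h2 : mom μ 2 = 1)
    (Z : ℕ → ℂ → ℂ) (ν : ℕ → Measure ℝ)
    (hbox : ∀ n : ℕ, 1 ≤ n → IsBoxPow μ n (Z n) (ν n))
    (p : ℕ → ℝ → ℝ)
    (hp : ∀ᶠ n in atTop, HasDensity (rescale n (ν n)) (p n)) :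
    ∃ c : ℝ, 0 < c ∧ ∃ n₁ : ℕ, ∀ n : ℕ, n₁ ≤ n →
      |((∫ x : ℝ, ∫ y : ℝ, Real.log |x - y| * p n x * p n y)
          + 3 / 4 + (1 / 2) * Real.log (2 * Real.pi))
        - ((1 / 2) * Real.log (2 * Real.pi * Real.exp 1) - (mom μ 3) ^ 2 / (6 * n))|
        ≤ c * (n : ℝ) ^ (-(6 / 5 : ℝ)) := by
  obtain ⟨K, hK, hgood⟩ := good_of μ h8 h1 h2 Z ν hbox
  set C := max (6 * K) |mom μ 3| with hC
  obtain ⟨cD, hcD, hD⟩ := D_est (mom μ 3) K C (le_max_left _ _) (le_max_right _ _)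
  obtain ⟨cE, hcE, hE⟩ := excess K hK
  obtain ⟨n₀, hn₀⟩ := eventually_atTop.mp hp
  refine ⟨2 * cE + cD + 1, by positivity, max n₀ (max 1 ⌈(max (8 * K) (256 * C ^ 2)) ^ 2⌉₊), fun n hn => ?_⟩
  have hn1 : 1 ≤ n := ((le_max_left _ _).trans (le_max_right _ _)).trans hn
  have hnL : ⌈(max (8 * K) (256 * C ^ 2)) ^ 2⌉₊ ≤ n := ((le_max_right _ _).trans (le_max_right _ _)).trans hn
  have hNL : max (8 * K) (256 * C ^ 2) ≤ √(n : ℝ) := Real.le_sqrt_of_sq_le (Nat.ceil_le.mp hnL)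
  have hG := hgood n hn1 ((le_max_left _ _).trans hNL)
  obtain ⟨hpc, hp0, hα⟩ := hn₀ n ((le_max_left _ _).trans hn)
  have d1 := hD _ _ hG ((le_max_right _ _).trans hNL)
  have d2 := hE _ _ _ _ hG hpc hp0 hα
  have hnice := good_nice hG
  obtain ⟨-, d3⟩ := energyD hnice (good_sq hG).2
  rw [energy_log hpc hp0 (dens_bd hG hpc hp0 hα) hα hnice, d3]
  have n0 : (0 : ℝ) < n := by exact_mod_cast hn1
  have n1 : (1 : ℝ) ≤ n := by exact_mod_cast hn1
  have N0 : 0 < √(n : ℝ) := Real.sqrt_pos.mpr n0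
  have N1 : 1 ≤ √(n : ℝ) := Real.one_le_sqrt.mpr n1
  rw [Real.sq_sqrt n0.le] at d1
  have ep : (1 / √(n : ℝ)) ^ (12 / 5 : ℝ) = (n : ℝ) ^ (-(6 / 5 : ℝ)) := by
    rw [one_div, Real.inv_rpow N0.le, Real.sqrt_eq_rpow, ← Real.rpow_mul n0.le, ← Real.rpow_neg n0.le]
    norm_num
  have ep2 : (1 / √(n : ℝ)) ^ (5 / 2 : ℝ) ≤ (1 / √(n : ℝ)) ^ (12 / 5 : ℝ) :=
    Real.rpow_le_rpow_of_exponent_ge (by positivity) (by rw [div_le_one N0]; exact N1) (by norm_num)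
  rw [ep] at ep2 d1
  have hpos : 0 < (n : ℝ) ^ (-(6 / 5 : ℝ)) := by positivity
  have d4 := d2.trans (mul_le_mul_of_nonneg_left ep2 hcE)
  have hlog : Real.log (2 * Real.pi * Real.exp 1) = Real.log (2 * Real.pi) + 1 := by
    rw [Real.log_mul (by positivity) (by positivity), Real.log_exp]
  rw [hlog]
  generalize (n : ℝ) ^ (-(6 / 5 : ℝ)) = r at *
  rw [abs_le] at d1 d4 ⊢
  constructor <;> nlinarith

end FreeCLT
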